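/- arXiv:0805.3788 — 6 statements merged into one kernel-verified Lean document; each statement's English description precedes it below -/
import Mathlib

section
/- Fix an integer r ≥ 1, let S = {(2^m + j) + α/2^{(m+1)r} : m, j, α ∈ ℕ, 0 ≤ j < 2^m, 0 ≤ α < 2^{(m+1)r}} ⊆ ℚ, and for a positive integer y let f(y) = Σ_{n=1}^{y−1} n^r. For every positive integer c and every positive integer y: #((1/c)·S ∩ [0, y)) = #(S ∩ [0, c·y)); in particular, if c·y ≥ 2 then f(c·y) < #((1/c)·S ∩ [0, y)) ≤ 2^r·f(c·y). -/
/-- The semigroup `S` of Example 3, for a given `r`. -/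
def exS (r : ℕ) : Set ℚ :=
  {q : ℚ | ∃ m j α : ℕ, j < 2 ^ m ∧ α < 2 ^ ((m + 1) * r) ∧
    q = (2 ^ m + j : ℚ) + (α : ℚ) / 2 ^ ((m + 1) * r)}

/-- `f(y) = Σ_{n=1}^{y-1} n^r`. -/
def exf (r y : ℕ) : ℕ := ∑ n ∈ Finset.Ico 1 y, n ^ r

/-- The number of elements of `exS r` in `[n, n + 1)`, for `n ≥ 1`. -/
def exCount (r n : ℕ) : ℕ := 2 ^ ((Nat.log 2 n + 1) * r)

/-- The `α`-th element of `exS r` in `[n, n + 1)`. -/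
def exPoint (r : ℕ) (p : (_ : ℕ) × ℕ) : ℚ := (p.1 : ℚ) + (p.2 : ℚ) / (exCount r p.1 : ℚ)

lemma exCount_pos (r n : ℕ) : 0 < exCount r n := by
  unfold exCount; positivity

lemma floor_exPoint {r n α : ℕ} (hα : α < exCount r n) : ⌊exPoint r ⟨n, α⟩⌋₊ = n := by
  have hpos : (0 : ℚ) < exCount r n := by exact_mod_cast exCount_pos r n
  have hlt : (α : ℚ) / exCount r n < 1 := by
    rw [div_lt_one hpos]; exact_mod_cast hα
  have hnonneg : (0 : ℚ) ≤ (α : ℚ) / exCount r n := by positivity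
  rw [Nat.floor_eq_iff (by unfold exPoint; positivity)]
  simp only [exPoint]
  constructor <;> linarith

lemma mem_exS_iff {r : ℕ} {q : ℚ} :
    q ∈ exS r ↔ ∃ n α : ℕ, 1 ≤ n ∧ α < exCount r n ∧ exPoint r ⟨n, α⟩ = q := by
  constructor
  · rintro ⟨m, j, α, hj, hα, rfl⟩
    have hlog : Nat.log 2 (2 ^ m + j) = m :=
      Nat.log_eq_of_pow_le_of_lt_pow (by omega) (by rw [pow_succ]; omega)
    refine ⟨2 ^ m + j, α, ?_, ?_, ?_⟩
    · have := Nat.one_le_two_pow (n := m)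
      omega
    · rwa [exCount, hlog]
    · simp only [exPoint, exCount, hlog]
      push_cast
      rfl
  · rintro ⟨n, α, hn, hα, rfl⟩
    have hle : 2 ^ Nat.log 2 n ≤ n := Nat.pow_log_le_self 2 (by omega)
    have hlt : n < 2 ^ (Nat.log 2 n + 1) := Nat.lt_pow_succ_log_self (by norm_num) n
    refine ⟨Nat.log 2 n, n - 2 ^ Nat.log 2 n, α, ?_, hα, ?_⟩
    · rw [pow_succ] at hlt
      omega
    · simp only [exPoint, exCount]
      push_cast [hle]
      ring

lemma exS_inter_Ico_eq_image (r N : ℕ) :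
    {q : ℚ | q ∈ exS r ∧ 0 ≤ q ∧ q < (N : ℚ)} =
      exPoint r '' ((Finset.Ico 1 N).sigma fun n => Finset.range (exCount r n)) := by
  ext q
  simp only [Set.mem_ofPred_eq, mem_exS_iff, Set.mem_image, Finset.mem_coe, Finset.mem_sigma,
    Finset.mem_Ico, Finset.mem_range, Sigma.exists]
  constructor
  · rintro ⟨⟨n, α, hn, hα, rfl⟩, h0, hN⟩
    refine ⟨n, α, ⟨⟨hn, ?_⟩, hα⟩, rfl⟩
    rwa [← Nat.floor_lt h0, floor_exPoint hα] at hN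
  · rintro ⟨n, α, ⟨⟨hn, hN⟩, hα⟩, rfl⟩
    have h0 : 0 ≤ exPoint r ⟨n, α⟩ := by unfold exPoint; positivity
    refine ⟨⟨n, α, hn, hα, rfl⟩, h0, ?_⟩
    rwa [← Nat.floor_lt h0, floor_exPoint hα]

lemma exPoint_injOn (r N : ℕ) :
    Set.InjOn (exPoint r) ((Finset.Ico 1 N).sigma fun n => Finset.range (exCount r n)) := by
  rintro ⟨n, α⟩ hp ⟨n', α'⟩ hp' h
  simp only [Finset.mem_coe, Finset.mem_sigma, Finset.mem_range] at hp hp'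
  obtain rfl : n = n' := by rw [← floor_exPoint hp.2, h, floor_exPoint hp'.2]
  have hne : (exCount r n : ℚ) ≠ 0 := by exact_mod_cast (exCount_pos r n).ne'
  simp only [exPoint, add_right_inj, div_left_inj' hne, Nat.cast_inj] at h
  rw [h]

lemma ncard_exS_inter_Ico (r N : ℕ) :
    {q : ℚ | q ∈ exS r ∧ 0 ≤ q ∧ q < (N : ℚ)}.ncard = ∑ n ∈ Finset.Ico 1 N, exCount r n := by
  rw [exS_inter_Ico_eq_image, (exPoint_injOn r N).ncard_image, Set.ncard_coe_finset,
    Finset.card_sigma]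
  simp

lemma pow_lt_exCount {r : ℕ} (hr : 1 ≤ r) (n : ℕ) : n ^ r < exCount r n := by
  rw [exCount, pow_mul]
  exact Nat.pow_lt_pow_left (Nat.lt_pow_succ_log_self (by norm_num) n) (by omega)

lemma exCount_le (r : ℕ) {n : ℕ} (hn : 1 ≤ n) : exCount r n ≤ 2 ^ r * n ^ r := by
  rw [exCount, pow_mul, ← mul_pow, pow_succ']
  gcongr
  exact Nat.pow_log_le_self 2 (by omega)

lemma ncard_div_inter_Ico (A : Set ℚ) {c : ℕ} (hc : 0 < c) (y : ℕ) :
    {q : ℚ | (∃ a ∈ A, q = a / (c : ℚ)) ∧ 0 ≤ q ∧ q < (y : ℚ)}.ncard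
      = {q : ℚ | q ∈ A ∧ 0 ≤ q ∧ q < ((c * y : ℕ) : ℚ)}.ncard := by
  have hc' : (0 : ℚ) < c := by exact_mod_cast hc
  have himage : {q : ℚ | (∃ a ∈ A, q = a / (c : ℚ)) ∧ 0 ≤ q ∧ q < (y : ℚ)}
      = (· / (c : ℚ)) '' {q : ℚ | q ∈ A ∧ 0 ≤ q ∧ q < ((c * y : ℕ) : ℚ)} := by
    have hiff (a : ℚ) : (0 ≤ a / c ∧ a / c < y) ↔ (0 ≤ a ∧ a < ((c * y : ℕ) : ℚ)) := by
      rw [div_lt_iff₀' hc', le_div_iff₀ hc', zero_mul, Nat.cast_mul]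
    ext q
    constructor
    · rintro ⟨⟨a, ha, rfl⟩, h⟩
      exact ⟨a, ⟨ha, (hiff a).1 h⟩, rfl⟩
    · rintro ⟨a, ⟨ha, h⟩, rfl⟩
      exact ⟨⟨a, ha, rfl⟩, (hiff a).2 h⟩
  rw [himage, Set.ncard_image_of_injective _ fun a b h => (div_left_inj' hc'.ne').1 h]

/-- For `r ≥ 1`, positive integers `c` and `y`:
`#((1/c)·S ∩ [0, y)) = #(S ∩ [0, c·y))`, and if moreover `c·y ≥ 2` then
`f(c·y) < #((1/c)·S ∩ [0, y)) ≤ 2^r·f(c·y)`. -/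
theorem stmt11 (r : ℕ) (hr : 1 ≤ r) (c y : ℕ) (hc : 0 < c) (hy : 0 < y) :
    {q : ℚ | (∃ a ∈ exS r, q = a / (c : ℚ)) ∧ 0 ≤ q ∧ q < (y : ℚ)}.ncard
      = {q : ℚ | q ∈ exS r ∧ 0 ≤ q ∧ q < ((c * y : ℕ) : ℚ)}.ncard ∧
    (2 ≤ c * y →
      exf r (c * y) < {q : ℚ | (∃ a ∈ exS r, q = a / (c : ℚ)) ∧ 0 ≤ q ∧ q < (y : ℚ)}.ncard ∧
      {q : ℚ | (∃ a ∈ exS r, q = a / (c : ℚ)) ∧ 0 ≤ q ∧ q < (y : ℚ)}.ncard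
        ≤ 2 ^ r * exf r (c * y)) := by
  rw [ncard_div_inter_Ico _ hc, ncard_exS_inter_Ico]
  refine ⟨rfl, fun h => ⟨?_, ?_⟩⟩
  · exact Finset.sum_lt_sum_of_nonempty (Finset.nonempty_Ico.2 h) fun n _ => pow_lt_exCount hr n
  · rw [exf, Finset.mul_sum]
    exact Finset.sum_le_sum fun n hn => exCount_le r (Finset.mem_Ico.1 hn).1
end

section
/- Let K be a field, let F = K(z) be the rational function field in one variable over K, and let σ : ℤ_{>0} → ℕ be any function. In the polynomial ring F[x,y], define P₀ = x, P₁ = y, and P_{i+1} = z^{σ(i)}·P_i² − x^{2^{i+1}}·P_{i−1} for i ≥ 1. Then deg_y(P_i) = 2^{i−1} for all i ≥ 1, and for every f ∈ F[x,y] and every ℓ ∈ ℕ with deg_y(f) < 2^ℓ, there is a unique finitely supported family (a_α)_{α} of elements of F, indexed by α = (α₀, α₁, …, α_ℓ) ∈ ℕ × {0,1}^ℓ, such that f = Σ_α a_α·x^{α₀}·P₁^{α₁}⋯P_ℓ^{α_ℓ}. -/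
open MvPolynomial

/-- The sequence `P₀ = x`, `P₁ = y`, `P_{i+1} = z^{σ(i)}·P_i² − x^{2^{i+1}}·P_{i−1}` (`i ≥ 1`)
in `F[x,y]`, where `F = K(z)` and `x = X 0`, `y = X 1`, `z = RatFunc.X`. -/
noncomputable def Pseq (K : Type*) [Field K] (σ : ℕ → ℕ) : ℕ → MvPolynomial (Fin 2) (RatFunc K)
  | 0 => X 0
  | 1 => X 1
  | (i + 2) => C ((RatFunc.X : RatFunc K) ^ σ (i + 1)) * (Pseq K σ (i + 1)) ^ 2
      - (X 0) ^ (2 ^ (i + 2)) * Pseq K σ i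

/-- The monomial `x^{α₀}·P₁^{α₁}⋯P_ℓ^{α_ℓ}` attached to `α ∈ ℕ × {0,1}^ℓ`. -/
noncomputable def Pmono (K : Type*) [Field K] (σ : ℕ → ℕ) (ℓ : ℕ)
    (α : ℕ × (Fin ℓ → Bool)) : MvPolynomial (Fin 2) (RatFunc K) :=
  (X 0) ^ α.1 * ∏ i : Fin ℓ, (Pseq K σ (i.1 + 1)) ^ ((α.2 i).toNat)

/-- Sums over `Fin (ℓ + 1) → Bool` of Boolean products split according to the last exponent. -/
theorem sum_mul_prod_pow_toNat_succ {A : Type*} [CommSemiring A] (q : ℕ → A) (ℓ : ℕ)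
    (c : (Fin (ℓ + 1) → Bool) → A) :
    ∑ s, c s * ∏ i : Fin (ℓ + 1), q i ^ (s i).toNat =
      (∑ s : Fin ℓ → Bool,
        c (Fin.snoc (α := fun _ => Bool) s false) * ∏ i : Fin ℓ, q i ^ (s i).toNat) +
      q ℓ * ∑ s : Fin ℓ → Bool,
        c (Fin.snoc (α := fun _ => Bool) s true) * ∏ i : Fin ℓ, q i ^ (s i).toNat := by
  rw [← (Fin.snocEquiv (fun _ : Fin (ℓ + 1) => Bool)).sum_comp, Fintype.sum_prod_type,
    Fintype.sum_bool, add_comm, Finset.mul_sum]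
  simp only [Fin.snocEquiv_apply, Fin.prod_univ_castSucc, Fin.snoc_castSucc, Fin.snoc_last,
    Fin.val_castSucc, Fin.val_last, Bool.toNat_false, Bool.toNat_true, pow_zero, pow_one, mul_one]
  congr 1
  refine Finset.sum_congr rfl fun s _ => ?_
  change _ = q ℓ * (c ((Fin.snocEquiv fun _ => Bool) (true, s)) * _)
  ring

theorem degree_sum_mul_prod_pow_toNat_lt {R : Type*} [CommRing R] [IsDomain R]
    {q : ℕ → Polynomial R} (hdeg : ∀ i, (q i).degree = (2 ^ i : ℕ)) (ℓ : ℕ)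
    (c : (Fin ℓ → Bool) → R) :
    (∑ s, Polynomial.C (c s) * ∏ i : Fin ℓ, q i ^ (s i).toNat).degree < (2 ^ ℓ : ℕ) := by
  induction ℓ with
  | zero => simpa using Polynomial.degree_C_lt
  | succ ℓ ih =>
    rw [sum_mul_prod_pow_toNat_succ q ℓ fun s => Polynomial.C (c s)]
    refine (Polynomial.degree_add_le _ _).trans_lt (max_lt ((ih _).trans ?_) ?_)
    · exact_mod_cast Nat.pow_lt_pow_right (by norm_num) (Nat.lt_succ_self ℓ)
    · rw [Polynomial.degree_mul, hdeg, pow_succ, mul_two, Nat.cast_add]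
      exact WithBot.add_lt_add_left (WithBot.coe_ne_bot) (ih _)

theorem linearIndependent_prod_pow_toNat {R : Type*} [CommRing R] [IsDomain R]
    {q : ℕ → Polynomial R} (hdeg : ∀ i, (q i).degree = (2 ^ i : ℕ)) (ℓ : ℕ) :
    LinearIndependent R fun s : Fin ℓ → Bool => ∏ i : Fin ℓ, q i ^ (s i).toNat := by
  rw [Fintype.linearIndependent_iff]
  simp only [Polynomial.smul_eq_C_mul]
  induction ℓ with
  | zero =>
    intro c hc s
    rw [Fintype.sum_subsingleton _ s] at hc
    simpa using hc
  | succ ℓ ih =>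
    intro c hc
    rw [sum_mul_prod_pow_toNat_succ q ℓ fun s => Polynomial.C (c s)] at hc
    have hlt := degree_sum_mul_prod_pow_toNat_lt hdeg ℓ fun s =>
      c (Fin.snoc (α := fun _ => Bool) s false)
    have htrue : ∑ s : Fin ℓ → Bool, Polynomial.C (c (Fin.snoc (α := fun _ => Bool) s true)) *
        ∏ i : Fin ℓ, q i ^ (s i).toNat = 0 := by
      by_contra hne
      rw [eq_neg_of_add_eq_zero_left hc, Polynomial.degree_neg, Polynomial.degree_mul, hdeg,
        Polynomial.degree_eq_natDegree hne, ← Nat.cast_add, Nat.cast_lt] at hlt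
      omega
    rw [htrue, mul_zero, add_zero] at hc
    intro s
    rw [← Fin.snoc_init_self s]
    cases h : s (Fin.last ℓ)
    · exact ih _ hc _
    · exact ih _ htrue _

theorem mem_span_prod_pow_toNat {R : Type*} [CommRing R] [IsDomain R]
    {q : ℕ → Polynomial R} (hdeg : ∀ i, (q i).degree = (2 ^ i : ℕ))
    (hlead : ∀ i, IsUnit (q i).leadingCoeff) (ℓ : ℕ) {p : Polynomial R}
    (hp : p.degree < (2 ^ ℓ : ℕ)) :
    p ∈ Submodule.span R (Set.range fun s : Fin ℓ → Bool => ∏ i : Fin ℓ, q i ^ (s i).toNat) := by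
  rw [Submodule.mem_span_range_iff_exists_fun]
  simp only [Polynomial.smul_eq_C_mul]
  induction ℓ generalizing p with
  | zero =>
    refine ⟨fun _ => p.coeff 0, ?_⟩
    have h0 : p.degree ≤ 0 := Nat.WithBot.lt_one_iff_le_zero.mp (by simpa using hp)
    simpa using (Polynomial.eq_C_of_degree_le_zero h0).symm
  | succ ℓ ih =>
    obtain ⟨u, hu⟩ := hlead ℓ
    have hmonic : (Polynomial.C (↑u⁻¹ : R) * q ℓ).Monic := by
      rw [Polynomial.Monic, Polynomial.leadingCoeff_mul, Polynomial.leadingCoeff_C, ← hu,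
        Units.inv_mul]
    set d := Polynomial.C (↑u⁻¹ : R) * q ℓ with hd
    have hddeg : d.degree = (2 ^ ℓ : ℕ) := by
      rw [hd, Polynomial.degree_C_mul (Units.ne_zero _), hdeg]
    have hrem : (p %ₘ d).degree < (2 ^ ℓ : ℕ) :=
      hddeg ▸ Polynomial.degree_modByMonic_lt p hmonic
    have hquot : (Polynomial.C (↑u⁻¹ : R) * (p /ₘ d)).degree < (2 ^ ℓ : ℕ) := by
      rw [Polynomial.degree_C_mul (Units.ne_zero _)]
      by_cases h0 : p /ₘ d = 0
      · rw [h0, Polynomial.degree_zero]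
        exact WithBot.bot_lt_coe _
      have hle : d.degree ≤ p.degree := by
        by_contra hlt
        exact h0 ((Polynomial.divByMonic_eq_zero_iff hmonic).mpr (not_le.mp hlt))
      have hadd := Polynomial.degree_add_divByMonic hmonic hle
      rw [← hadd, hddeg, Polynomial.degree_eq_natDegree h0, ← Nat.cast_add, Nat.cast_lt,
        pow_succ] at hp
      rw [Polynomial.degree_eq_natDegree h0, Nat.cast_lt]
      omega
    obtain ⟨a, ha⟩ := ih hrem
    obtain ⟨b, hb⟩ := ih hquot
    refine ⟨fun s => if s (Fin.last ℓ) then b (Fin.init s) else a (Fin.init s), ?_⟩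
    rw [sum_mul_prod_pow_toNat_succ q ℓ fun s => Polynomial.C
      (if s (Fin.last ℓ) then b (Fin.init s) else a (Fin.init s))]
    simp only [Fin.snoc_last, Fin.init_snoc, if_true, Bool.false_eq_true, if_false]
    rw [ha, hb]
    conv_rhs => rw [← Polynomial.modByMonic_add_div p d]
    rw [hd]
    ring

/-- The isomorphism `F[x,y] ≃ F[x][y]`. -/
noncomputable def finTwoAlgEquiv (F : Type*) [CommRing F] :
    MvPolynomial (Fin 2) F ≃ₐ[F] Polynomial (Polynomial F) :=
  ((renameEquiv F (Equiv.swap (0 : Fin 2) 1)).trans (finSuccEquiv F 1)).trans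
    (Polynomial.mapAlgEquiv (uniqueAlgEquiv F (Fin 1)))

theorem finTwoAlgEquiv_X_zero (F : Type*) [CommRing F] :
    finTwoAlgEquiv F (X 0) = Polynomial.C Polynomial.X := by
  have h : finSuccEquiv F 1 (X 1) = Polynomial.C (X 0) := finSuccEquiv_X_succ (j := 0)
  simp [finTwoAlgEquiv, h, uniqueAlgEquiv]

theorem finTwoAlgEquiv_X_one (F : Type*) [CommRing F] :
    finTwoAlgEquiv F (X 1) = Polynomial.X := by
  simp [finTwoAlgEquiv, finSuccEquiv_X_zero]

theorem finTwoAlgEquiv_C (F : Type*) [CommRing F] (a : F) :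
    finTwoAlgEquiv F (C a) = Polynomial.C (Polynomial.C a) :=
  (finTwoAlgEquiv F).commutes a

theorem natDegree_finTwoAlgEquiv {F : Type*} [CommRing F] (f : MvPolynomial (Fin 2) F) :
    (finTwoAlgEquiv F f).natDegree = degreeOf 1 f := by
  have h := degreeOf_rename_of_injective (p := f) (Equiv.swap (0 : Fin 2) 1).injective 1
  rw [Equiv.swap_apply_right] at h
  rw [← h, ← natDegree_finSuccEquiv]
  exact Polynomial.natDegree_map_eq_of_injective (uniqueAlgEquiv F (Fin 1)).injective _

theorem degree_leadingCoeff_finTwoAlgEquiv_Pseq (K : Type*) [Field K] (σ : ℕ → ℕ) (i : ℕ) :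
    (finTwoAlgEquiv _ (Pseq K σ i)).degree < (2 ^ i : ℕ) ∧
    (finTwoAlgEquiv _ (Pseq K σ (i + 1))).degree = (2 ^ i : ℕ) ∧
    IsUnit (finTwoAlgEquiv _ (Pseq K σ (i + 1))).leadingCoeff := by
  induction i with
  | zero =>
    simp only [Pseq, finTwoAlgEquiv_X_zero, finTwoAlgEquiv_X_one]
    simp [Polynomial.degree_C Polynomial.X_ne_zero]
  | succ i ih =>
    obtain ⟨h0, h1, hu⟩ := ih
    have hz : (RatFunc.X : RatFunc K) ^ σ (i + 1) ≠ 0 := pow_ne_zero _ RatFunc.X_ne_zero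
    have hlt : (2 ^ i : ℕ) < 2 ^ (i + 1) := Nat.pow_lt_pow_right (by norm_num) (Nat.lt_succ_self i)
    have hrec : finTwoAlgEquiv _ (Pseq K σ (i + 2)) =
        Polynomial.C (Polynomial.C ((RatFunc.X : RatFunc K) ^ σ (i + 1))) *
          finTwoAlgEquiv _ (Pseq K σ (i + 1)) ^ 2 -
        Polynomial.C (Polynomial.X ^ 2 ^ (i + 2)) * finTwoAlgEquiv _ (Pseq K σ i) := by
      rw [Pseq, map_sub, map_mul, map_mul, finTwoAlgEquiv_C, map_pow (finTwoAlgEquiv _),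
        map_pow (finTwoAlgEquiv _), finTwoAlgEquiv_X_zero, ← Polynomial.C_pow]
    have hmain : (Polynomial.C (Polynomial.C ((RatFunc.X : RatFunc K) ^ σ (i + 1))) *
          finTwoAlgEquiv _ (Pseq K σ (i + 1)) ^ 2).degree = (2 ^ (i + 1) : ℕ) := by
      rw [Polynomial.degree_C_mul (Polynomial.C_ne_zero.mpr hz), pow_two, Polynomial.degree_mul,
        h1, pow_succ, mul_two, Nat.cast_add]
    have htail : (Polynomial.C (Polynomial.X ^ 2 ^ (i + 2)) *
        finTwoAlgEquiv _ (Pseq K σ i)).degree < ((2 ^ (i + 1) : ℕ) : WithBot ℕ) := by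
      rw [Polynomial.degree_C_mul (pow_ne_zero _ Polynomial.X_ne_zero)]
      exact h0.trans (Nat.cast_lt.mpr hlt)
    rw [← hmain] at htail
    refine ⟨by rw [h1]; exact Nat.cast_lt.mpr hlt, ?_, ?_⟩
    · rw [hrec, Polynomial.degree_sub_eq_left_of_degree_lt htail, hmain]
    · rw [hrec, Polynomial.leadingCoeff_sub_of_degree_lt htail, Polynomial.leadingCoeff_mul,
        Polynomial.leadingCoeff_C, Polynomial.leadingCoeff_pow]
      exact (Polynomial.isUnit_C.mpr hz.isUnit).mul (hu.pow 2)

theorem finTwoAlgEquiv_Pmono (K : Type*) [Field K] (σ : ℕ → ℕ) (ℓ : ℕ)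
    (α : ℕ × (Fin ℓ → Bool)) :
    finTwoAlgEquiv _ (Pmono K σ ℓ α) = Polynomial.basisMonomials (RatFunc K) α.1 •
      ∏ i : Fin ℓ, finTwoAlgEquiv _ (Pseq K σ (i.1 + 1)) ^ (α.2 i).toNat := by
  simp [Pmono, finTwoAlgEquiv_X_zero, Polynomial.smul_eq_C_mul,
    Polynomial.monomial_one_right_eq_X_pow]

theorem finTwoAlgEquiv_sum_Pmono (K : Type*) [Field K] (σ : ℕ → ℕ) (ℓ : ℕ)
    (a : (ℕ × (Fin ℓ → Bool)) →₀ RatFunc K) :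
    finTwoAlgEquiv _ (a.sum fun α c => C c * Pmono K σ ℓ α) =
      Finsupp.linearCombination (RatFunc K) (fun α : ℕ × (Fin ℓ → Bool) =>
        Polynomial.basisMonomials (RatFunc K) α.1 •
          ∏ i : Fin ℓ, finTwoAlgEquiv _ (Pseq K σ (i.1 + 1)) ^ (α.2 i).toNat) a := by
  simp only [Finsupp.linearCombination_apply, Finsupp.sum, map_sum, map_smul,
    MvPolynomial.C_mul', finTwoAlgEquiv_Pmono]

/-- **part of Lemma 3 of the paper.**  `deg_y P_i = 2^{i-1}` for `i ≥ 1`, and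
every `f ∈ F[x,y]` with `deg_y f < 2^ℓ` has a unique expansion
`f = Σ_α a_α·x^{α₀}·P₁^{α₁}⋯P_ℓ^{α_ℓ}` over finitely supported families indexed by
`α ∈ ℕ × {0,1}^ℓ`. -/
theorem stmt13 (K : Type*) [Field K] (σ : ℕ → ℕ) :
    (∀ i : ℕ, 1 ≤ i → degreeOf 1 (Pseq K σ i) = 2 ^ (i - 1)) ∧
    (∀ (f : MvPolynomial (Fin 2) (RatFunc K)) (ℓ : ℕ), degreeOf 1 f < 2 ^ ℓ →
      ∃! a : (ℕ × (Fin ℓ → Bool)) →₀ RatFunc K,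
        f = a.sum fun α c => C c * Pmono K σ ℓ α) := by
  have hdeg i := (degree_leadingCoeff_finTwoAlgEquiv_Pseq K σ i).2.1
  have hlead i := (degree_leadingCoeff_finTwoAlgEquiv_Pseq K σ i).2.2
  refine ⟨fun i hi => ?_, fun f ℓ hf => ?_⟩
  · obtain ⟨i, rfl⟩ := Nat.exists_eq_add_of_le' hi
    rw [← natDegree_finTwoAlgEquiv, Polynomial.natDegree_eq_of_degree_eq_some (hdeg i),
      Nat.add_sub_cancel]
  · rw [← natDegree_finTwoAlgEquiv] at hf
    have hf' : (finTwoAlgEquiv _ f).degree < (2 ^ ℓ : ℕ) :=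
      Polynomial.degree_le_natDegree.trans_lt (Nat.cast_lt.mpr hf)
    have hmem := mem_span_prod_pow_toNat (q := fun i => finTwoAlgEquiv _ (Pseq K σ (i + 1)))
      hdeg hlead ℓ hf'
    have hli := linearIndependent_smul (Polynomial.basisMonomials (RatFunc K)).linearIndependent
      (linearIndependent_prod_pow_toNat (q := fun i => finTwoAlgEquiv _ (Pseq K σ (i + 1))) hdeg ℓ)
    rw [← Submodule.restrictScalars_mem (RatFunc K), ← Submodule.span_smul_of_span_eq_top
      (Polynomial.basisMonomials (RatFunc K)).span_eq, Set.range_smul_range,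
      Finsupp.mem_span_range_iff_exists_finsupp] at hmem
    obtain ⟨a, ha⟩ := hmem
    refine ⟨a, (finTwoAlgEquiv _).injective ?_, fun b hb => hli ?_⟩
    · rw [finTwoAlgEquiv_sum_Pmono]
      exact ha.symm
    · rw [← finTwoAlgEquiv_sum_Pmono, ← hb]
      exact ha.symm
end

section
/- Define rationals η_i by η₀ = 1 and η_{i+1} = 2η_i + 1/2^{i+1} for i ≥ 0. Then for every ℓ ∈ ℕ, the map sending α = (α₀, α₁, …, α_ℓ) ∈ ℕ × {0,1}^ℓ to Σ_{i=0}^{ℓ} α_i·η_i is injective; that is, if α, β ∈ ℕ × {0,1}^ℓ satisfy Σ_{i=0}^{ℓ} α_i·η_i = Σ_{i=0}^{ℓ} β_i·η_i, then α = β. -/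
/-- The sequence `η₀ = 1`, `η_{i+1} = 2η_i + 1/2^{i+1}`. -/
def etaSeq : ℕ → ℚ
  | 0 => 1
  | (i + 1) => 2 * etaSeq i + 1 / 2 ^ (i + 1)

theorem exists_two_pow_mul_etaSeq_eq_odd (i : ℕ) :
    ∃ k : ℕ, 2 ^ i * etaSeq i = 2 * k + 1 := by
  induction i with
  | zero => exact ⟨0, by simp [etaSeq]⟩
  | succ i ih =>
    obtain ⟨k, hk⟩ := ih
    refine ⟨2 * (2 * k + 1), ?_⟩
    have h : (2 : ℚ) ^ (i + 1) * (1 / 2 ^ (i + 1)) = 1 := mul_one_div_cancel (by positivity)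
    rw [etaSeq, mul_add, h, pow_succ]
    push_cast
    linear_combination 4 * hk

theorem exists_two_pow_mul_etaSeq_sum_eq_natCast (ℓ a : ℕ) (f : Fin ℓ → Bool) :
    ∃ A : ℕ, 2 ^ ℓ * ((a : ℚ) * etaSeq 0 +
      ∑ i : Fin ℓ, ((f i).toNat : ℚ) * etaSeq (i.1 + 1)) = A := by
  induction ℓ with
  | zero => exact ⟨a, by simp [etaSeq]⟩
  | succ ℓ ih =>
    obtain ⟨A, hA⟩ := ih (fun i => f i.castSucc)
    obtain ⟨k, hk⟩ := exists_two_pow_mul_etaSeq_eq_odd (ℓ + 1)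
    refine ⟨2 * A + (f (Fin.last ℓ)).toNat * (2 * k + 1), ?_⟩
    simp only [Fin.sum_univ_castSucc, Fin.val_castSucc, Fin.val_last]
    push_cast
    linear_combination 2 * hA + ((f (Fin.last ℓ)).toNat : ℚ) * hk

/-- For every `ℓ`, the map `α = (α₀,…,α_ℓ) ∈ ℕ × {0,1}^ℓ ↦ Σ α_i·η_i`
is injective. -/
theorem stmt14 (ℓ : ℕ) :
    Function.Injective (fun α : ℕ × (Fin ℓ → Bool) =>
      (α.1 : ℚ) * etaSeq 0 + ∑ i : Fin ℓ, ((α.2 i).toNat : ℚ) * etaSeq (i.1 + 1)) := by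
  induction ℓ with
  | zero =>
    rintro ⟨a, f⟩ ⟨b, g⟩ h
    have hab : a = b := by simpa [etaSeq] using h
    exact Prod.ext hab (Subsingleton.elim f g)
  | succ ℓ ih =>
    rintro ⟨a, f⟩ ⟨b, g⟩ h
    obtain ⟨A, hA⟩ := exists_two_pow_mul_etaSeq_sum_eq_natCast ℓ a (fun i => f i.castSucc)
    obtain ⟨B, hB⟩ := exists_two_pow_mul_etaSeq_sum_eq_natCast ℓ b (fun i => g i.castSucc)
    obtain ⟨k, hk⟩ := exists_two_pow_mul_etaSeq_eq_odd (ℓ + 1)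
    simp only [Fin.sum_univ_castSucc, Fin.val_castSucc, Fin.val_last] at h
    have hlast : f (Fin.last ℓ) = g (Fin.last ℓ) := by
      have key : 2 * A + (f (Fin.last ℓ)).toNat * (2 * k + 1) =
          2 * B + (g (Fin.last ℓ)).toNat * (2 * k + 1) := by
        have : (2 * A + (f (Fin.last ℓ)).toNat * (2 * k + 1) : ℚ) =
            2 * B + (g (Fin.last ℓ)).toNat * (2 * k + 1) := by
          linear_combination 2 ^ (ℓ + 1) * h - 2 * hA + 2 * hB -
            ((f (Fin.last ℓ)).toNat : ℚ) * hk + ((g (Fin.last ℓ)).toNat : ℚ) * hk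
        exact_mod_cast this
      cases hf : f (Fin.last ℓ) <;> cases hg : g (Fin.last ℓ) <;> simp [hf, hg] at key ⊢ <;> omega
    have hinit := @ih (a, fun i => f i.castSucc) (b, fun i => g i.castSucc) (by
      rw [hlast] at h
      linear_combination h)
    obtain ⟨hab, hfg⟩ := Prod.ext_iff.mp hinit
    refine Prod.ext hab (funext fun i => ?_)
    exact Fin.lastCases hlast (fun j => congrFun hfg j) i
end

section
/- Let K be a field, F = K(z), σ : ℤ_{>0} → ℕ a function, and in F[x,y] define P₀ = x, P₁ = y, P_{i+1} = z^{σ(i)}·P_i² − x^{2^{i+1}}·P_{i−1} for i ≥ 1. Define η₀ = 1, η_{i+1} = 2η_i + 1/2^{i+1}, γ₀ = 0, γ_i = −Σ_{j=1}^{i} σ(j)/2^{i+1−j}. For a nonzero f ∈ F[x,y] with unique expansion f = Σ_α a_α·x^{α₀}·P₁^{α₁}⋯P_ℓ^{α_ℓ} over α ∈ ℕ × {0,1}^ℓ (where deg_y f < 2^ℓ), define ν(f) = min over α with a_α ≠ 0 of (Σ_{i=0}^{ℓ} α_i·η_i , ord_z(a_α) + Σ_{i=0}^{ℓ} α_i·γ_i)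 ∈ ℚ × ℚ with the lexicographic order, where ord_z is the z-adic valuation on K(z). Then ν(f) is independent of the choice of ℓ, the minimum is attained at exactly one index α, and for all nonzero f, g ∈ F[x,y]: ν(fg) = ν(f) + ν(g), and ν(f+g) ≥ min(ν(f), ν(g)) whenever f + g ≠ 0. -/
open MvPolynomial

/-- `f` (with `deg_y f < 2^ℓ`) has the expansion `f = Σ_α a_α·x^{α₀}·P₁^{α₁}⋯P_ℓ^{α_ℓ}`. -/
noncomputable def IsPExpansion (K : Type*) [Field K] (σ : ℕ → ℕ)
    (f : MvPolynomial (Fin 2) (RatFunc K)) (ℓ : ℕ)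
    (a : (ℕ × (Fin ℓ → Bool)) →₀ RatFunc K) : Prop :=
  degreeOf 1 f < 2 ^ ℓ ∧ f = a.sum fun α c => C c * Pmono K σ ℓ α

/-- `γ₀ = 0`, `γ_i = −Σ_{j=1}^{i} σ(j)/2^{i+1−j}` for `i ≥ 1`. -/
def gammaSeq (σ : ℕ → ℕ) (i : ℕ) : ℚ :=
  -∑ j ∈ Finset.Icc 1 i, (σ j : ℚ) / 2 ^ (i + 1 - j)

/-- The value `(Σ α_i·η_i, ord_z(a_α) + Σ α_i·γ_i) ∈ ℚ ×ₗ ℚ` of the term of the expansion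
indexed by `α`, with coefficient `c = a_α`. -/
noncomputable def Pvalue {K : Type*} [Field K] (ordz : RatFunc K → ℤ) (σ : ℕ → ℕ) (ℓ : ℕ)
    (α : ℕ × (Fin ℓ → Bool)) (c : RatFunc K) : ℚ ×ₗ ℚ :=
  toLex ((α.1 : ℚ) * etaSeq 0 + ∑ i : Fin ℓ, ((α.2 i).toNat : ℚ) * etaSeq (i.1 + 1),
    (ordz c : ℚ) +
      ((α.1 : ℚ) * gammaSeq σ 0 + ∑ i : Fin ℓ, ((α.2 i).toNat : ℚ) * gammaSeq σ (i.1 + 1)))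

/-- The set of values of the (nonzero) terms of an expansion `a`; `ν(f)` is its minimum. -/
noncomputable def PvalueSet {K : Type*} [Field K] (ordz : RatFunc K → ℤ) (σ : ℕ → ℕ) (ℓ : ℕ)
    (a : (ℕ × (Fin ℓ → Bool)) →₀ RatFunc K) : Set (ℚ ×ₗ ℚ) :=
  {v : ℚ ×ₗ ℚ | ∃ α ∈ a.support, v = Pvalue ordz σ ℓ α (a α)}


/-- The `z`-adic valuation properties that are used: multiplicativity, the ultrametric inequality
and the normalization at `z`. -/
structure IsZOrder {K : Type*} [Field K] (ordz : RatFunc K → ℤ) : Prop where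
  map_mul : ∀ {x y : RatFunc K}, x ≠ 0 → y ≠ 0 → ordz (x * y) = ordz x + ordz y
  min_le_add : ∀ {x y : RatFunc K}, x ≠ 0 → y ≠ 0 → x + y ≠ 0 →
    min (ordz x) (ordz y) ≤ ordz (x + y)
  map_X : ordz RatFunc.X = 1

namespace IsZOrder

variable {K : Type*} [Field K] {ordz : RatFunc K → ℤ}

theorem of_rootMultiplicity
    (hpoly : ∀ p : Polynomial K, p ≠ 0 →
      ordz (algebraMap (Polynomial K) (RatFunc K) p) = p.rootMultiplicity 0)
    (hmul : ∀ x y : RatFunc K, x ≠ 0 → y ≠ 0 → ordz (x * y) = ordz x + ordz y) :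
    IsZOrder ordz where
  map_mul hx hy := hmul _ _ hx hy
  min_le_add {x y} hx hy hxy := by
    classical
    obtain ⟨d, hd⟩ := IsLocalization.exist_integer_multiples_of_finset
      (nonZeroDivisors (Polynomial K)) ({x, y} : Finset (RatFunc K))
    obtain ⟨p, hp⟩ := hd x (by simp)
    obtain ⟨q, hq⟩ := hd y (by simp)
    have hd0 : algebraMap (Polynomial K) (RatFunc K) d ≠ 0 := by simp
    simp only [Algebra.smul_def] at hp hq
    have hpq : algebraMap (Polynomial K) (RatFunc K) (p + q)
        = algebraMap (Polynomial K) (RatFunc K) d * (x + y) := by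
      rw [map_add, hp, hq, mul_add]
    have ne {r : Polynomial K} {w : RatFunc K} (hw : w ≠ 0)
        (h : algebraMap (Polynomial K) (RatFunc K) r
          = algebraMap (Polynomial K) (RatFunc K) d * w) : r ≠ 0 := by
      rintro rfl
      rw [map_zero] at h
      exact mul_ne_zero hd0 hw h.symm
    have key {r : Polynomial K} {w : RatFunc K} (hw : w ≠ 0)
        (h : algebraMap (Polynomial K) (RatFunc K) r
          = algebraMap (Polynomial K) (RatFunc K) d * w) :
        (r.rootMultiplicity 0 : ℤ)
          = ordz (algebraMap (Polynomial K) (RatFunc K) d) + ordz w := by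
      rw [← hpoly r (ne hw h), h, hmul _ _ hd0 hw]
    have h := Polynomial.rootMultiplicity_add (a := 0) (ne hxy hpq)
    have h1 := key hx hp
    have h2 := key hy hq
    have h3 := key hxy hpq
    omega
  map_X := by
    rw [← RatFunc.algebraMap_X, hpoly _ Polynomial.X_ne_zero]
    have := Polynomial.rootMultiplicity_X_sub_C_self (R := K) (x := 0)
    rw [map_zero, sub_zero] at this
    simp [this]

variable (h : IsZOrder ordz)
include h

theorem map_one : ordz 1 = 0 := by
  have := h.map_mul (one_ne_zero (α := RatFunc K)) one_ne_zero
  rw [mul_one] at this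
  omega

theorem map_inv {x : RatFunc K} (hx : x ≠ 0) : ordz x⁻¹ = -ordz x := by
  have := h.map_mul hx (inv_ne_zero hx)
  rw [mul_inv_cancel₀ hx, h.map_one] at this
  omega

theorem map_X_pow (n : ℕ) : ordz (RatFunc.X ^ n) = n := by
  induction n with
  | zero => simpa using h.map_one
  | succ n ih =>
    rw [pow_succ, h.map_mul (pow_ne_zero _ RatFunc.X_ne_zero) RatFunc.X_ne_zero, ih, h.map_X]
    simp

theorem map_neg {x : RatFunc K} (hx : x ≠ 0) : ordz (-x) = ordz x := by
  have h1 : ordz (-1 : RatFunc K) = 0 := by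
    have := h.map_mul (neg_ne_zero.2 (one_ne_zero (α := RatFunc K)))
      (neg_ne_zero.2 one_ne_zero)
    rw [neg_mul_neg, mul_one, h.map_one] at this
    omega
  rw [← neg_one_mul, h.map_mul (neg_ne_zero.2 one_ne_zero) hx, h1, zero_add]

theorem add_eq_of_lt {x y : RatFunc K} (hx : x ≠ 0) (hy : y ≠ 0) (hxy : ordz x < ordz y) :
    x + y ≠ 0 ∧ ordz (x + y) = ordz x := by
  have h0 : x + y ≠ 0 := by
    intro h0
    rw [eq_neg_of_add_eq_zero_left h0, h.map_neg hy] at hxy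
    exact lt_irrefl _ hxy
  refine ⟨h0, ?_⟩
  have h1 := h.min_le_add hx hy h0
  have h2 := h.min_le_add h0 (neg_ne_zero.2 hy) (by simpa using hx)
  rw [h.map_neg hy, add_neg_cancel_right] at h2
  omega

end IsZOrder

/-- The monomial `x^a·∏_{i ∈ m} P_{i+1}` attached to `a ∈ ℕ` and a multiset `m`. -/
noncomputable def genMono (K : Type*) [Field K] (σ : ℕ → ℕ) (p : ℕ × Multiset ℕ) :
    MvPolynomial (Fin 2) (RatFunc K) :=
  X 0 ^ p.1 * (p.2.map fun i => Pseq K σ (i + 1)).prod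

/-- The monomial `x^a·∏_{i ∈ s} P_{i+1}` attached to `a ∈ ℕ` and a finite set `s`. -/
noncomputable def redMono (K : Type*) [Field K] (σ : ℕ → ℕ) (q : ℕ × Finset ℕ) :
    MvPolynomial (Fin 2) (RatFunc K) :=
  genMono K σ (q.1, q.2.val)

section LinearIndependence

variable (K : Type*) [Field K] (σ : ℕ → ℕ)

/-- The map `F[x,y] → F[x][y]`. -/
noncomputable def toIterated :
    MvPolynomial (Fin 2) (RatFunc K) →ₐ[RatFunc K] Polynomial (Polynomial (RatFunc K)) :=
  aeval ![Polynomial.C Polynomial.X, Polynomial.X]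

theorem degree_toIterated_Pseq (i : ℕ) :
    (toIterated K (Pseq K σ i)).degree < ((2 ^ i : ℕ) : WithBot ℕ) ∧
      (toIterated K (Pseq K σ (i + 1))).degree = ((2 ^ i : ℕ) : WithBot ℕ) := by
  induction i with
  | zero =>
    simp only [Pseq, toIterated, aeval_X]
    refine ⟨lt_of_le_of_lt Polynomial.degree_C_le ?_, ?_⟩
    · simp
    · simp
  | succ i ih =>
    refine ⟨by rw [ih.2]; exact_mod_cast Nat.pow_lt_pow_succ one_lt_two, ?_⟩
    have e1 : (toIterated K (C ((RatFunc.X : RatFunc K) ^ σ (i + 1)) * Pseq K σ (i + 1) ^ 2)).degree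
        = ((2 ^ (i + 1) : ℕ) : WithBot ℕ) := by
      rw [_root_.map_mul, _root_.map_pow (toIterated K), Polynomial.degree_mul, Polynomial.degree_pow,
        ih.2, toIterated, algHom_C, Polynomial.algebraMap_apply, Polynomial.degree_C, pow_succ, mul_comm]
      · simp [two_mul]
      · simp [RatFunc.X_ne_zero]
    have e2 : (toIterated K (X 0 ^ 2 ^ (i + 2) * Pseq K σ i)).degree
        < ((2 ^ (i + 1) : ℕ) : WithBot ℕ) := by
      rw [_root_.map_mul, _root_.map_pow, Polynomial.degree_mul, Polynomial.degree_pow]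
      have : (toIterated K (X 0)).degree = 0 := by
        simp [toIterated]
      rw [this, smul_zero, zero_add]
      refine ih.1.trans ?_
      exact_mod_cast Nat.pow_lt_pow_succ one_lt_two
    rw [Pseq, map_sub, Polynomial.degree_sub_eq_left_of_degree_lt (by rwa [e1]), e1]

theorem degree_toIterated_prod (s : Finset ℕ) :
    (toIterated K (∏ i ∈ s, Pseq K σ (i + 1))).degree = ((∑ i ∈ s, 2 ^ i : ℕ) : WithBot ℕ) := by
  rw [map_prod, Polynomial.degree_prod]
  push_cast
  exact Finset.sum_congr rfl fun i _ => by exact_mod_cast (degree_toIterated_Pseq K σ i).2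

theorem linearIndependent_redMono : LinearIndependent (RatFunc K) (redMono K σ) := by
  let S : Polynomial.Sequence (Polynomial (RatFunc K)) :=
    ⟨fun n => toIterated K (∏ i ∈ Finset.equivBitIndices n, Pseq K σ (i + 1)), fun n => by
      rw [degree_toIterated_prod]
      exact congrArg _ (Finset.equivBitIndices.symm_apply_apply n)⟩
  have hS := (linearIndependent_smul (Polynomial.basisMonomials (RatFunc K)).linearIndependent
    S.linearIndependent).comp (Prod.map id Finset.equivBitIndices.symm)
    (Function.injective_id.prodMap Finset.equivBitIndices.symm.injective)
  refine LinearIndependent.of_comp (toIterated K).toLinearMap ?_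
  have e : (toIterated K).toLinearMap ∘ redMono K σ =
      (fun p : ℕ × ℕ => Polynomial.basisMonomials (RatFunc K) p.1 • S p.2) ∘
        Prod.map id Finset.equivBitIndices.symm := by
    funext q
    have hq : S (Finset.equivBitIndices.symm q.2)
        = toIterated K (∏ i ∈ q.2, Pseq K σ (i + 1)) := by
      change toIterated K (∏ i ∈ Finset.equivBitIndices (Finset.equivBitIndices.symm q.2), _) = _
      rw [Equiv.apply_symm_apply]
    simp only [Function.comp_apply, Prod.map, id, hq, redMono, genMono, Polynomial.coe_basisMonomials,
      AlgHom.toLinearMap_apply, _root_.map_mul, _root_.map_pow, Polynomial.smul_eq_C_mul]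
    congr 1
    simp [toIterated, ← Polynomial.X_pow_eq_monomial]
  rw [e]
  exact hS

end LinearIndependence

section Weights

theorem exists_odd_etaSeq (i : ℕ) : ∃ n : ℤ, Odd n ∧ etaSeq i * 2 ^ i = n := by
  induction i with
  | zero => exact ⟨1, odd_one, by simp [etaSeq]⟩
  | succ i ih =>
    obtain ⟨n, -, hn⟩ := ih
    refine ⟨2 * (2 * n) + 1, ⟨2 * n, rfl⟩, ?_⟩
    push_cast
    rw [← hn, etaSeq]
    field_simp
    ring

theorem two_mul_etaSeq (i : ℕ) : 2 * etaSeq (i + 1) = 2 ^ (i + 2) + etaSeq i := by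
  induction i with
  | zero => norm_num [etaSeq]
  | succ i ih =>
    have h1 : etaSeq (i + 2) = 2 * etaSeq (i + 1) + 1 / 2 ^ (i + 2) := rfl
    have h2 : etaSeq (i + 1) = 2 * etaSeq i + 1 / 2 ^ (i + 1) := rfl
    rw [h1, ih, mul_add, mul_add, h2]
    field_simp
    ring

theorem two_mul_gammaSeq (σ : ℕ → ℕ) (i : ℕ) :
    2 * gammaSeq σ (i + 1) = gammaSeq σ i - σ (i + 1) := by
  have h : ∑ j ∈ Finset.Icc 1 i, (σ j : ℚ) / 2 ^ (i + 1 - j)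
      = 2 * ∑ j ∈ Finset.Icc 1 i, (σ j : ℚ) / 2 ^ (i + 1 + 1 - j) := by
    rw [Finset.mul_sum]
    refine Finset.sum_congr rfl fun j hj => ?_
    rw [Finset.mem_Icc] at hj
    rw [show i + 1 + 1 - j = (i + 1 - j) + 1 by omega, pow_succ]
    field_simp
  unfold gammaSeq
  rw [Finset.sum_Icc_succ_top (by omega), h]
  simp only [Nat.add_sub_cancel_left, pow_one]
  ring

/-- The first component of the value of the monomial `x^a·∏_{i ∈ s} P_{i+1}`. -/
def redDegree (q : ℕ × Finset ℕ) : ℚ := q.1 + ∑ i ∈ q.2, etaSeq (i + 1)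

theorem exists_int_redDegree (k a : ℕ) (s : Finset ℕ) (hs : ∀ i ∈ s, i < k) :
    ∃ n : ℤ, redDegree (a, s) * 2 ^ k = n := by
  induction s using Finset.induction_on with
  | empty => exact ⟨a * 2 ^ k, by simp [redDegree]⟩
  | insert i s hi ih =>
    obtain ⟨n, hn⟩ := ih fun j hj => hs j (Finset.mem_insert_of_mem hj)
    obtain ⟨m, -, hm⟩ := exists_odd_etaSeq (i + 1)
    obtain ⟨d, hd⟩ := Nat.exists_eq_add_of_lt (hs i (Finset.mem_insert_self i s))
    refine ⟨n + m * 2 ^ d, ?_⟩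
    push_cast
    rw [← hn, ← hm, redDegree, redDegree, Finset.sum_insert hi, hd]
    ring

theorem redDegree_insert (a : ℕ) {k : ℕ} {s : Finset ℕ} (hk : k ∈ s) :
    redDegree (a, s) = etaSeq (k + 1) + redDegree (a, s.erase k) := by
  simp only [redDegree]
  rw [← Finset.add_sum_erase s (fun i => etaSeq (i + 1)) hk]
  ring

theorem redDegree_ne_of_mem {k : ℕ} {a b : ℕ} {s t : Finset ℕ} (hs : ∀ i ∈ s, i < k + 1)
    (ht : ∀ i ∈ t, i < k) (hk : k ∈ s) : redDegree (a, s) ≠ redDegree (b, t) := by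
  intro h
  obtain ⟨m, hm⟩ := exists_int_redDegree k a (s.erase k) fun i hi => by
    have := hs i (Finset.mem_of_mem_erase hi)
    have := Finset.ne_of_mem_erase hi
    omega
  obtain ⟨n, hn⟩ := exists_int_redDegree k b t ht
  obtain ⟨r, ⟨o, ho⟩, hr⟩ := exists_odd_etaSeq (k + 1)
  rw [redDegree_insert a hk] at h
  have : r = 2 * (n - m) := by
    have : (r : ℚ) = 2 * (n - m) := by
      rw [← hr, ← hn, ← hm, ← h]
      ring
    exact_mod_cast this
  omega

theorem redDegree_injective : Function.Injective redDegree := by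
  suffices H : ∀ (k a b : ℕ) (s t : Finset ℕ), (∀ i ∈ s, i < k) → (∀ i ∈ t, i < k) →
      redDegree (a, s) = redDegree (b, t) → a = b ∧ s = t by
    rintro ⟨a, s⟩ ⟨b, t⟩ h
    obtain ⟨h1, h2⟩ := H (s.sup id + t.sup id + 1) a b s t
      (fun i hi => by have := Finset.le_sup (f := id) hi; simp only [id] at this; omega)
      (fun i hi => by have := Finset.le_sup (f := id) hi; simp only [id] at this; omega) h
    rw [h1, h2]
  intro k
  induction k with
  | zero =>
    intro a b s t hs ht h
    obtain rfl : s = ∅ := Finset.eq_empty_of_forall_notMem fun i hi => by simpa using hs i hi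
    obtain rfl : t = ∅ := Finset.eq_empty_of_forall_notMem fun i hi => by simpa using ht i hi
    simpa [redDegree] using h
  | succ k ih =>
    intro a b s t hs ht h
    have lt_of {s : Finset ℕ} (hs : ∀ i ∈ s, i < k + 1) (hk : k ∉ s) : ∀ i ∈ s, i < k :=
      fun i hi => lt_of_le_of_ne (Nat.lt_succ_iff.1 (hs i hi)) fun e => hk (e ▸ hi)
    by_cases hks : k ∈ s <;> by_cases hkt : k ∈ t
    · rw [redDegree_insert a hks, redDegree_insert b hkt, add_right_inj] at h
      obtain ⟨h1, h2⟩ := ih a b _ _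
        (lt_of (fun i hi => hs i (Finset.mem_of_mem_erase hi)) (Finset.notMem_erase k s))
        (lt_of (fun i hi => ht i (Finset.mem_of_mem_erase hi)) (Finset.notMem_erase k t)) h
      exact ⟨h1, by rw [← Finset.insert_erase hks, h2, Finset.insert_erase hkt]⟩
    · exact absurd h (redDegree_ne_of_mem hs (lt_of ht hkt) hks)
    · exact absurd h.symm (redDegree_ne_of_mem ht (lt_of hs hks) hkt)
    · exact ih a b s t (lt_of hs hks) (lt_of ht hkt) h

variable (σ : ℕ → ℕ)

/-- The value `(a + Σ_{i ∈ m} η_{i+1}, Σ_{i ∈ m} γ_{i+1})` of the monomial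
`x^a·∏_{i ∈ m} P_{i+1}`. -/
def genWeight (p : ℕ × Multiset ℕ) : ℚ ×ₗ ℚ :=
  toLex (p.1 + (p.2.map fun i => etaSeq (i + 1)).sum, (p.2.map fun i => gammaSeq σ (i + 1)).sum)

theorem genWeight_add (p q : ℕ × Multiset ℕ) :
    genWeight σ (p + q) = genWeight σ p + genWeight σ q := by
  simp only [genWeight, ← toLex_add, Prod.mk_add_mk, Prod.fst_add, Prod.snd_add, Multiset.map_add,
    Multiset.sum_add, Nat.cast_add]
  congr 2
  ring

/-- The exponent of `P_i` as a monomial `x^a·∏_{j ∈ m} P_{j+1}`. -/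
def keyIndex : ℕ → ℕ × Multiset ℕ
  | 0 => (1, 0)
  | i + 1 => (0, {i})

theorem genWeight_keyIndex (i : ℕ) :
    genWeight σ (keyIndex i) = toLex (etaSeq i, gammaSeq σ i) := by
  cases i <;> simp [keyIndex, genWeight, etaSeq, gammaSeq]

theorem card_keyIndex_le (i : ℕ) : Multiset.card (keyIndex i).2 ≤ 1 := by
  cases i <;> simp [keyIndex]

variable {K : Type*} [Field K] (ordz : RatFunc K → ℤ)

/-- The value of the term `c·x^a·∏_{i ∈ m} P_{i+1}`. -/
def termValue (p : ℕ × Multiset ℕ) (c : RatFunc K) : ℚ ×ₗ ℚ :=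
  toLex (0, (ordz c : ℚ)) + genWeight σ p

theorem termValue_mul {ordz : RatFunc K → ℤ} (h : IsZOrder ordz) (p q : ℕ × Multiset ℕ)
    {c d : RatFunc K} (hc : c ≠ 0) (hd : d ≠ 0) :
    termValue σ ordz (p + q) (c * d) = termValue σ ordz p c + termValue σ ordz q d := by
  have : toLex ((0 : ℚ), (ordz (c * d) : ℚ)) = toLex (0, (ordz c : ℚ)) + toLex (0, (ordz d : ℚ)) := by
    rw [h.map_mul hc hd, ← toLex_add, Prod.mk_add_mk, add_zero, Int.cast_add]
  rw [termValue, termValue, termValue, genWeight_add, this]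
  abel

theorem termValue_one {ordz : RatFunc K → ℤ} (h : IsZOrder ordz) (p : ℕ × Multiset ℕ) :
    termValue σ ordz p 1 = genWeight σ p := by
  rw [termValue, h.map_one, Int.cast_zero]
  exact zero_add _

theorem termValue_lt_iff {ordz : RatFunc K → ℤ} (p : ℕ × Multiset ℕ) {c d : RatFunc K} :
    termValue σ ordz p c < termValue σ ordz p d ↔ ordz c < ordz d := by
  rw [termValue, termValue, add_lt_add_iff_right, Prod.Lex.toLex_lt_toLex]
  simp

end Weights

section Reduction

variable (K : Type*) [Field K] (σ : ℕ → ℕ)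

theorem genMono_add (p q : ℕ × Multiset ℕ) :
    genMono K σ (p + q) = genMono K σ p * genMono K σ q := by
  simp only [genMono, Prod.fst_add, Prod.snd_add, Multiset.map_add, Multiset.prod_add, pow_add]
  ring

theorem genMono_keyIndex (i : ℕ) : genMono K σ (keyIndex i) = Pseq K σ i := by
  cases i <;> simp [keyIndex, genMono, Pseq]

variable {K}

/-- Replacing a square `P_{i+1}²` by means of the recursion for `P_{i+2}`. -/
theorem exists_reduction {ordz : RatFunc K → ℤ} (h : IsZOrder ordz) (p : ℕ × Multiset ℕ)
    (hp : ¬ p.2.Nodup) :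
    ∃ (c : RatFunc K) (p₁ p₂ : ℕ × Multiset ℕ), c ≠ 0 ∧
      Multiset.card p₁.2 < Multiset.card p.2 ∧ Multiset.card p₂.2 < Multiset.card p.2 ∧
      genMono K σ p = C c * genMono K σ p₁ + C c * genMono K σ p₂ ∧
      termValue σ ordz p₁ c = genWeight σ p ∧ genWeight σ p < termValue σ ordz p₂ c := by
  obtain ⟨a, m⟩ := p
  simp only [Multiset.nodup_iff_ne_cons_cons, not_forall, not_not] at hp
  obtain ⟨i, t, rfl⟩ := hp
  have hz : (RatFunc.X : RatFunc K) ^ σ (i + 1) ≠ 0 := pow_ne_zero _ RatFunc.X_ne_zero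
  have hp : ((a, i ::ₘ i ::ₘ t) : ℕ × Multiset ℕ)
      = keyIndex (i + 1) + keyIndex (i + 1) + (a, t) := by
    simp [keyIndex]
  have hx : genWeight σ (2 ^ (i + 2), 0) = toLex (2 ^ (i + 2), 0) := by simp [genWeight]
  have hc : (ordz ((RatFunc.X : RatFunc K) ^ σ (i + 1))⁻¹ : ℚ) = -σ (i + 1) := by
    rw [h.map_inv hz, h.map_X_pow]
    simp
  refine ⟨((RatFunc.X : RatFunc K) ^ σ (i + 1))⁻¹, (2 ^ (i + 2), 0) + keyIndex i + (a, t),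
    keyIndex (i + 2) + (a, t), inv_ne_zero hz, ?_, ?_, ?_, ?_, ?_⟩
  · have := card_keyIndex_le i
    simp only [Prod.snd_add, Multiset.card_add, Multiset.card_cons, Multiset.card_zero]
    omega
  · have := card_keyIndex_le (i + 2)
    simp only [Prod.snd_add, Multiset.card_add, Multiset.card_cons]
    omega
  · rw [hp]
    simp only [genMono_add, genMono_keyIndex]
    have e : genMono K σ (2 ^ (i + 2), 0) = X 0 ^ 2 ^ (i + 2) := by simp [genMono]
    have e2 : (C ((RatFunc.X : RatFunc K) ^ σ (i + 1))⁻¹ : MvPolynomial (Fin 2) (RatFunc K))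
        * C ((RatFunc.X : RatFunc K) ^ σ (i + 1)) = 1 := by
      rw [← C_mul, inv_mul_cancel₀ hz, C_1]
    rw [e, Pseq]
    linear_combination (-(Pseq K σ (i + 1)) ^ 2 * genMono K σ (a, t)) * e2
  · rw [hp, termValue]
    simp only [genWeight_add, genWeight_keyIndex, hx, hc, ← add_assoc]
    congr 1
    simp only [← toLex_add, Prod.mk_add_mk]
    have h1 := two_mul_etaSeq i
    have h2 := two_mul_gammaSeq σ i
    congr 2 <;> linarith
  · rw [hp, termValue]
    simp only [genWeight_add, genWeight_keyIndex, hc, ← add_assoc]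
    rw [add_lt_add_iff_right]
    simp only [← toLex_add, Prod.mk_add_mk, Prod.Lex.toLex_lt_toLex]
    left
    have h1 : etaSeq (i + 2) = 2 * etaSeq (i + 1) + 1 / 2 ^ (i + 2) := rfl
    have h2 : (0 : ℚ) < 1 / 2 ^ (i + 2) := by positivity
    linarith

end Reduction

section Filtration

variable {K : Type*} [Field K] (σ : ℕ → ℕ) (ordz : RatFunc K → ℤ)

/-- The value of the term `c·x^a·∏_{i ∈ s} P_{i+1}`. -/
def redValue (q : ℕ × Finset ℕ) (c : RatFunc K) : ℚ ×ₗ ℚ := termValue σ ordz (q.1, q.2.val) c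

theorem ofLex_redValue_fst (q : ℕ × Finset ℕ) (c : RatFunc K) :
    (ofLex (redValue σ ordz q c)).1 = redDegree q := by
  simp [redValue, termValue, genWeight, redDegree]

theorem redValue_injective_left {q q' : ℕ × Finset ℕ} {c c' : RatFunc K}
    (h : redValue σ ordz q c = redValue σ ordz q' c') : q = q' := by
  refine redDegree_injective ?_
  rw [← ofLex_redValue_fst σ ordz q c, ← ofLex_redValue_fst σ ordz q' c', h]

/-- The polynomials that are sums of terms `c·x^a·∏_{i ∈ m} P_{i+1}` of value greater than `u`. -/
noncomputable def sumAbove (u : ℚ ×ₗ ℚ) : AddSubgroup (MvPolynomial (Fin 2) (RatFunc K)) :=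
  AddSubgroup.closure {f | ∃ (c : RatFunc K) (p : ℕ × Multiset ℕ),
    c ≠ 0 ∧ u < termValue σ ordz p c ∧ f = C c * genMono K σ p}

variable {ordz}

theorem term_mem_sumAbove {u : ℚ ×ₗ ℚ} {c : RatFunc K} {p : ℕ × Multiset ℕ} (hc : c ≠ 0)
    (hu : u < termValue σ ordz p c) : C c * genMono K σ p ∈ sumAbove σ ordz u :=
  AddSubgroup.subset_closure ⟨c, p, hc, hu, rfl⟩

theorem sumAbove_anti {u v : ℚ ×ₗ ℚ} (huv : u ≤ v) : sumAbove σ ordz v ≤ sumAbove σ ordz u := by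
  refine AddSubgroup.closure_mono ?_
  rintro f ⟨c, p, hc, hv, rfl⟩
  exact ⟨c, p, hc, huv.trans_lt hv, rfl⟩

variable (h : IsZOrder ordz)
include h

theorem term_mul_mem_sumAbove {v : ℚ ×ₗ ℚ} {c : RatFunc K} {p : ℕ × Multiset ℕ} (hc : c ≠ 0)
    {g : MvPolynomial (Fin 2) (RatFunc K)} (hg : g ∈ sumAbove σ ordz v) :
    C c * genMono K σ p * g ∈ sumAbove σ ordz (termValue σ ordz p c + v) := by
  induction hg using AddSubgroup.closure_induction with
  | mem g hg =>
    obtain ⟨d, q, hd, hv, rfl⟩ := hg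
    have : C c * genMono K σ p * (C d * genMono K σ q) = C (c * d) * genMono K σ (p + q) := by
      rw [genMono_add, C_mul]
      ring
    rw [this]
    refine term_mem_sumAbove σ (mul_ne_zero hc hd) ?_
    rw [termValue_mul σ h p q hc hd]
    gcongr
  | zero => simp
  | add x y _ _ hx hy => rw [mul_add]; exact add_mem hx hy
  | neg x _ hx => rw [mul_neg]; exact neg_mem hx

theorem mul_mem_sumAbove {u v : ℚ ×ₗ ℚ} {f g : MvPolynomial (Fin 2) (RatFunc K)}
    (hf : f ∈ sumAbove σ ordz u) (hg : g ∈ sumAbove σ ordz v) :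
    f * g ∈ sumAbove σ ordz (u + v) := by
  induction hf using AddSubgroup.closure_induction with
  | mem f hf =>
    obtain ⟨c, p, hc, hu, rfl⟩ := hf
    exact sumAbove_anti σ (by gcongr) (term_mul_mem_sumAbove σ h hc hg)
  | zero => simp
  | add x y _ _ hx hy => rw [add_mul]; exact add_mem hx hy
  | neg x _ hx => rw [neg_mul]; exact neg_mem hx

/-- The coefficient families all of whose terms have value greater than `u`. -/
def coeffAbove (u : ℚ ×ₗ ℚ) : AddSubgroup ((ℕ × Finset ℕ) →₀ RatFunc K) where
  carrier := {a | ∀ q, a q ≠ 0 → u < redValue σ ordz q (a q)}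
  zero_mem' q hq := absurd rfl hq
  add_mem' {a b} ha hb q hq := by
    rw [Finsupp.add_apply] at hq ⊢
    by_cases h1 : a q = 0
    · rw [h1, zero_add] at hq ⊢
      exact hb q hq
    by_cases h2 : b q = 0
    · rw [h2, add_zero] at hq ⊢
      exact ha q hq
    have hle := h.min_le_add h1 h2 hq
    rcases min_le_iff.1 hle with hle | hle
    · exact (ha q h1).trans_le (not_lt.1 fun hlt =>
        hle.not_gt ((termValue_lt_iff σ (q.1, q.2.val)).1 hlt))
    · exact (hb q h2).trans_le (not_lt.1 fun hlt =>
        hle.not_gt ((termValue_lt_iff σ (q.1, q.2.val)).1 hlt))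
  neg_mem' {a} ha q hq := by
    rw [Finsupp.neg_apply] at hq ⊢
    have hq' : a q ≠ 0 := by simpa using hq
    rw [redValue, termValue, h.map_neg hq']
    exact ha q hq'

theorem single_mem_coeffAbove {u : ℚ ×ₗ ℚ} {q : ℕ × Finset ℕ} {c : RatFunc K}
    (hu : u < redValue σ ordz q c) : Finsupp.single q c ∈ coeffAbove σ h u := by
  intro q' hq'
  obtain rfl : q = q' := by
    by_contra hne
    exact hq' (Finsupp.single_eq_of_ne' hne)
  rwa [Finsupp.single_eq_same]

omit h in
theorem linearCombination_single_redMono (q : ℕ × Finset ℕ) (c : RatFunc K) :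
    Finsupp.linearCombination (RatFunc K) (redMono K σ) (Finsupp.single q c)
      = C c * genMono K σ (q.1, q.2.val) := by
  rw [Finsupp.linearCombination_single, smul_eq_C_mul, redMono]

theorem term_mem_map_coeffAbove (n : ℕ) : ∀ (p : ℕ × Multiset ℕ), Multiset.card p.2 < n →
    ∀ {u : ℚ ×ₗ ℚ} {c : RatFunc K}, c ≠ 0 → u < termValue σ ordz p c →
    ∃ a ∈ coeffAbove σ h u,
      Finsupp.linearCombination (RatFunc K) (redMono K σ) a = C c * genMono K σ p := by
  induction n with
  | zero => intro p hp; omega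
  | succ n ih =>
    intro p hp u c hc hu
    by_cases hnd : p.2.Nodup
    · exact ⟨Finsupp.single (p.1, ⟨p.2, hnd⟩) c, single_mem_coeffAbove σ h hu,
        linearCombination_single_redMono σ _ _⟩
    · obtain ⟨d, p₁, p₂, hd, h1, h2, e, w1, w2⟩ := exists_reduction σ h p hnd
      have hv (p' : ℕ × Multiset ℕ) (hw : genWeight σ p ≤ termValue σ ordz p' d) :
          u < termValue σ ordz p' (c * d) := by
        refine hu.trans_le ?_
        rw [← zero_add p', termValue_mul σ h 0 p' hc hd]
        have : termValue σ ordz p c = termValue σ ordz 0 c + genWeight σ p := by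
          simp [termValue, genWeight]
        rw [this]
        gcongr
      obtain ⟨a, ha, ea⟩ := ih p₁ (by omega) (mul_ne_zero hc hd) (hv p₁ w1.ge)
      obtain ⟨b, hb, eb⟩ := ih p₂ (by omega) (mul_ne_zero hc hd) (hv p₂ w2.le)
      refine ⟨a + b, add_mem ha hb, ?_⟩
      rw [map_add, ea, eb, e, C_mul]
      ring

theorem exists_coeffAbove {u : ℚ ×ₗ ℚ} {f : MvPolynomial (Fin 2) (RatFunc K)}
    (hf : f ∈ sumAbove σ ordz u) : ∃ a ∈ coeffAbove σ h u,
      Finsupp.linearCombination (RatFunc K) (redMono K σ) a = f := by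
  induction hf using AddSubgroup.closure_induction with
  | mem f hf =>
    obtain ⟨c, p, hc, hu, rfl⟩ := hf
    exact term_mem_map_coeffAbove σ h _ p (Nat.lt_succ_self _) hc hu
  | zero => exact ⟨0, zero_mem _, map_zero _⟩
  | add x y _ _ hx hy =>
    obtain ⟨a, ha, rfl⟩ := hx
    obtain ⟨b, hb, rfl⟩ := hy
    exact ⟨a + b, add_mem ha hb, map_add _ _ _⟩
  | neg x _ hx =>
    obtain ⟨a, ha, rfl⟩ := hx
    exact ⟨-a, neg_mem ha, LinearMap.map_neg _ _⟩

theorem linearCombination_mem_sumAbove_iff {u : ℚ ×ₗ ℚ} {a : (ℕ × Finset ℕ) →₀ RatFunc K} :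
    Finsupp.linearCombination (RatFunc K) (redMono K σ) a ∈ sumAbove σ ordz u ↔
      a ∈ coeffAbove σ h u := by
  refine ⟨fun hf => ?_, fun ha => ?_⟩
  · obtain ⟨b, hb, e⟩ := exists_coeffAbove σ h hf
    rwa [← linearIndependent_redMono K σ e]
  · rw [Finsupp.linearCombination_apply]
    refine sum_mem fun q hq => ?_
    dsimp only
    rw [smul_eq_C_mul, redMono]
    rw [Finsupp.mem_support_iff] at hq
    exact term_mem_sumAbove σ hq (ha q hq)

theorem genMono_eq_lead (n : ℕ) : ∀ p : ℕ × Multiset ℕ, Multiset.card p.2 < n →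
    ∃ (q : ℕ × Finset ℕ) (c : RatFunc K), c ≠ 0 ∧ redValue σ ordz q c = genWeight σ p ∧
      genMono K σ p - C c * redMono K σ q ∈ sumAbove σ ordz (genWeight σ p) := by
  induction n with
  | zero => intro p hp; omega
  | succ n ih =>
    intro p hp
    by_cases hnd : p.2.Nodup
    · refine ⟨(p.1, ⟨p.2, hnd⟩), 1, one_ne_zero, termValue_one σ h p, ?_⟩
      simp [redMono]
    · obtain ⟨d, p₁, p₂, hd, h1, h2, e, w1, w2⟩ := exists_reduction σ h p hnd
      obtain ⟨q, c, hc, hv, hm⟩ := ih p₁ (by omega)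
      refine ⟨q, d * c, mul_ne_zero hd hc, ?_, ?_⟩
      · rw [redValue, ← zero_add (q.1, q.2.val), termValue_mul σ h 0 _ hd hc, ← redValue, hv, ← w1]
        simp [termValue, genWeight]
      · have e2 : genMono K σ p - C (d * c) * redMono K σ q
            = C d * genMono K σ 0 * (genMono K σ p₁ - C c * redMono K σ q)
              + C d * genMono K σ p₂ := by
          have : genMono K σ 0 = 1 := by simp [genMono]
          rw [e, C_mul, this]
          ring
        rw [e2]
        refine add_mem ?_ (term_mem_sumAbove σ hd w2)
        have := term_mul_mem_sumAbove σ h (p := 0) hd hm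
        convert this using 2
        rw [← w1]
        simp [termValue, genWeight]

omit h in
/-- `f` is the sum of a term `c·x^a·∏_{i ∈ s} P_{i+1}` of value `v` and of terms of value
greater than `v`. -/
def HasLead (ordz : RatFunc K → ℤ) (v : ℚ ×ₗ ℚ) (f : MvPolynomial (Fin 2) (RatFunc K)) : Prop :=
  ∃ (q : ℕ × Finset ℕ) (c : RatFunc K), c ≠ 0 ∧ redValue σ ordz q c = v ∧
    f - C c * redMono K σ q ∈ sumAbove σ ordz v

theorem HasLead.mul {u v : ℚ ×ₗ ℚ} {f g : MvPolynomial (Fin 2) (RatFunc K)}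
    (hf : HasLead σ ordz u f) (hg : HasLead σ ordz v g) : HasLead σ ordz (u + v) (f * g) := by
  obtain ⟨q, c, hc, rfl, hq⟩ := hf
  obtain ⟨r, d, hd, rfl, hr⟩ := hg
  obtain ⟨s, e, he, hv, hs⟩ := genMono_eq_lead σ h _ ((q.1, q.2.val) + (r.1, r.2.val))
    (Nat.lt_succ_self _)
  have hcd := mul_ne_zero hc hd
  have hval : termValue σ ordz 0 (c * d) + genWeight σ ((q.1, q.2.val) + (r.1, r.2.val))
      = redValue σ ordz q c + redValue σ ordz r d := by
    rw [redValue, redValue, ← termValue_mul σ h _ _ hc hd]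
    simp [termValue, genWeight]
  refine ⟨s, c * d * e, mul_ne_zero hcd he, ?_, ?_⟩
  · rw [redValue, ← zero_add (s.1, s.2.val), termValue_mul σ h 0 _ hcd he, ← redValue, hv, hval]
  · have e1 : f * g - C (c * d * e) * redMono K σ s
        = C (c * d) * genMono K σ 0
            * (genMono K σ ((q.1, q.2.val) + (r.1, r.2.val)) - C e * redMono K σ s)
          + C c * genMono K σ (q.1, q.2.val) * (g - C d * redMono K σ r)
          + C d * genMono K σ (r.1, r.2.val) * (f - C c * redMono K σ q)
          + (f - C c * redMono K σ q) * (g - C d * redMono K σ r) := by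
      have : genMono K σ 0 = 1 := by simp [genMono]
      simp only [genMono_add, this, C_mul, redMono]
      ring
    rw [e1]
    refine add_mem (add_mem (add_mem ?_ ?_) ?_) (mul_mem_sumAbove σ h hq hr)
    · rw [← hval]
      exact term_mul_mem_sumAbove σ h hcd hs
    · exact term_mul_mem_sumAbove σ h hc hr
    · rw [add_comm]
      exact term_mul_mem_sumAbove σ h hd hq

omit h in
/-- The set of values of the terms of a coefficient family. -/
def redValueSet (ordz : RatFunc K → ℤ) (a : (ℕ × Finset ℕ) →₀ RatFunc K) : Set (ℚ ×ₗ ℚ) :=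
  {v | ∃ q ∈ a.support, v = redValue σ ordz q (a q)}

omit h in
theorem exists_isLeast_redValueSet {a : (ℕ × Finset ℕ) →₀ RatFunc K} (ha : a ≠ 0) :
    ∃ v, IsLeast (redValueSet σ ordz a) v := by
  obtain ⟨q, hq, hle⟩ := a.support.exists_min_image (fun q => redValue σ ordz q (a q))
    (Finsupp.support_nonempty_iff.2 ha)
  refine ⟨_, ⟨q, hq, rfl⟩, ?_⟩
  rintro _ ⟨r, hr, rfl⟩
  exact hle r hr

theorem hasLead_of_isLeast {a : (ℕ × Finset ℕ) →₀ RatFunc K} {v : ℚ ×ₗ ℚ}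
    (hv : IsLeast (redValueSet σ ordz a) v) :
    HasLead σ ordz v (Finsupp.linearCombination (RatFunc K) (redMono K σ) a) := by
  obtain ⟨⟨q, hq, rfl⟩, hle⟩ := hv
  refine ⟨q, a q, Finsupp.mem_support_iff.1 hq, rfl, ?_⟩
  rw [← smul_eq_C_mul, ← Finsupp.linearCombination_single, ← map_sub,
    linearCombination_mem_sumAbove_iff σ h]
  intro r hr
  have hrq : q ≠ r := by
    rintro rfl
    simp at hr
  rw [Finsupp.sub_apply, Finsupp.single_eq_of_ne' hrq, sub_zero] at hr ⊢
  exact lt_of_le_of_ne (hle ⟨r, Finsupp.mem_support_iff.2 hr, rfl⟩) fun e =>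
    hrq (redValue_injective_left σ ordz e)

theorem isLeast_of_hasLead {a : (ℕ × Finset ℕ) →₀ RatFunc K} {v : ℚ ×ₗ ℚ}
    (hv : HasLead σ ordz v (Finsupp.linearCombination (RatFunc K) (redMono K σ) a)) :
    IsLeast (redValueSet σ ordz a) v := by
  obtain ⟨q, c, hc, rfl, hm⟩ := hv
  rw [← smul_eq_C_mul, ← Finsupp.linearCombination_single, ← map_sub,
    linearCombination_mem_sumAbove_iff σ h] at hm
  have key : a q ≠ 0 ∧ ordz (a q) = ordz c := by
    by_cases h0 : a q - c = 0
    · rw [sub_eq_zero.1 h0]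
      exact ⟨hc, rfl⟩
    · have hlt := hm q
      rw [Finsupp.sub_apply, Finsupp.single_eq_same] at hlt
      have := h.add_eq_of_lt hc h0 ((termValue_lt_iff σ (q.1, q.2.val)).1 (hlt h0))
      rwa [add_sub_cancel] at this
  have hval : redValue σ ordz q (a q) = redValue σ ordz q c := by
    rw [redValue, termValue, key.2]
    rfl
  refine ⟨⟨q, Finsupp.mem_support_iff.2 key.1, hval.symm⟩, ?_⟩
  rintro _ ⟨r, hr, rfl⟩
  by_cases hrq : q = r
  · rw [← hrq, hval]
  · have hlt := hm r
    rw [Finsupp.sub_apply, Finsupp.single_eq_of_ne' hrq, sub_zero] at hlt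
    exact (hlt (Finsupp.mem_support_iff.1 hr)).le

theorem min_le_of_isLeast {a b d : (ℕ × Finset ℕ) →₀ RatFunc K} {u v w : ℚ ×ₗ ℚ}
    (hd : Finsupp.linearCombination (RatFunc K) (redMono K σ) d
      = Finsupp.linearCombination (RatFunc K) (redMono K σ) a
        + Finsupp.linearCombination (RatFunc K) (redMono K σ) b)
    (hu : IsLeast (redValueSet σ ordz a) u) (hv : IsLeast (redValueSet σ ordz b) v)
    (hw : IsLeast (redValueSet σ ordz d) w) : min u v ≤ w := by
  refine le_of_forall_lt fun t ht => ?_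
  rw [← map_add] at hd
  obtain rfl := linearIndependent_redMono K σ hd
  have ha : a ∈ coeffAbove σ h t := fun q hq =>
    (ht.trans_le (min_le_left _ _)).trans_le (hu.2 ⟨q, Finsupp.mem_support_iff.2 hq, rfl⟩)
  have hb : b ∈ coeffAbove σ h t := fun q hq =>
    (ht.trans_le (min_le_right _ _)).trans_le (hv.2 ⟨q, Finsupp.mem_support_iff.2 hq, rfl⟩)
  obtain ⟨q, hq, rfl⟩ := hw.1
  exact add_mem ha hb q (Finsupp.mem_support_iff.1 hq)

end Filtration

section Expansion

variable {K : Type*} [Field K] {σ : ℕ → ℕ} {ordz : RatFunc K → ℤ}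

/-- The index `α ∈ ℕ × {0,1}^ℓ` as an element of `ℕ × Finset ℕ`. -/
def toRedIndex (ℓ : ℕ) : ℕ × (Fin ℓ → Bool) ↪ ℕ × Finset ℕ where
  toFun α := (α.1, (Finset.univ.filter fun i => α.2 i = true).map Fin.valEmbedding)
  inj' := by
    rintro ⟨a, s⟩ ⟨b, t⟩ h
    simp only [Prod.mk.injEq, Finset.map_inj] at h
    refine Prod.ext h.1 (funext fun i => Bool.eq_iff_iff.2 ?_)
    simpa using Finset.ext_iff.1 h.2 i

theorem Pmono_eq_redMono (ℓ : ℕ) (α : ℕ × (Fin ℓ → Bool)) :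
    Pmono K σ ℓ α = redMono K σ (toRedIndex ℓ α) := by
  change _ = X 0 ^ α.1 * ∏ i ∈ (Finset.univ.filter fun i => α.2 i = true).map Fin.valEmbedding,
    Pseq K σ (i + 1)
  rw [Pmono, Finset.prod_map, Finset.prod_filter]
  congr 1
  refine Finset.prod_congr rfl fun i _ => ?_
  cases α.2 i <;> simp

theorem Pvalue_eq_redValue (ℓ : ℕ) (α : ℕ × (Fin ℓ → Bool)) (c : RatFunc K) :
    Pvalue ordz σ ℓ α c = redValue σ ordz (toRedIndex ℓ α) c := by
  have key (w : ℕ → ℚ) : ∑ i : Fin ℓ, ((α.2 i).toNat : ℚ) * w (i.1 + 1)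
      = ((toRedIndex ℓ α).2.val.map fun i => w (i + 1)).sum := by
    change _ = ∑ i ∈ (Finset.univ.filter fun i => α.2 i = true).map Fin.valEmbedding, w (i + 1)
    rw [Finset.sum_map, Finset.sum_filter]
    refine Finset.sum_congr rfl fun i _ => ?_
    cases α.2 i <;> simp
  have h0 : (toRedIndex ℓ α).1 = α.1 := rfl
  rw [Pvalue, key, key, redValue, termValue, genWeight, ← toLex_add, Prod.mk_add_mk]
  simp [h0, etaSeq, gammaSeq]

theorem PvalueSet_eq_redValueSet (ℓ : ℕ) (a : (ℕ × (Fin ℓ → Bool)) →₀ RatFunc K) :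
    PvalueSet ordz σ ℓ a = redValueSet σ ordz (a.embDomain (toRedIndex ℓ)) := by
  ext v
  simp only [PvalueSet, redValueSet, Finsupp.support_embDomain, Pvalue_eq_redValue,
    Set.mem_ofPred_eq]
  constructor
  · rintro ⟨α, hα, rfl⟩
    exact ⟨_, Finset.mem_map_of_mem _ hα, by rw [Finsupp.embDomain_apply_self]⟩
  · rintro ⟨q, hq, rfl⟩
    obtain ⟨α, hα, rfl⟩ := Finset.mem_map.1 hq
    exact ⟨α, hα, by rw [Finsupp.embDomain_apply_self]⟩

theorem IsPExpansion.eq_linearCombination {f : MvPolynomial (Fin 2) (RatFunc K)} {ℓ : ℕ}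
    {a : (ℕ × (Fin ℓ → Bool)) →₀ RatFunc K} (h : IsPExpansion K σ f ℓ a) :
    f = Finsupp.linearCombination (RatFunc K) (redMono K σ) (a.embDomain (toRedIndex ℓ)) := by
  rw [Finsupp.linearCombination_embDomain, Finsupp.linearCombination_apply, h.2]
  simp only [Function.comp_apply, Pmono_eq_redMono, smul_eq_C_mul]

end Expansion

/-- **Lemma 3 of the paper.**  For nonzero `f`, the minimum `ν(f)` of the values
of the terms of an expansion of `f` does not depend on the choice of `ℓ` (and of expansion),
the minimum is attained at exactly one index `α`, and `ν(fg) = ν(f) + ν(g)` and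
`ν(f+g) ≥ min(ν(f), ν(g))` (when `f + g ≠ 0`). -/
theorem stmt16 (K : Type*) [Field K] (σ : ℕ → ℕ) (ordz : RatFunc K → ℤ)
    (hordz_poly : ∀ p : Polynomial K, p ≠ 0 →
      ordz (algebraMap (Polynomial K) (RatFunc K) p) = p.rootMultiplicity 0)
    (hordz_mul : ∀ x y : RatFunc K, x ≠ 0 → y ≠ 0 → ordz (x * y) = ordz x + ordz y) :
    -- the minimum exists
    (∀ (f : MvPolynomial (Fin 2) (RatFunc K)), f ≠ 0 → ∀ (ℓ : ℕ)
      (a : (ℕ × (Fin ℓ → Bool)) →₀ RatFunc K), IsPExpansion K σ f ℓ a →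
      ∃ v : ℚ ×ₗ ℚ, IsLeast (PvalueSet ordz σ ℓ a) v) ∧
    -- independence of the choice of `ℓ` and of the expansion
    (∀ (f : MvPolynomial (Fin 2) (RatFunc K)), f ≠ 0 → ∀ (ℓ ℓ' : ℕ)
      (a : (ℕ × (Fin ℓ → Bool)) →₀ RatFunc K) (a' : (ℕ × (Fin ℓ' → Bool)) →₀ RatFunc K),
      IsPExpansion K σ f ℓ a → IsPExpansion K σ f ℓ' a' →
      ∀ v v' : ℚ ×ₗ ℚ, IsLeast (PvalueSet ordz σ ℓ a) v → IsLeast (PvalueSet ordz σ ℓ' a') v' →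
      v = v') ∧
    -- the minimum is attained at exactly one index
    (∀ (f : MvPolynomial (Fin 2) (RatFunc K)), f ≠ 0 → ∀ (ℓ : ℕ)
      (a : (ℕ × (Fin ℓ → Bool)) →₀ RatFunc K), IsPExpansion K σ f ℓ a →
      ∀ v : ℚ ×ₗ ℚ, IsLeast (PvalueSet ordz σ ℓ a) v →
      ∃! α : ℕ × (Fin ℓ → Bool), α ∈ a.support ∧ Pvalue ordz σ ℓ α (a α) = v) ∧
    -- ν(fg) = ν(f) + ν(g)
    (∀ (f g : MvPolynomial (Fin 2) (RatFunc K)), f ≠ 0 → g ≠ 0 →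
      ∀ (ℓf ℓg ℓfg : ℕ) (af : (ℕ × (Fin ℓf → Bool)) →₀ RatFunc K)
        (ag : (ℕ × (Fin ℓg → Bool)) →₀ RatFunc K)
        (afg : (ℕ × (Fin ℓfg → Bool)) →₀ RatFunc K),
      IsPExpansion K σ f ℓf af → IsPExpansion K σ g ℓg ag →
      IsPExpansion K σ (f * g) ℓfg afg →
      ∀ u v w : ℚ ×ₗ ℚ, IsLeast (PvalueSet ordz σ ℓf af) u →
        IsLeast (PvalueSet ordz σ ℓg ag) v → IsLeast (PvalueSet ordz σ ℓfg afg) w →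
      w = u + v) ∧
    -- ν(f+g) ≥ min(ν(f), ν(g))
    (∀ (f g : MvPolynomial (Fin 2) (RatFunc K)), f ≠ 0 → g ≠ 0 → f + g ≠ 0 →
      ∀ (ℓf ℓg ℓfg : ℕ) (af : (ℕ × (Fin ℓf → Bool)) →₀ RatFunc K)
        (ag : (ℕ × (Fin ℓg → Bool)) →₀ RatFunc K)
        (afg : (ℕ × (Fin ℓfg → Bool)) →₀ RatFunc K),
      IsPExpansion K σ f ℓf af → IsPExpansion K σ g ℓg ag →
      IsPExpansion K σ (f + g) ℓfg afg →
      ∀ u v w : ℚ ×ₗ ℚ, IsLeast (PvalueSet ordz σ ℓf af) u →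
        IsLeast (PvalueSet ordz σ ℓg ag) v → IsLeast (PvalueSet ordz σ ℓfg afg) w →
      min u v ≤ w) := by

  have h := IsZOrder.of_rootMultiplicity hordz_poly hordz_mul
  refine ⟨?_, ?_, ?_, ?_, ?_⟩
  · intro f hf ℓ a ha
    rw [PvalueSet_eq_redValueSet]
    refine exists_isLeast_redValueSet σ fun h0 => hf ?_
    rw [ha.eq_linearCombination, h0, map_zero]
  · intro f _ ℓ ℓ' a a' ha ha' v v' hv hv'
    rw [PvalueSet_eq_redValueSet] at hv hv'
    rw [linearIndependent_redMono K σ (ha.eq_linearCombination.symm.trans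
      ha'.eq_linearCombination)] at hv
    exact hv.unique hv'
  · intro f _ ℓ a _ v hv
    obtain ⟨α, hα, rfl⟩ := hv.1
    refine ⟨α, ⟨hα, rfl⟩, ?_⟩
    rintro β ⟨-, hβ⟩
    rw [Pvalue_eq_redValue, Pvalue_eq_redValue] at hβ
    exact (toRedIndex ℓ).injective (redValue_injective_left σ ordz hβ)
  · intro f g _ _ ℓf ℓg ℓfg af ag afg hf hg hfg u v w hu hv hw
    rw [PvalueSet_eq_redValueSet] at hu hv hw
    have hl := (hasLead_of_isLeast σ h hu).mul σ h (hasLead_of_isLeast σ h hv)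
    rw [← hf.eq_linearCombination, ← hg.eq_linearCombination, hfg.eq_linearCombination] at hl
    exact hw.unique (isLeast_of_hasLead σ h hl)
  · intro f g _ _ _ ℓf ℓg ℓfg af ag afg hf hg hfg u v w hu hv hw
    rw [PvalueSet_eq_redValueSet] at hu hv hw
    refine min_le_of_isLeast σ h ?_ hu hv hw
    rw [← hf.eq_linearCombination, ← hg.eq_linearCombination, ← hfg.eq_linearCombination]
end

section
/- Let K be a field and let f : ℕ → ℤ be nonincreasing (f(m) ≤ f(n) whenever m ≥ n). Let H = ℤ[1/2] = {a/2^k : a ∈ ℤ, k ∈ ℕ} ⊆ ℚ. Then there exists a valuation ν of the rational function field K(x,y,z) with value group exactly H × ℤ, ordered lexicographically, dominating the regular local ring R = K[x,y,z]_{(x,y,z)}, with the following property: for every valuation ω of K(x,y,z), taking values in the lexicographically ordered group H × ℤ with ω(K(x,y,z)∖{0}) = H × ℤ, which is equivalent to ν (i.e. has the same valuation ring as ν), there exists n₀ ∈ ℕ such that for every integer n ≥ n₀ there is λ ∈ ω₂(R∖{0}) with 0 ≤ λ < n and π₂(λ̃) < f(n), where ω₂ = π₁∘ω, λ̃ = min{ω(g)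 : g ∈ R∖{0}, ω₂(g) = λ}, and π₁, π₂ are the first and second projections H × ℤ → H, H × ℤ → ℤ. -/
open MvPolynomial

/-- The dyadic rationals `ℤ[1/2] = {a/2^k}` inside `ℚ`. -/
def dyadicSet : Set ℚ := {q : ℚ | ∃ (a : ℤ) (k : ℕ), q = (a : ℚ) / 2 ^ k}

/-- The maximal ideal `(x,y,z)` of `K[x,y,z]`. -/
noncomputable def mxyz (K : Type*) [Field K] : Ideal (MvPolynomial (Fin 3) K) :=
  Ideal.span {X 0, X 1, X 2}

/-- The local ring `R = K[x,y,z]_{(x,y,z)}`, realized as the subset of the rational function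
field `K(x,y,z)` of elements of the form `f/g` with `g ∉ (x,y,z)`. -/
noncomputable def Rxyz (K : Type*) [Field K] : Set (FractionRing (MvPolynomial (Fin 3) K)) :=
  {x | ∃ f g : MvPolynomial (Fin 3) K, g ∉ mxyz K ∧
    x * algebraMap (MvPolynomial (Fin 3) K) (FractionRing (MvPolynomial (Fin 3) K)) g
      = algebraMap (MvPolynomial (Fin 3) K) (FractionRing (MvPolynomial (Fin 3) K)) f}

/-- The maximal ideal of `R = K[x,y,z]_{(x,y,z)}`, as a subset of `K(x,y,z)`. -/
noncomputable def mRxyz (K : Type*) [Field K] : Set (FractionRing (MvPolynomial (Fin 3) K)) :=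
  {x | ∃ f g : MvPolynomial (Fin 3) K, f ∈ mxyz K ∧ g ∉ mxyz K ∧
    x * algebraMap (MvPolynomial (Fin 3) K) (FractionRing (MvPolynomial (Fin 3) K)) g
      = algebraMap (MvPolynomial (Fin 3) K) (FractionRing (MvPolynomial (Fin 3) K)) f}

namespace DyadicWild

/-- The substitution `x ↦ x² (c + y)`, `y ↦ x` on `L[y][x]`. -/
noncomputable def subst {L : Type*} [CommRing L] (c : L) :
    Polynomial (Polynomial L) →+* Polynomial (Polynomial L) :=
  Polynomial.eval₂RingHom
    (Polynomial.eval₂RingHom (Polynomial.C.comp Polynomial.C) Polynomial.X)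
    (Polynomial.X ^ 2 * Polynomial.C (Polynomial.C c + Polynomial.X))

/-- The value at `x = y = 0`. -/
noncomputable def evalOrigin (L : Type*) [CommRing L] : Polynomial (Polynomial L) →+* L :=
  Polynomial.constantCoeff.comp Polynomial.constantCoeff

section Bivariate

variable {L : Type*} [CommRing L]

@[simp] lemma evalOrigin_X : evalOrigin L Polynomial.X = 0 := by simp [evalOrigin]

@[simp] lemma evalOrigin_C (p : Polynomial L) : evalOrigin L (Polynomial.C p) = p.coeff 0 := by
  simp [evalOrigin]

@[simp] lemma subst_X (c : L) : subst c Polynomial.X =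
    Polynomial.X ^ 2 * Polynomial.C (Polynomial.C c + Polynomial.X) := by
  simp [subst]

@[simp] lemma subst_C (c : L) (p : Polynomial L) :
    subst c (Polynomial.C p) = p.map Polynomial.C := by
  simp [subst, Polynomial.map, Polynomial.eval₂]

@[simp] lemma evalOrigin_subst (c : L) (P : Polynomial (Polynomial L)) :
    evalOrigin L (subst c P) = evalOrigin L P := by
  have : (evalOrigin L).comp (subst c) = evalOrigin L := by
    ext <;> simp
  exact congrArg (fun g : _ →+* L => g P) this

/-- `y`-degrees in the image of `subst` are at most half of the `x`-exponents. -/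
lemma two_mul_natDegree_coeff_subst_le (c : L) (P : Polynomial (Polynomial L)) (n : ℕ) :
    2 * ((subst c P).coeff n).natDegree ≤ n := by
  classical
  let S : Subsemiring (Polynomial (Polynomial L)) :=
    { carrier := {Q | ∀ n, 2 * (Q.coeff n).natDegree ≤ n}
      zero_mem' := by intro n; simp
      one_mem' := by
        intro n
        rw [Polynomial.coeff_one]
        split_ifs <;> simp
      add_mem' := by
        intro a b ha hb n
        have := Polynomial.natDegree_add_le (a.coeff n) (b.coeff n)
        have h1 := ha n
        have h2 := hb n
        rw [Polynomial.coeff_add]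
        omega
      mul_mem' := by
        intro a b ha hb n
        rw [Polynomial.coeff_mul]
        have : (∑ x ∈ Finset.HasAntidiagonal.antidiagonal n,
            a.coeff x.1 * b.coeff x.2).natDegree ≤ n / 2 := by
          refine Polynomial.natDegree_sum_le_of_forall_le _ _ fun x hx => ?_
          have h := Polynomial.natDegree_mul_le (p := a.coeff x.1) (q := b.coeff x.2)
          have h1 := ha x.1
          have h2 := hb x.2
          have h3 := Finset.HasAntidiagonal.mem_antidiagonal.mp hx
          omega
        omega }
  have hX : (Polynomial.X : Polynomial (Polynomial L)) ∈ S := by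
    intro n
    rw [Polynomial.coeff_X]
    split_ifs <;> simp
  have hCC (l : L) : (Polynomial.C (Polynomial.C l)) ∈ S := by
    intro n
    rw [Polynomial.coeff_C]
    split_ifs <;> simp
  have hmap (p : Polynomial L) : p.map Polynomial.C ∈ S := by
    induction p using Polynomial.induction_on' with
    | add p q hp hq => rw [Polynomial.map_add]; exact S.add_mem hp hq
    | monomial n a =>
      rw [Polynomial.map_monomial, ← Polynomial.C_mul_X_pow_eq_monomial]
      exact S.mul_mem (hCC a) (S.pow_mem hX n)
  have hmain : subst c P ∈ S := by
    induction P using Polynomial.induction_on' with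
    | add p q hp hq => rw [map_add]; exact S.add_mem hp hq
    | monomial n a =>
      rw [← Polynomial.C_mul_X_pow_eq_monomial, map_mul, map_pow, subst_C, subst_X]
      refine S.mul_mem (hmap a) (S.pow_mem ?_ n)
      intro k
      rw [Polynomial.coeff_X_pow_mul']
      split_ifs with hk
      · rw [Polynomial.coeff_C]
        split_ifs with h0
        · have h := Polynomial.natDegree_add_le (Polynomial.C c) Polynomial.X
          have h1 := Polynomial.natDegree_C c
          have h2 := Polynomial.natDegree_X_le (R := L)
          omega
        · simp
      · simp
  exact hmain n

/-- Specializing `y = -c` undoes the substitution on `P(0, y)`. -/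
lemma map_eval_neg_subst (c : L) (P : Polynomial (Polynomial L)) :
    (subst c P).map (Polynomial.evalRingHom (-c)) = P.coeff 0 := by
  have : (Polynomial.mapRingHom (Polynomial.evalRingHom (-c))).comp (subst c) =
      (Polynomial.constantCoeff : _ →+* Polynomial L) := by
    ext <;> simp
  exact congrArg (fun g : _ →+* Polynomial L => g P) this

/-- `P = x ^ k * U` with `U(0, 0) = l`. -/
def HasUnitForm (P : Polynomial (Polynomial L)) (k : ℕ) (l : L) : Prop :=
  ∃ U, P = Polynomial.X ^ k * U ∧ evalOrigin L U = l

lemma HasUnitForm.mul {P Q : Polynomial (Polynomial L)} {k n : ℕ} {l r : L}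
    (hP : HasUnitForm P k l) (hQ : HasUnitForm Q n r) : HasUnitForm (P * Q) (k + n) (l * r) := by
  obtain ⟨U, rfl, rfl⟩ := hP
  obtain ⟨V, rfl, rfl⟩ := hQ
  exact ⟨U * V, by ring, map_mul _ _ _⟩

lemma HasUnitForm.subst {P : Polynomial (Polynomial L)} {k : ℕ} {l : L}
    (hP : HasUnitForm P k l) (c : L) : HasUnitForm (subst c P) (2 * k) (c ^ k * l) := by
  obtain ⟨U, rfl, rfl⟩ := hP
  refine ⟨Polynomial.C (Polynomial.C c + Polynomial.X) ^ k * DyadicWild.subst c U, ?_, ?_⟩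
  · rw [map_mul, map_pow, subst_X]; ring
  · simp

lemma HasUnitForm.add_of_lt {P Q S : Polynomial (Polynomial L)} {k n m : ℕ} {l r s : L}
    (hP : HasUnitForm P k l) (hQ : HasUnitForm Q n r) (hS : HasUnitForm S m s)
    (h : P + Q = S) (hk : m < k) (hn : m < n) : s = 0 := by
  obtain ⟨U, rfl, rfl⟩ := hP
  obtain ⟨V, rfl, rfl⟩ := hQ
  obtain ⟨W, rfl, rfl⟩ := hS
  obtain ⟨i, rfl⟩ := Nat.exists_eq_add_of_lt hk
  obtain ⟨j, rfl⟩ := Nat.exists_eq_add_of_lt hn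
  have : W = Polynomial.X ^ (i + 1) * U + Polynomial.X ^ (j + 1) * V := by
    refine (Polynomial.Monic.isRegular (Polynomial.monic_X_pow m)).left ?_
    simp only
    rw [← h]; ring
  rw [this]; simp

lemma HasUnitForm.add_of_eq {P Q S : Polynomial (Polynomial L)} {k n : ℕ} {l r s : L}
    (hP : HasUnitForm P k l) (hQ : HasUnitForm Q n r) (hS : HasUnitForm S k s)
    (h : P + Q = S) (hn : k ≤ n) : s = l + if n = k then r else 0 := by
  obtain ⟨U, rfl, rfl⟩ := hP
  obtain ⟨V, rfl, rfl⟩ := hQ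
  obtain ⟨W, rfl, rfl⟩ := hS
  obtain ⟨j, rfl⟩ := Nat.exists_eq_add_of_le hn
  have : W = U + Polynomial.X ^ j * V := by
    refine (Polynomial.Monic.isRegular (Polynomial.monic_X_pow k)).left ?_
    simp only
    rw [← h]; ring
  rw [this]
  rcases j with _ | j <;> simp

lemma HasUnitForm.unique {P : Polynomial (Polynomial L)} {k n : ℕ} {l r : L}
    (hP : HasUnitForm P k l) (hQ : HasUnitForm P n r) (hl : l ≠ 0) (hr : r ≠ 0) :
    k = n ∧ l = r := by
  have h0 (N : ℕ) : HasUnitForm (0 : Polynomial (Polynomial L)) N 0 := ⟨0, by simp, map_zero _⟩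
  have hkn : k = n := by
    rcases lt_trichotomy k n with h | h | h
    · exact (hl (hQ.add_of_lt (h0 n) hP (add_zero P) h h)).elim
    · exact h
    · exact (hr (hP.add_of_lt (h0 k) hQ (add_zero P) h h)).elim
  subst hkn
  have := hP.add_of_eq (h0 (k + 1)) hQ (add_zero P) (by omega)
  exact ⟨rfl, by simpa using this.symm⟩

lemma exists_eq_X_pow_mul {P : Polynomial (Polynomial L)} (hP : P ≠ 0) :
    ∃ k U, P = Polynomial.X ^ k * U ∧ U.coeff 0 ≠ 0 := by
  have hd : Polynomial.X ^ P.natTrailingDegree ∣ P := by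
    rw [Polynomial.X_pow_dvd_iff]
    exact fun d hd => Polynomial.coeff_eq_zero_of_lt_natTrailingDegree hd
  obtain ⟨U, hU⟩ := hd
  refine ⟨_, U, hU, ?_⟩
  have h := Polynomial.trailingCoeff_nonzero_iff_nonzero.mpr hP
  rw [Polynomial.trailingCoeff] at h
  have h0 := congrArg (fun Q => Q.coeff P.natTrailingDegree) hU
  simp only [Polynomial.coeff_X_pow_mul', le_refl, if_true, Nat.sub_self] at h0
  rwa [← h0]

variable [IsDomain L]

lemma subst_ne_zero (c : L) {P : Polynomial (Polynomial L)} (hP : P ≠ 0) :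
    subst c P ≠ 0 := by
  obtain ⟨k, U, rfl, hU⟩ := exists_eq_X_pow_mul hP
  rw [map_mul, map_pow, subst_X]
  have h1 : Polynomial.C c + Polynomial.X ≠ 0 := by
    rw [add_comm]; exact Polynomial.X_add_C_ne_zero c
  have h2 : subst c U ≠ 0 := by
    intro h
    have := map_eval_neg_subst c U
    rw [h, Polynomial.map_zero] at this
    exact hU this.symm
  have h3 := Polynomial.C_ne_zero.mpr h1
  exact mul_ne_zero (pow_ne_zero _ (mul_ne_zero (pow_ne_zero _ Polynomial.X_ne_zero) h3)) h2

/-- The `y`-order of the lowest `x`-coefficient at least halves under a substitution. -/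
lemma exists_subst_form {c : L} (hc : c ≠ 0) (k : ℕ) {U : Polynomial (Polynomial L)}
    (hU : U.coeff 0 ≠ 0) :
    ∃ n V, subst c (Polynomial.X ^ k * U) = Polynomial.X ^ n * V ∧ V.coeff 0 ≠ 0 ∧
      2 * (V.coeff 0).natTrailingDegree ≤ (U.coeff 0).natTrailingDegree := by
  set e := (U.coeff 0).natTrailingDegree with he
  have hne : (subst c U).coeff e ≠ 0 := by
    intro h
    have h1 := congrArg (fun p => p.coeff e) (map_eval_neg_subst c U)
    simp only [Polynomial.coeff_map, h, map_zero] at h1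
    exact Polynomial.trailingCoeff_nonzero_iff_nonzero.mpr hU h1.symm
  have hU0 : subst c U ≠ 0 := fun h => hne (by simp [h])
  obtain ⟨w, V, hV, hV0⟩ := exists_eq_X_pow_mul hU0
  have hcoeff : (subst c U).coeff w = V.coeff 0 := by
    rw [hV]; simp [Polynomial.coeff_X_pow_mul']
  have hwe : w ≤ e := by
    by_contra! h
    exact hne (by rw [hV, Polynomial.coeff_X_pow_mul', if_neg (by omega)])
  have hdeg := two_mul_natDegree_coeff_subst_le c U w
  rw [hcoeff] at hdeg
  have htr := Polynomial.natTrailingDegree_le_natDegree (V.coeff 0)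
  set q : Polynomial L := Polynomial.C c + Polynomial.X with hq
  have hq0 : q.coeff 0 ≠ 0 := by simpa [hq] using hc
  have hqne : q ≠ 0 := fun h => hq0 (by simp [h])
  have hqk : (q ^ k).natTrailingDegree = 0 :=
    Polynomial.natTrailingDegree_eq_zero.mpr (Or.inr (by
      rw [Polynomial.coeff_zero_eq_eval_zero, Polynomial.eval_pow,
        ← Polynomial.coeff_zero_eq_eval_zero]
      exact pow_ne_zero _ hq0))
  have hco : ((Polynomial.C q) ^ k * V).coeff 0 = q ^ k * V.coeff 0 := by
    rw [← map_pow, Polynomial.coeff_C_mul]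
  refine ⟨2 * k + w, (Polynomial.C q) ^ k * V, ?_, ?_, ?_⟩
  · rw [map_mul, map_pow, subst_X, hV]; ring
  · rw [hco]; exact mul_ne_zero (pow_ne_zero _ hqne) hV0
  · rw [hco, Polynomial.natTrailingDegree_mul (pow_ne_zero _ hqne) hV0, hqk]
    omega

/-- Every nonzero polynomial acquires a unit form after finitely many substitutions. -/
lemma exists_hasUnitForm {c : ℕ → L} (hc : ∀ i, c i ≠ 0) {P : ℕ → Polynomial (Polynomial L)}
    (hP : ∀ i, P (i + 1) = subst (c i) (P i)) (h0 : P 0 ≠ 0) :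
    ∃ i k l, l ≠ 0 ∧ HasUnitForm (P i) k l := by
  suffices H : ∀ (e i k : ℕ) (U : Polynomial (Polynomial L)), P i = Polynomial.X ^ k * U →
      U.coeff 0 ≠ 0 → (U.coeff 0).natTrailingDegree = e →
      ∃ i k l, l ≠ 0 ∧ HasUnitForm (P i) k l by
    obtain ⟨k, U, h, hU⟩ := exists_eq_X_pow_mul h0
    exact H _ 0 k U h hU rfl
  intro e
  induction e using Nat.strong_induction_on with
  | _ e ih =>
    intro i k U hi hU he
    rcases Nat.eq_zero_or_pos e with h | h
    · refine ⟨i, k, evalOrigin L U, ?_, U, hi, rfl⟩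
      have := (Polynomial.natTrailingDegree_eq_zero.mp (he.trans h)).resolve_left hU
      simpa [evalOrigin] using this
    · obtain ⟨n, V, h1, h2, h3⟩ := exists_subst_form (hc i) k hU
      rw [← hi, ← hP] at h1
      exact ih _ (by omega) (i + 1) n V h1 h2 rfl

end Bivariate

section Chain

/-- `Q` has value `γ`, read off a unit form at level `i`, where `x` has value `(2⁻ⁱ, -s i)`. -/
def HasLevelValue {K : Type*} [CommRing K] (s : ℕ → ℕ) (i : ℕ)
    (Q : Polynomial (Polynomial (Polynomial K))) (γ : ℚ ×ₗ ℤ) : Prop :=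
  ∃ k l, l ≠ 0 ∧ HasUnitForm Q k l ∧
    γ = toLex ((k : ℚ) / 2 ^ i, (l.natTrailingDegree : ℤ) - k * s i)

/-- The parameters of the successive substitutions. -/
noncomputable def param (K : Type*) [CommRing K] (s : ℕ → ℕ) (i : ℕ) : Polynomial K :=
  Polynomial.X ^ (2 * s (i + 1) - s i)

/-- The composite of the first `i` substitutions on `K[x,y,z]`. -/
noncomputable def chain (K : Type*) [CommRing K] (s : ℕ → ℕ) :
    ℕ → MvPolynomial (Fin 3) K →+* Polynomial (Polynomial (Polynomial K))
  | 0 => MvPolynomial.eval₂Hom (S₁ := Polynomial (Polynomial (Polynomial K)))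
      (Polynomial.C.comp (Polynomial.C.comp Polynomial.C))
      ![Polynomial.X, Polynomial.C Polynomial.X, Polynomial.C (Polynomial.C Polynomial.X)]
  | i + 1 => (subst (param K s i)).comp (chain K s i)

variable {K : Type*} [Field K] {s : ℕ → ℕ}

lemma param_ne_zero (i : ℕ) : param K s i ≠ 0 := pow_ne_zero _ Polynomial.X_ne_zero

lemma chain_succ (i : ℕ) (P : MvPolynomial (Fin 3) K) :
    chain K s (i + 1) P = subst (param K s i) (chain K s i P) := rfl

lemma chain_zero_injective : Function.Injective (chain K s 0) := by
  let g : Polynomial (Polynomial (Polynomial K)) →+* MvPolynomial (Fin 3) K :=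
    Polynomial.eval₂RingHom (Polynomial.eval₂RingHom (Polynomial.eval₂RingHom
      MvPolynomial.C (X 2)) (X 1)) (X 0)
  have h : g.comp (chain K s 0) = RingHom.id _ := by
    refine MvPolynomial.ringHom_ext (fun r => ?_) (fun i => ?_)
    · simp [g, chain]
    · fin_cases i <;> simp [g, chain]
  exact Function.LeftInverse.injective (g := g) fun P => congrArg (fun f : _ →+* _ => f P) h

lemma chain_ne_zero {P : MvPolynomial (Fin 3) K} (hP : P ≠ 0) (i : ℕ) : chain K s i P ≠ 0 := by
  induction i with
  | zero => exact (map_ne_zero_iff _ chain_zero_injective).mpr hP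
  | succ i ih => exact subst_ne_zero _ ih

lemma chain_X_two (i : ℕ) :
    chain K s i (X 2) = Polynomial.C (Polynomial.C Polynomial.X) := by
  induction i with
  | zero => simp [chain]
  | succ i ih => rw [chain_succ, ih]; simp

lemma coeff_zero_evalOrigin_chain (i : ℕ) (P : MvPolynomial (Fin 3) K) :
    (evalOrigin _ (chain K s i P)).coeff 0 = MvPolynomial.constantCoeff P := by
  induction i with
  | zero =>
    have : (Polynomial.constantCoeff.comp (evalOrigin (Polynomial K))).comp (chain K s 0) =
        (MvPolynomial.constantCoeff : MvPolynomial (Fin 3) K →+* K) := by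
      refine MvPolynomial.ringHom_ext (fun r => ?_) (fun i => ?_)
      · simp [chain]
      · fin_cases i <;> simp [chain]
    exact congrArg (fun f : _ →+* K => f P) this
  | succ i ih => rw [chain_succ, evalOrigin_subst, ih]

lemma HasLevelValue.unique {i : ℕ} {Q : Polynomial (Polynomial (Polynomial K))} {γ δ : ℚ ×ₗ ℤ}
    (hγ : HasLevelValue s i Q γ) (hδ : HasLevelValue s i Q δ) : γ = δ := by
  obtain ⟨k, l, hl, h, rfl⟩ := hγ
  obtain ⟨n, r, hr, h', rfl⟩ := hδ
  obtain ⟨rfl, rfl⟩ := h.unique h' hl hr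
  rfl

lemma HasLevelValue.mul {i : ℕ} {P Q : Polynomial (Polynomial (Polynomial K))} {γ δ : ℚ ×ₗ ℤ}
    (hP : HasLevelValue s i P γ) (hQ : HasLevelValue s i Q δ) :
    HasLevelValue s i (P * Q) (γ + δ) := by
  obtain ⟨k, l, hl, h, rfl⟩ := hP
  obtain ⟨n, r, hr, h', rfl⟩ := hQ
  refine ⟨k + n, l * r, mul_ne_zero hl hr, h.mul h', ?_⟩
  rw [Polynomial.natTrailingDegree_mul hl hr, ← toLex_add, Prod.mk_add_mk]
  push_cast
  congr 2 <;> ring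

lemma HasLevelValue.subst {i : ℕ} (hs : s i ≤ 2 * s (i + 1))
    {Q : Polynomial (Polynomial (Polynomial K))} {γ : ℚ ×ₗ ℤ} (h : HasLevelValue s i Q γ) :
    HasLevelValue s (i + 1) (DyadicWild.subst (param K s i) Q) γ := by
  obtain ⟨k, l, hl, h, rfl⟩ := h
  have hp : param K s i ^ k ≠ 0 := pow_ne_zero _ (param_ne_zero i)
  refine ⟨2 * k, _, mul_ne_zero hp hl, h.subst _, ?_⟩
  rw [Polynomial.natTrailingDegree_mul hp hl, param, ← pow_mul,
    Polynomial.natTrailingDegree_X_pow]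
  push_cast [Nat.cast_sub hs]
  congr 2
  · field_simp; ring
  · ring

lemma HasLevelValue.min_le_add {i : ℕ} {P Q S : Polynomial (Polynomial (Polynomial K))}
    {γ δ ε : ℚ ×ₗ ℤ} (hP : HasLevelValue s i P γ) (hQ : HasLevelValue s i Q δ)
    (hS : HasLevelValue s i S ε) (h : P + Q = S) : min γ δ ≤ ε := by
  wlog hle : γ.1 ≤ δ.1 generalizing P Q γ δ
  · rw [min_comm]
    exact this hQ hP (by rw [add_comm, h]) (le_of_not_ge hle)
  obtain ⟨k, l, hl, hP, rfl⟩ := hP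
  obtain ⟨n, r, hr, hQ, rfl⟩ := hQ
  obtain ⟨m, t, ht, hS, rfl⟩ := hS
  have h2 : (0 : ℚ) < 2 ^ i := by positivity
  have hkn : k ≤ n := by
    have : (k : ℚ) / 2 ^ i ≤ n / 2 ^ i := hle
    rw [div_le_div_iff_of_pos_right h2] at this
    exact_mod_cast this
  rcases lt_trichotomy m k with hmk | rfl | hkm
  · exact (ht (hP.add_of_lt hQ hS h hmk (by omega))).elim
  · have ht' := hP.add_of_eq hQ hS h hkn
    split_ifs at ht' with hnm
    · subst hnm
      have : min l.natTrailingDegree r.natTrailingDegree ≤ t.natTrailingDegree := by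
        refine Polynomial.le_natTrailingDegree ht fun j hj => ?_
        rw [ht', Polynomial.coeff_add,
          Polynomial.coeff_eq_zero_of_lt_natTrailingDegree (lt_min_iff.mp hj).1,
          Polynomial.coeff_eq_zero_of_lt_natTrailingDegree (lt_min_iff.mp hj).2, add_zero]
      rcases min_le_iff.mp this with h' | h'
      · refine (min_le_left _ _).trans (Prod.Lex.toLex_le_toLex.mpr (Or.inr ⟨rfl, ?_⟩))
        simpa using h'
      · refine (min_le_right _ _).trans (Prod.Lex.toLex_le_toLex.mpr (Or.inr ⟨rfl, ?_⟩))
        simpa using h'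
    · rw [ht', add_zero]
      exact min_le_left _ _
  · refine (min_le_left _ _).trans (Prod.Lex.toLex_le_toLex.mpr (Or.inl ?_))
    have : (k : ℚ) < m := by exact_mod_cast hkm
    simp only
    gcongr

lemma hasLevelValue_X (i : ℕ) : HasLevelValue s i
    (Polynomial.X : Polynomial (Polynomial (Polynomial K))) (toLex (1 / 2 ^ i, -(s i : ℤ))) :=
  ⟨1, 1, one_ne_zero, ⟨1, by simp, map_one _⟩, by simp⟩

lemma HasLevelValue.chain_mono (hs : ∀ i, s i ≤ 2 * s (i + 1)) {i j : ℕ} (hij : i ≤ j)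
    {P : MvPolynomial (Fin 3) K} {γ : ℚ ×ₗ ℤ} (h : HasLevelValue s i (chain K s i P) γ) :
    HasLevelValue s j (chain K s j P) γ := by
  induction j, hij using Nat.le_induction with
  | base => exact h
  | succ j _ ih => exact ih.subst (hs j)

lemma exists_hasLevelValue {P : MvPolynomial (Fin 3) K} (hP : P ≠ 0) :
    ∃ γ i, HasLevelValue s i (chain K s i P) γ := by
  obtain ⟨i, k, l, hl, h⟩ := exists_hasUnitForm (c := param K s) param_ne_zero
    (P := fun i => chain K s i P) (fun i => chain_succ i P) (chain_ne_zero hP 0)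
  exact ⟨_, i, k, l, hl, h, rfl⟩

/-- The value of a polynomial, read off at any sufficiently high level. -/
noncomputable def value (s : ℕ → ℕ) (P : MvPolynomial (Fin 3) K) : ℚ ×ₗ ℤ :=
  open Classical in if h : P ≠ 0 then (exists_hasLevelValue (s := s) h).choose else 0

variable (hs : ∀ i, s i ≤ 2 * s (i + 1))

lemma exists_hasLevelValue_value {P : MvPolynomial (Fin 3) K} (hP : P ≠ 0) :
    ∃ i, HasLevelValue s i (chain K s i P) (value s P) := by
  rw [value, dif_pos hP]
  exact (exists_hasLevelValue (s := s) hP).choose_spec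

include hs

lemma value_eq {P : MvPolynomial (Fin 3) K} (hP : P ≠ 0) {i : ℕ} {γ : ℚ ×ₗ ℤ}
    (h : HasLevelValue s i (chain K s i P) γ) : value s P = γ := by
  obtain ⟨j, hj⟩ := exists_hasLevelValue_value (s := s) hP
  exact (hj.chain_mono hs (le_max_left j i)).unique (h.chain_mono hs (le_max_right j i))

lemma value_mul {P Q : MvPolynomial (Fin 3) K} (hP : P ≠ 0) (hQ : Q ≠ 0) :
    value s (P * Q) = value s P + value s Q := by
  obtain ⟨i, hi⟩ := exists_hasLevelValue_value (s := s) hP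
  obtain ⟨j, hj⟩ := exists_hasLevelValue_value (s := s) hQ
  refine value_eq hs (mul_ne_zero hP hQ) (i := max i j) ?_
  rw [map_mul]
  exact (hi.chain_mono hs (le_max_left i j)).mul (hj.chain_mono hs (le_max_right i j))

lemma min_value_le_value_add {P Q : MvPolynomial (Fin 3) K} (hP : P ≠ 0) (hQ : Q ≠ 0)
    (hPQ : P + Q ≠ 0) : min (value s P) (value s Q) ≤ value s (P + Q) := by
  obtain ⟨i, hi⟩ := exists_hasLevelValue_value (s := s) hP
  obtain ⟨j, hj⟩ := exists_hasLevelValue_value (s := s) hQ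
  obtain ⟨k, hk⟩ := exists_hasLevelValue_value (s := s) hPQ
  exact (hi.chain_mono hs (j := max i (max j k)) (by omega)).min_le_add
    (hj.chain_mono hs (by omega)) (hk.chain_mono hs (by omega)) (map_add _ _ _).symm

omit hs in
lemma value_fst_mem_dyadicSet {P : MvPolynomial (Fin 3) K} (hP : P ≠ 0) :
    (ofLex (value s P)).1 ∈ dyadicSet := by
  obtain ⟨i, k, l, hl, h, hv⟩ := exists_hasLevelValue_value (s := s) hP
  exact ⟨k, i, by rw [hv]; simp⟩

omit hs in
lemma value_nonneg {P : MvPolynomial (Fin 3) K} (hP : P ≠ 0) : 0 ≤ value s P := by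
  obtain ⟨i, k, l, hl, h, hv⟩ := exists_hasLevelValue_value (s := s) hP
  rw [hv]
  refine Prod.Lex.toLex_le_toLex.mpr ?_
  rcases Nat.eq_zero_or_pos k with rfl | hk
  · right; simp
  · left
    have : (0 : ℚ) < k := by exact_mod_cast hk
    simp only
    positivity

lemma value_eq_zero {P : MvPolynomial (Fin 3) K} (hP : MvPolynomial.constantCoeff P ≠ 0) :
    value s P = 0 := by
  have h := coeff_zero_evalOrigin_chain (s := s) 0 P
  have h0 : evalOrigin _ (chain K s 0 P) ≠ 0 := fun h0 => hP (by rw [← h, h0]; simp)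
  refine value_eq hs (fun h0 => hP (by simp [h0])) (i := 0)
    ⟨0, _, h0, ⟨_, by simp, rfl⟩, ?_⟩
  rw [Polynomial.natTrailingDegree_eq_zero.mpr (Or.inr (by rwa [h]))]
  simp only [CharP.cast_eq_zero, zero_div, zero_mul, sub_zero]
  rfl

omit hs in
lemma value_pos {P : MvPolynomial (Fin 3) K} (hP : P ≠ 0)
    (h0 : MvPolynomial.constantCoeff P = 0) : 0 < value s P := by
  obtain ⟨i, k, l, hl, ⟨U, hU, hUl⟩, hv⟩ := exists_hasLevelValue_value (s := s) hP
  rw [hv]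
  refine Prod.Lex.toLex_lt_toLex.mpr ?_
  rcases Nat.eq_zero_or_pos k with rfl | hk
  · right
    have h := coeff_zero_evalOrigin_chain (s := s) i P
    rw [hU, pow_zero, one_mul, hUl, h0] at h
    have : l.natTrailingDegree ≠ 0 := fun h' =>
      (Polynomial.natTrailingDegree_eq_zero.mp h').elim hl (fun h' => h' h)
    simp
    omega
  · left
    have : (0 : ℚ) < k := by exact_mod_cast hk
    simp only
    positivity

lemma value_X_two : value s (X 2 : MvPolynomial (Fin 3) K) = toLex (0, 1) := by
  refine value_eq hs (X_ne_zero 2) (i := 0) ⟨0, Polynomial.X, Polynomial.X_ne_zero,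
    ⟨Polynomial.C (Polynomial.C Polynomial.X), ?_, by simp⟩, by simp⟩
  rw [chain_X_two]; simp

lemma value_eq_add {A B : MvPolynomial (Fin 3) K} (hA : A ≠ 0) (hB : B ≠ 0) {i : ℕ}
    (h : chain K s i A = Polynomial.X * chain K s i B) :
    value s A = value s B + toLex (1 / 2 ^ i, -(s i : ℤ)) := by
  have key : ∀ j, i ≤ j → ∃ Q, chain K s j A = Q * chain K s j B ∧
      HasLevelValue s j Q (toLex (1 / 2 ^ i, -(s i : ℤ))) := by
    intro j hj
    induction j, hj using Nat.le_induction with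
    | base => exact ⟨_, h, hasLevelValue_X i⟩
    | succ j _ ih =>
      obtain ⟨Q, hQ, hQv⟩ := ih
      exact ⟨_, by rw [chain_succ, hQ, map_mul, ← chain_succ], hQv.subst (hs j)⟩
  obtain ⟨k, hk⟩ := exists_hasLevelValue_value (s := s) hB
  obtain ⟨Q, hQ, hQv⟩ := key (max i k) (le_max_left i k)
  refine value_eq hs hA (i := max i k) ?_
  rw [hQ, add_comm]
  exact hQv.mul (hk.chain_mono hs (le_max_right i k))

/-- Elements of small first value and very negative second value. -/
lemma exists_value_eq (i : ℕ) : ∃ A B : MvPolynomial (Fin 3) K, A ≠ 0 ∧ B ≠ 0 ∧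
    value s A = value s B + toLex (1 / 2 ^ i, -(s i : ℤ)) ∧
    (ofLex (value s B)).1 ≤ 3 ^ i - 1 ∧ (ofLex (value s B)).2 ≤ 0 := by
  suffices H : ∃ A B A' B' : MvPolynomial (Fin 3) K, A ≠ 0 ∧ B ≠ 0 ∧ A' ≠ 0 ∧ B' ≠ 0 ∧
      chain K s i A = Polynomial.X * chain K s i B ∧
      chain K s i A' = Polynomial.C Polynomial.X * chain K s i B' ∧
      (ofLex (value s B)).1 ≤ 3 ^ i - 1 ∧ (ofLex (value s B)).2 ≤ 0 ∧
      (ofLex (value s B')).1 ≤ 3 ^ (i + 1) - 1 ∧ (ofLex (value s B')).2 ≤ 0 by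
    obtain ⟨A, B, -, -, hA, hB, -, -, h, -, h1, h2, -⟩ := H
    exact ⟨A, B, hA, hB, value_eq_add hs hA hB h, h1, h2⟩
  induction i with
  | zero =>
    have h1 : value s (1 : MvPolynomial (Fin 3) K) = 0 := value_eq_zero hs (by simp)
    refine ⟨X 0, 1, X 1, 1, X_ne_zero _, one_ne_zero, X_ne_zero _, one_ne_zero, ?_, ?_, ?_⟩
    · simp [chain]
    · simp [chain]
    · rw [h1]; norm_num
  | succ i ih =>
    obtain ⟨A, B, A', B', hA, hB, hA', hB', e, e', h1, h2, h1', h2'⟩ := ih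
    have e1 : chain K s (i + 1) A = Polynomial.X ^ 2 *
        Polynomial.C (Polynomial.C (param K s i) + Polynomial.X) * chain K s (i + 1) B := by
      rw [chain_succ, e, map_mul, subst_X, chain_succ]
    have e1' : chain K s (i + 1) A' = Polynomial.X * chain K s (i + 1) B' := by
      rw [chain_succ, e', map_mul, subst_C, Polynomial.map_X, chain_succ]
    have hz : chain K s (i + 1) (X 2 ^ (2 * s (i + 1) - s i)) =
        Polynomial.C (Polynomial.C (param K s i)) := by
      rw [map_pow, chain_X_two, param]; simp
    have hB'' : B * A' ^ 2 ≠ 0 := mul_ne_zero hB (pow_ne_zero _ hA')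
    have e2 : chain K s (i + 1) (A * B' ^ 2 - X 2 ^ (2 * s (i + 1) - s i) * (B * A' ^ 2)) =
        Polynomial.C Polynomial.X * chain K s (i + 1) (B * A' ^ 2) := by
      simp only [map_sub, map_mul (chain K s (i + 1)), hz, map_pow (chain K s (i + 1)), e1, e1',
        map_add]
      ring
    have hv : value s (B * A' ^ 2) = value s B + (value s A' + value s A') := by
      rw [value_mul hs hB (pow_ne_zero _ hA'), pow_two, value_mul hs hA' hA']
    refine ⟨A', B', _, B * A' ^ 2, hA', hB', ?_, hB'', e1', e2, h1', h2', ?_, ?_⟩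
    · intro h
      rw [h, map_zero] at e2
      exact mul_ne_zero (Polynomial.C_ne_zero.mpr Polynomial.X_ne_zero)
        (chain_ne_zero hB'' (i + 1)) e2.symm
    · rw [hv, value_eq_add hs hA' hB' e1']
      simp only [ofLex_add, Prod.fst_add, ofLex_toLex]
      have h3 : (1 : ℚ) / 2 ^ (i + 1) ≤ 1 / 2 := by
        rw [pow_succ]
        have : (1 : ℚ) ≤ 2 ^ i := one_le_pow₀ (by norm_num)
        gcongr
        linarith
      have h4 : (1 : ℚ) ≤ 3 ^ i := one_le_pow₀ (by norm_num)
      have h5 : (3 : ℚ) ^ (i + 1) = 3 * 3 ^ i := pow_succ' _ _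
      have h6 : (3 : ℚ) ^ (i + 1 + 1) = 3 * (3 * 3 ^ i) := by rw [pow_succ', h5]
      rw [h5] at h1'
      rw [h6]
      linarith
    · rw [hv, value_eq_add hs hA' hB' e1']
      simp only [ofLex_add, Prod.snd_add, ofLex_toLex]
      omega

end Chain

section Extension

/-- A valuation on a domain extends to its fraction field. -/
lemma exists_extension {A : Type*} [CommRing A] [IsDomain A] (v : A → ℚ ×ₗ ℤ)
    (hmul : ∀ a b, a ≠ 0 → b ≠ 0 → v (a * b) = v a + v b)
    (hadd : ∀ a b, a ≠ 0 → b ≠ 0 → a + b ≠ 0 → min (v a) (v b) ≤ v (a + b)) :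
    ∃ w : FractionRing A → ℚ ×ₗ ℤ,
      (∀ x a b, a ≠ 0 → b ≠ 0 → x * algebraMap A (FractionRing A) b = algebraMap _ _ a →
        w x = v a - v b) ∧
      (∀ x y, x ≠ 0 → y ≠ 0 → w (x * y) = w x + w y) ∧
      (∀ x y, x ≠ 0 → y ≠ 0 → x + y ≠ 0 → min (w x) (w y) ≤ w (x + y)) := by
  have hinj := IsFractionRing.injective A (FractionRing A)
  have hrep (x : FractionRing A) : ∃ p : A × A, p.2 ≠ 0 ∧
      x * algebraMap A (FractionRing A) p.2 = algebraMap _ _ p.1 := by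
    obtain ⟨a, b, hb, rfl⟩ := IsFractionRing.div_surjective A x
    have hb0 := nonZeroDivisors.ne_zero hb
    exact ⟨(a, b), hb0, div_mul_cancel₀ _ ((map_ne_zero_iff _ hinj).mpr hb0)⟩
  choose r hr0 hr using hrep
  have hne {x : FractionRing A} (hx : x ≠ 0) {a b : A} (hb : b ≠ 0)
      (h : x * algebraMap A (FractionRing A) b = algebraMap _ _ a) : a ≠ 0 := by
    rintro rfl
    rw [map_zero] at h
    exact mul_ne_zero hx ((map_ne_zero_iff _ hinj).mpr hb) h
  have hw (x : FractionRing A) (a b : A) (ha : a ≠ 0) (hb : b ≠ 0)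
      (h : x * algebraMap A (FractionRing A) b = algebraMap _ _ a) :
      v (r x).1 - v (r x).2 = v a - v b := by
    have hx : x ≠ 0 := by
      rintro rfl
      rw [zero_mul] at h
      exact (map_ne_zero_iff _ hinj).mpr ha h.symm
    have h1 : (r x).1 * b = a * (r x).2 := by
      apply hinj
      rw [map_mul, map_mul, ← h, ← hr x]
      ring
    have h2 := congrArg v h1
    rw [hmul _ _ (hne hx (hr0 x) (hr x)) hb, hmul _ _ ha (hr0 x)] at h2
    rw [sub_eq_sub_iff_add_eq_add, h2]
  refine ⟨fun x => v (r x).1 - v (r x).2, hw, fun x y hx hy => ?_, fun x y hx hy hxy => ?_⟩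
  · have h1 := hne hx (hr0 x) (hr x)
    have h2 := hne hy (hr0 y) (hr y)
    have h3 := hw (x * y) _ _ (mul_ne_zero h1 h2) (mul_ne_zero (hr0 x) (hr0 y)) (by
      rw [map_mul, map_mul, ← hr x, ← hr y]; ring)
    simp only
    rw [h3, hmul _ _ h1 h2, hmul _ _ (hr0 x) (hr0 y)]
    abel
  · have h1 := hne hx (hr0 x) (hr x)
    have h2 := hne hy (hr0 y) (hr y)
    have h4 := mul_ne_zero (hr0 x) (hr0 y)
    have hs : (x + y) * algebraMap A (FractionRing A) ((r x).2 * (r y).2) =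
        algebraMap _ _ ((r x).1 * (r y).2 + (r y).1 * (r x).2) := by
      rw [map_add, map_mul, map_mul, map_mul, ← hr x, ← hr y]; ring
    have h5 := hne hxy h4 hs
    have h6 := hadd _ _ (mul_ne_zero h1 (hr0 y)) (mul_ne_zero h2 (hr0 x)) h5
    simp only
    rw [hw (x + y) _ _ h5 h4 hs, hmul _ _ (hr0 x) (hr0 y)]
    rw [hmul _ _ h1 (hr0 y), hmul _ _ h2 (hr0 x)] at h6
    rcases min_le_iff.mp h6 with h | h
    · refine (min_le_left _ _).trans ?_
      rw [le_sub_iff_add_le]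
      convert h using 1
      abel
    · refine (min_le_right _ _).trans ?_
      rw [le_sub_iff_add_le]
      convert h using 1
      abel

/-- The values of a nonnegative valuation on a Noetherian domain are well ordered. -/
lemma exists_min_value {A : Type*} [CommRing A] [IsDomain A] [IsNoetherianRing A]
    (u : A → ℚ ×ₗ ℤ) (hmul : ∀ a b, a ≠ 0 → b ≠ 0 → u (a * b) = u a + u b)
    (hadd : ∀ a b, a ≠ 0 → b ≠ 0 → a + b ≠ 0 → min (u a) (u b) ≤ u (a + b))
    (hpos : ∀ a, a ≠ 0 → 0 ≤ u a) {T : Set A} (hT : T.Nonempty) (h0 : 0 ∉ T) :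
    ∃ a ∈ T, ∀ b ∈ T, u a ≤ u b := by
  let I (γ : ℚ ×ₗ ℤ) : Ideal A :=
    { carrier := {a | a ≠ 0 → γ ≤ u a}
      zero_mem' := fun h => (h rfl).elim
      add_mem' := by
        intro a b ha hb hab
        by_cases ha0 : a = 0
        · subst ha0
          rw [zero_add] at hab ⊢
          exact hb hab
        by_cases hb0 : b = 0
        · subst hb0
          rw [add_zero] at hab ⊢
          exact ha hab
        exact (le_min (ha ha0) (hb hb0)).trans (hadd a b ha0 hb0 hab)
      smul_mem' := by
        intro c a ha hca
        have hc0 := left_ne_zero_of_mul hca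
        have ha0 := right_ne_zero_of_mul hca
        rw [smul_eq_mul, hmul c a hc0 ha0]
        exact (ha ha0).trans (le_add_of_nonneg_left (hpos c hc0)) }
  obtain ⟨J, ⟨a, ha, rfl⟩, hJ⟩ := (wellFounded_gt (α := Ideal A)).has_min
    ((fun a => I (u a)) '' T) (hT.image _)
  refine ⟨a, ha, fun b hb => ?_⟩
  by_contra! hlt
  refine hJ _ ⟨b, hb, rfl⟩ (lt_of_le_of_ne (fun x hx hx0 => hlt.le.trans (hx hx0)) ?_)
  intro h
  have hmem : b ∈ I (u a) := by
    have hbb : b ∈ I (u b) := fun _ => le_rfl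
    simpa only [h] using hbb
  exact absurd (hmem fun h => h0 (h ▸ hb)) hlt.not_ge

lemma mem_dyadicSet_div {h : ℚ} (hh : h ∈ dyadicSet) (N : ℕ) : h / 2 ^ N ∈ dyadicSet := by
  obtain ⟨a, k, rfl⟩ := hh
  exact ⟨a, k + N, by rw [div_div, pow_add]⟩

lemma sub_mem_dyadicSet {g h : ℚ} (hg : g ∈ dyadicSet) (hh : h ∈ dyadicSet) :
    g - h ∈ dyadicSet := by
  obtain ⟨a, k, rfl⟩ := hg
  obtain ⟨b, n, rfl⟩ := hh
  refine ⟨a * 2 ^ n - b * 2 ^ k, k + n, ?_⟩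
  push_cast
  rw [pow_add]
  field_simp

/-- An order automorphism of `ℤ[1/2] ×ₗ ℤ` only rescales the first component. -/
lemma exists_scaling {M : Type*} [AddCommGroup M] (v w : M →+ ℚ ×ₗ ℤ)
    (hv : ∀ γ : ℚ ×ₗ ℤ, (∃ x, v x = γ) ↔ (ofLex γ).1 ∈ dyadicSet)
    (hw : ∀ γ : ℚ ×ₗ ℤ, (∃ x, w x = γ) ↔ (ofLex γ).1 ∈ dyadicSet)
    (hvw : ∀ x, 0 ≤ v x ↔ 0 ≤ w x) :
    ∃ c : ℚ, ∀ x, w x = toLex (c * (ofLex (v x)).1, (ofLex (v x)).2) := by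
  have hker {x y : M} (h : v x = v y) : w x = w y := by
    apply le_antisymm
    · rw [← sub_nonneg, ← map_sub, ← hvw, map_sub, h, sub_self]
    · rw [← sub_nonneg, ← map_sub, ← hvw, map_sub, h, sub_self]
  have hlt (x : M) : 0 < v x ↔ 0 < w x := by
    have h := hvw (-x)
    rw [map_neg, map_neg, neg_nonneg, neg_nonneg] at h
    rw [← not_le, ← not_le, h]
  have hone {γ : ℚ ×ₗ ℤ} (h : 0 < γ) : toLex (0, 1) ≤ γ := by
    rw [Prod.Lex.lt_iff] at h
    rw [Prod.Lex.le_iff]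
    rcases h with h | ⟨h, h'⟩
    · exact Or.inl h
    · exact Or.inr ⟨h, h'⟩
  have hpos : (0 : ℚ ×ₗ ℤ) < toLex (0, 1) := by
    rw [Prod.Lex.lt_iff]
    exact Or.inr ⟨rfl, zero_lt_one⟩
  have hd0 : (0 : ℚ) ∈ dyadicSet := ⟨0, 0, by simp⟩
  obtain ⟨z, hz⟩ := (hv (toLex (0, 1))).mpr hd0
  have hwz : w z = toLex (0, 1) := by
    apply le_antisymm
    · obtain ⟨t, ht⟩ := (hw (toLex (0, 1))).mpr hd0
      have h1 : 0 < v t := by rw [hlt, ht]; exact hpos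
      rw [← ht, ← sub_nonneg, ← map_sub, ← hvw, map_sub, hz, sub_nonneg]
      exact hone h1
    · refine hone ((hlt z).mp ?_)
      rw [hz]; exact hpos
  obtain ⟨e, he⟩ := (hv (toLex (1, 0))).mpr ⟨1, 0, by simp⟩
  refine ⟨(ofLex (w e)).1, fun x => ?_⟩
  have hx := (hv (v x)).mp ⟨x, rfl⟩
  have hsnd : (ofLex (w x)).2 = (ofLex (v x)).2 := by
    have hdvd (N : ℕ) : (2 : ℤ) ^ N ∣ (ofLex (w x)).2 - (ofLex (v x)).2 := by
      obtain ⟨t, ht⟩ := (hv (toLex ((ofLex (v x)).1 / 2 ^ N, 0))).mpr (mem_dyadicSet_div hx N)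
      have h1 : v x = v ((2 ^ N : ℕ) • t + (ofLex (v x)).2 • z) := by
        rw [map_add, map_nsmul, map_zsmul, ht, hz]
        apply ofLex.injective
        ext
        · simp [mul_div_cancel₀]
        · simp
      have h2 := congrArg (fun γ : ℚ ×ₗ ℤ => (ofLex γ).2) (hker h1)
      rw [map_add, map_nsmul, map_zsmul, hwz] at h2
      simp only [ofLex_add, Prod.snd_add] at h2
      refine ⟨(ofLex (w t)).2, ?_⟩
      rw [h2]
      simp
    rw [← sub_eq_zero]
    refine Int.eq_zero_of_abs_lt_dvd (hdvd ((ofLex (w x)).2 - (ofLex (v x)).2).natAbs) ?_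
    rw [Int.abs_eq_natAbs]
    exact_mod_cast Nat.lt_two_pow_self
  have hfst : (ofLex (w x)).1 = (ofLex (w e)).1 * (ofLex (v x)).1 := by
    obtain ⟨a, k, hak⟩ := hx
    have h1 : v ((2 ^ k : ℕ) • x) = v (a • e + (2 ^ k * (ofLex (v x)).2) • z) := by
      rw [map_add, map_nsmul, map_zsmul, map_zsmul, he, hz]
      apply ofLex.injective
      ext
      · simp [hak, mul_div_cancel₀]
      · simp
    have h2 := congrArg (fun γ : ℚ ×ₗ ℤ => (ofLex γ).1) (hker h1)
    rw [map_add, map_nsmul, map_zsmul, map_zsmul, hwz] at h2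
    simp only [ofLex_add, Prod.fst_add] at h2
    rw [hak]
    have h3 : (2 : ℚ) ^ k * (ofLex (w x)).1 = a * (ofLex (w e)).1 := by simpa using h2
    field_simp
    linarith
  apply ofLex.injective
  exact Prod.ext hfst hsnd

/-- A multiplicative function on the nonzero elements of a field, as a homomorphism. -/
def unitsHom {F : Type*} [Field F] (v : F → ℚ ×ₗ ℤ)
    (hmul : ∀ x y, x ≠ 0 → y ≠ 0 → v (x * y) = v x + v y) : Additive Fˣ →+ ℚ ×ₗ ℤ :=
  AddMonoidHom.mk' (fun x => v (x.toMul : F)) fun x y => by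
    simpa using hmul x.toMul y.toMul x.toMul.ne_zero y.toMul.ne_zero

lemma exists_unitsHom_eq_iff {F : Type*} [Field F] (v : F → ℚ ×ₗ ℤ)
    (hmul : ∀ x y, x ≠ 0 → y ≠ 0 → v (x * y) = v x + v y) (γ : ℚ ×ₗ ℤ) :
    (∃ x, unitsHom v hmul x = γ) ↔ ∃ x, x ≠ 0 ∧ v x = γ :=
  ⟨fun ⟨x, hx⟩ => ⟨x.toMul, x.toMul.ne_zero, hx⟩,
    fun ⟨x, hx, h⟩ => ⟨Additive.ofMul (Units.mk0 x hx), h⟩⟩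

lemma mem_mxyz_iff {K : Type*} [Field K] (P : MvPolynomial (Fin 3) K) :
    P ∈ mxyz K ↔ MvPolynomial.constantCoeff P = 0 := by
  have h : ({X 0, X 1, X 2} : Set (MvPolynomial (Fin 3) K)) = X '' Set.univ := by
    ext p
    simp [Fin.exists_fin_succ, eq_comm]
  rw [mxyz, h, MvPolynomial.mem_ideal_span_X_image, MvPolynomial.constantCoeff_eq,
    ← MvPolynomial.notMem_support_iff]
  constructor
  · intro h h0
    simpa using h 0 h0
  · intro h m hm
    by_contra! h'
    have : m = 0 := Finsupp.ext fun i => h' i (Set.mem_univ i)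
    exact h (this ▸ hm)

end Extension

end DyadicWild

open DyadicWild

/-- **Example 2 of the paper.**  Given a nonincreasing `f : ℕ → ℤ`, there is a
valuation `ν` of `K(x,y,z)` with value group exactly `H × ℤ` (`H = ℤ[1/2]`), lexicographically
ordered, dominating `R = K[x,y,z]_{(x,y,z)}`, such that for every equivalent valuation `ω`
with value group `H × ℤ` there is `n₀` such that for all `n ≥ n₀` there is
`λ ∈ ω₂(R∖{0}) ∩ [0, n)` with `π₂(λ̃) < f(n)`. -/
theorem stmt17 (K : Type*) [Field K] (f : ℕ → ℤ) (hf : ∀ m n : ℕ, n ≤ m → f m ≤ f n) :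
    ∃ ν : FractionRing (MvPolynomial (Fin 3) K) → ℚ ×ₗ ℤ,
      (∀ x y : FractionRing (MvPolynomial (Fin 3) K), x ≠ 0 → y ≠ 0 →
        ν (x * y) = ν x + ν y) ∧
      (∀ x y : FractionRing (MvPolynomial (Fin 3) K), x ≠ 0 → y ≠ 0 → x + y ≠ 0 →
        min (ν x) (ν y) ≤ ν (x + y)) ∧
      -- the value group is exactly `H × ℤ`
      ({γ : ℚ ×ₗ ℤ | ∃ x : FractionRing (MvPolynomial (Fin 3) K), x ≠ 0 ∧ ν x = γ}
        = {γ : ℚ ×ₗ ℤ | (ofLex γ).1 ∈ dyadicSet}) ∧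
      -- `ν` dominates `R`
      (∀ x ∈ Rxyz K, x ≠ 0 → 0 ≤ ν x) ∧
      (∀ x ∈ mRxyz K, x ≠ 0 → 0 < ν x) ∧
      (∀ x ∈ Rxyz K, x ≠ 0 → 0 < ν x → x ∈ mRxyz K) ∧
      -- the wild behavior of the tilde function, for any equivalent valuation
      (∀ ω : FractionRing (MvPolynomial (Fin 3) K) → ℚ ×ₗ ℤ,
        (∀ x y : FractionRing (MvPolynomial (Fin 3) K), x ≠ 0 → y ≠ 0 →
          ω (x * y) = ω x + ω y) →
        (∀ x y : FractionRing (MvPolynomial (Fin 3) K), x ≠ 0 → y ≠ 0 → x + y ≠ 0 →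
          min (ω x) (ω y) ≤ ω (x + y)) →
        ({γ : ℚ ×ₗ ℤ | ∃ x : FractionRing (MvPolynomial (Fin 3) K), x ≠ 0 ∧ ω x = γ}
          = {γ : ℚ ×ₗ ℤ | (ofLex γ).1 ∈ dyadicSet}) →
        -- `ω` is equivalent to `ν`: they have the same valuation ring
        ({x : FractionRing (MvPolynomial (Fin 3) K) | x = 0 ∨ 0 ≤ ν x}
          = {x : FractionRing (MvPolynomial (Fin 3) K) | x = 0 ∨ 0 ≤ ω x}) →
        ∃ n₀ : ℕ, ∀ n : ℕ, n₀ ≤ n →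
          ∃ lam : ℚ,
            (∃ g : FractionRing (MvPolynomial (Fin 3) K),
              g ∈ Rxyz K ∧ g ≠ 0 ∧ (ofLex (ω g)).1 = lam) ∧
            0 ≤ lam ∧ lam < (n : ℚ) ∧
            ∃ lt : ℚ ×ₗ ℤ,
              IsLeast {γ : ℚ ×ₗ ℤ | ∃ g : FractionRing (MvPolynomial (Fin 3) K),
                g ∈ Rxyz K ∧ g ≠ 0 ∧ (ofLex (ω g)).1 = lam ∧ ω g = γ} lt ∧
              (ofLex lt).2 < f n) := by
  have hanti : Antitone f := fun a b h => hf b a h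
  let s : ℕ → ℕ := fun j => (1 - f (6 ^ (j + 1))).toNat
  have hs : ∀ i, s i ≤ 2 * s (i + 1) := by
    intro i
    have h1 : f (6 ^ (i + 1 + 1)) ≤ f (6 ^ (i + 1)) :=
      hanti (Nat.pow_le_pow_right (by norm_num) (by omega))
    have h2 : s i ≤ s (i + 1) := Int.toNat_le_toNat (by omega)
    omega
  have hinj := IsFractionRing.injective (MvPolynomial (Fin 3) K)
    (FractionRing (MvPolynomial (Fin 3) K))
  obtain ⟨ν, hν, hmul, hadd⟩ := exists_extension (value s)
    (fun P Q hP hQ => value_mul (K := K) hs hP hQ)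
    (fun P Q hP hQ hPQ => min_value_le_value_add hs hP hQ hPQ)
  have hνa (P : MvPolynomial (Fin 3) K) (hP : P ≠ 0) : ν (algebraMap _ _ P) = value s P := by
    rw [hν _ P 1 hP one_ne_zero (by simp), value_eq_zero (P := 1) hs (by simp), sub_zero]
  have hR {x : FractionRing (MvPolynomial (Fin 3) K)} (hx : x ≠ 0)
      {p q : MvPolynomial (Fin 3) K} (hq : q ∉ mxyz K)
      (h : x * algebraMap _ _ q = algebraMap _ _ p) : p ≠ 0 ∧ ν x = value s p := by
    rw [mem_mxyz_iff] at hq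
    have hq0 : q ≠ 0 := fun h => hq (by simp [h])
    have hp0 : p ≠ 0 := by
      rintro rfl
      rw [map_zero] at h
      exact mul_ne_zero hx ((map_ne_zero_iff _ hinj).mpr hq0) h
    exact ⟨hp0, by rw [hν x p q hp0 hq0 h, value_eq_zero hs hq, sub_zero]⟩
  have hrange (γ : ℚ ×ₗ ℤ) : (∃ x, x ≠ 0 ∧ ν x = γ) ↔ (ofLex γ).1 ∈ dyadicSet := by
    constructor
    · rintro ⟨x, hx, rfl⟩
      obtain ⟨a, b, hb, rfl⟩ := IsFractionRing.div_surjective (MvPolynomial (Fin 3) K) x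
      have hb0 := nonZeroDivisors.ne_zero hb
      have ha0 : a ≠ 0 := by
        rintro rfl
        simp at hx
      rw [hν _ a b ha0 hb0 (div_mul_cancel₀ _ ((map_ne_zero_iff _ hinj).mpr hb0))]
      exact sub_mem_dyadicSet (value_fst_mem_dyadicSet ha0) (value_fst_mem_dyadicSet hb0)
    · rintro ⟨a, j, haj⟩
      obtain ⟨A, B, hA, hB, hAB, -⟩ := exists_value_eq (K := K) hs j
      have hA' := (map_ne_zero_iff _ hinj).mpr hA
      have hB' := (map_ne_zero_iff _ hinj).mpr hB
      have hz := hνa (X 2) (X_ne_zero 2)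
      rw [value_X_two hs] at hz
      have ht := hν (algebraMap _ _ A / algebraMap _ _ B) A B hA hB (div_mul_cancel₀ _ hB')
      rw [hAB, add_sub_cancel_left] at ht
      obtain ⟨t, ht⟩ := (exists_unitsHom_eq_iff ν hmul _).mpr ⟨_, div_ne_zero hA' hB', ht⟩
      obtain ⟨z, hz⟩ := (exists_unitsHom_eq_iff ν hmul _).mpr
        ⟨_, (map_ne_zero_iff _ hinj).mpr (X_ne_zero 2), hz⟩
      refine (exists_unitsHom_eq_iff ν hmul γ).mp ⟨a • t + ((ofLex γ).2 + a * s j) • z, ?_⟩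
      rw [map_add, map_zsmul, map_zsmul, ht, hz]
      apply ofLex.injective
      ext
      · simp [haj, div_eq_mul_inv]
      · simp
  have hνR : ∀ x ∈ Rxyz K, x ≠ 0 → 0 ≤ ν x := by
    rintro x ⟨p, q, hq, h⟩ hx
    obtain ⟨hp, hxp⟩ := hR hx hq h
    rw [hxp]
    exact value_nonneg hp
  refine ⟨ν, hmul, hadd, Set.ext hrange, hνR, ?_, ?_, ?_⟩
  · rintro x ⟨p, q, hp, hq, h⟩ hx
    obtain ⟨hp0, hxp⟩ := hR hx hq h
    rw [hxp]
    exact value_pos hp0 ((mem_mxyz_iff p).mp hp)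
  · rintro x ⟨p, q, hq, h⟩ hx hpos
    obtain ⟨hp0, hxp⟩ := hR hx hq h
    refine ⟨p, q, (mem_mxyz_iff p).mpr ?_, hq, h⟩
    by_contra hp
    rw [hxp, value_eq_zero hs hp] at hpos
    exact lt_irrefl _ hpos
  · intro ω ωmul ωadd ωrange hequiv
    obtain ⟨c, hc⟩ := exists_scaling (unitsHom ν hmul) (unitsHom ω ωmul)
      (fun γ => (exists_unitsHom_eq_iff ν hmul γ).trans (hrange γ))
      (fun γ => (exists_unitsHom_eq_iff ω ωmul γ).trans (Set.ext_iff.mp ωrange γ))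
      (fun x => by
        have h := Set.ext_iff.mp hequiv (x.toMul : FractionRing (MvPolynomial (Fin 3) K))
        change 0 ≤ ν (x.toMul : FractionRing (MvPolynomial (Fin 3) K)) ↔
          0 ≤ ω (x.toMul : FractionRing (MvPolynomial (Fin 3) K))
        simpa only [Set.mem_ofPred_eq, x.toMul.ne_zero, false_or] using h)
    have hων (x : FractionRing (MvPolynomial (Fin 3) K)) (hx : x ≠ 0) :
        ω x = toLex (c * (ofLex (ν x)).1, (ofLex (ν x)).2) :=
      hc (Additive.ofMul (Units.mk0 x hx))
    have hωpos (x : FractionRing (MvPolynomial (Fin 3) K)) (hx : x ≠ 0) (h : 0 ≤ ν x) :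
        0 ≤ ω x :=
      ((Set.ext_iff.mp hequiv x).mp (Or.inr h)).resolve_left hx
    have hmem (P : MvPolynomial (Fin 3) K) : algebraMap _ _ P ∈ Rxyz K :=
      ⟨P, 1, by rw [mem_mxyz_iff]; simp, by simp⟩
    have hne {P : MvPolynomial (Fin 3) K} (hP : P ≠ 0) :
        algebraMap _ (FractionRing (MvPolynomial (Fin 3) K)) P ≠ 0 :=
      (map_ne_zero_iff _ hinj).mpr hP
    obtain ⟨k, hk⟩ := pow_unbounded_of_one_lt c (one_lt_two : (1 : ℚ) < 2)
    refine ⟨6 ^ k + 1, fun n hn => ?_⟩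
    obtain ⟨j, hj⟩ : ∃ j, Nat.log 6 (n - 1) = j := ⟨_, rfl⟩
    have hkj : k ≤ j := hj ▸ Nat.le_log_of_pow_le (by norm_num) (by omega)
    have hpos6 : 0 < 6 ^ k := by positivity
    have hjn : 6 ^ j < n := by
      have := Nat.pow_log_le_self 6 (x := n - 1) (by omega)
      rw [hj] at this
      omega
    have hnj : n ≤ 6 ^ (j + 1) := by
      have := Nat.lt_pow_succ_log_self (b := 6) (by norm_num) (n - 1)
      rw [hj] at this
      change n - 1 < 6 ^ (j + 1) at this
      omega
    obtain ⟨A, B, hA, hB, hAB, hB1, hB2⟩ := exists_value_eq (K := K) hs j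
    have hωA := hων _ (hne hA)
    rw [hνa A hA, hAB] at hωA
    simp only [ofLex_add, ofLex_toLex, Prod.fst_add, Prod.snd_add] at hωA
    have hA0 := hωpos _ (hne hA) (hνR _ (hmem A) (hne hA))
    set g := algebraMap _ (FractionRing (MvPolynomial (Fin 3) K)) A with hg
    obtain ⟨P, ⟨hP0, hP1⟩, hPmin⟩ := exists_min_value
      (fun P : MvPolynomial (Fin 3) K => ω (algebraMap _ _ P))
      (fun a b ha hb => by
        simp only [map_mul]
        exact ωmul _ _ (hne ha) (hne hb))
      (fun a b ha hb hab => by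
        have h := hne hab
        simp only [map_add] at h ⊢
        exact ωadd _ _ (hne ha) (hne hb) h)
      (fun a ha => hωpos _ (hne ha) (hνR _ (hmem a) (hne ha)))
      (T := {P | P ≠ 0 ∧ (ofLex (ω (algebraMap _ _ P))).1 = (ofLex (ω g)).1})
      ⟨A, hA, rfl⟩ (fun h => h.1 rfl)
    have hleast : ∀ x ∈ Rxyz K, x ≠ 0 → (ofLex (ω x)).1 = (ofLex (ω g)).1 →
        ω (algebraMap _ _ P) ≤ ω x := by
      rintro x ⟨p, q, hq, h⟩ hx hx1
      obtain ⟨hp0, hxp⟩ := hR hx hq h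
      have hωp : ω x = ω (algebraMap _ _ p) := by
        rw [hων x hx, hων _ (hne hp0), hνa p hp0, hxp]
      rw [hωp] at hx1 ⊢
      exact hPmin p ⟨hp0, hx1⟩
    refine ⟨(ofLex (ω g)).1, ⟨g, hmem A, hne hA, rfl⟩, ?_, ?_, ω (algebraMap _ _ P),
      ⟨⟨_, hmem P, hne hP0, hP1, rfl⟩, ?_⟩, ?_⟩
    · rcases Prod.Lex.le_iff.mp hA0 with h | h
      · exact h.le
      · exact h.1.le
    · have hv0 : 0 ≤ (ofLex (value s B)).1 := by
        rcases Prod.Lex.le_iff.mp (value_nonneg (s := s) hB) with h | h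
        · exact h.le
        · exact h.1.le
      have h1 : (1 : ℚ) / 2 ^ j ≤ 1 := by
        rw [div_le_one (by positivity)]
        exact one_le_pow₀ (by norm_num)
      have h2 : (0 : ℚ) ≤ 1 / 2 ^ j := by positivity
      have h3 : (2 : ℚ) ^ k ≤ 2 ^ j := pow_le_pow_right₀ (by norm_num) hkj
      rw [hωA]
      calc c * ((ofLex (value s B)).1 + 1 / 2 ^ j)
          ≤ 2 ^ j * 3 ^ j := by
            refine mul_le_mul (hk.le.trans h3) (by linarith) (by linarith) (by positivity)
        _ = 6 ^ j := by rw [← mul_pow]; norm_num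
        _ < n := by exact_mod_cast hjn
    · rintro γ ⟨x, hxR, hx0, hx1, rfl⟩
      exact hleast x hxR hx0 hx1
    · have h1 : (ofLex (ω (algebraMap _ _ P))).2 ≤ (ofLex (ω g)).2 := by
        rcases Prod.Lex.le_iff.mp (hleast g (hmem A) (hne hA) rfl) with h | h
        · exact absurd hP1 h.ne
        · exact h.2
      have h2 : f (6 ^ (j + 1)) ≤ f n := hanti hnj
      have h3 : 1 - f (6 ^ (j + 1)) ≤ s j := Int.self_le_toNat _
      rw [hωA] at h1
      simp only [ofLex_toLex] at h1
      omega
end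

section
/- Let K be a field and let g : ℕ → ℤ be nondecreasing (g(m) ≥ g(n) whenever m ≥ n). Let H = ℤ[1/2] ⊆ ℚ. Then there exists a valuation ν of the rational function field K(x,y,z) with value group exactly H × ℤ, ordered lexicographically, dominating the regular local ring R = K[x,y,z]_{(x,y,z)}, with the following property: for every valuation ω of K(x,y,z), taking values in the lexicographically ordered group H × ℤ with ω(K(x,y,z)∖{0}) = H × ℤ, which is equivalent to ν (i.e. has the same valuation ring as ν), there exists n₀ ∈ ℕ such that for every integer n ≥ n₀ there is λ ∈ ω₂(R∖{0}) with 0 ≤ λ < n and π₂(λ̃) > g(n), where ω₂ = π₁∘ω, λ̃ = min{ω(h) : h ∈ R∖{0}, ω₂(h) = λ}, and π₁, π₂ are the first and second projections. -/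
open MvPolynomial

namespace HahnSeries

/-- The subring of Hahn series whose support lies in the submonoid `S`. -/
def supportedSubring {Γ : Type*} [AddCommMonoid Γ] [PartialOrder Γ] [IsOrderedCancelAddMonoid Γ]
    (K : Type*) [CommRing K] (S : AddSubmonoid Γ) : Subring (HahnSeries Γ K) where
  carrier := {f | f.support ⊆ S}
  mul_mem' {a b} ha hb := support_mul_subset.trans <| by
    rintro _ ⟨i, hi, j, hj, rfl⟩
    exact S.add_mem (ha hi) (hb hj)
  one_mem' := by
    intro i hi
    have : i = 0 := by
      by_contra h
      exact hi (by simp [coeff_one, h])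
    exact this ▸ S.zero_mem
  add_mem' {a b} ha hb := (support_add_subset a b).trans (Set.union_subset ha hb)
  zero_mem' := by simp
  neg_mem' {a} ha := by simpa using ha

section
variable {Γ K : Type*} [AddCommMonoid Γ] [PartialOrder Γ] [IsOrderedCancelAddMonoid Γ]
  [CommRing K] {S : AddSubmonoid Γ}

theorem mem_supportedSubring {f : HahnSeries Γ K} :
    f ∈ supportedSubring K S ↔ ∀ i, f.coeff i ≠ 0 → i ∈ S := Iff.rfl

theorem single_mem_supportedSubring {i : Γ} (hi : i ∈ S) (r : K) :
    single i r ∈ supportedSubring K S := by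
  intro j hj
  have := support_single_subset hj
  simp only [Set.mem_singleton_iff] at this
  exact this ▸ hi

end

theorem order_mem_of_mem_supportedSubring {Γ K : Type*} [AddCommMonoid Γ] [LinearOrder Γ]
    [IsOrderedCancelAddMonoid Γ] [CommRing K] {S : AddSubmonoid Γ} {f : HahnSeries Γ K}
    (hf : f ∈ supportedSubring K S) (h0 : f ≠ 0) : f.order ∈ S :=
  mem_supportedSubring.1 hf _ (coeff_order_eq_zero.not.2 h0)

/-- A finite sum of nonzero Hahn series with pairwise distinct orders is nonzero, and its order
is the least of the orders of the terms. -/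
theorem order_sum_of_injOn {Γ K ι : Type*} [LinearOrder Γ] [Zero Γ]
    [AddCommMonoid K] (s : Finset ι) (hs : s.Nonempty) (f : ι → HahnSeries Γ K)
    (hf : ∀ i ∈ s, f i ≠ 0) (hinj : Set.InjOn (fun i => (f i).order) s) :
    ∑ i ∈ s, f i ≠ 0 ∧ ∃ j ∈ s, (∑ i ∈ s, f i).order = (f j).order ∧
      ∀ i ∈ s, (f j).order ≤ (f i).order := by
  obtain ⟨j, hj, hmin⟩ := s.exists_min_image (fun i => (f i).order) hs
  have hc : (∑ i ∈ s, f i).coeff (f j).order = (f j).coeff (f j).order := by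
    rw [coeff_sum]
    refine Finset.sum_eq_single_of_mem j hj fun i hi hij => coeff_eq_zero_of_lt_order ?_
    exact (hmin i hi).lt_of_ne fun h => hij (hinj hi hj h.symm)
  have hc0 : (∑ i ∈ s, f i).coeff (f j).order ≠ 0 := by
    rw [hc]; exact coeff_order_eq_zero.not.2 (hf j hj)
  have hne : ∑ i ∈ s, f i ≠ 0 := fun h => hc0 (by simp [h])
  refine ⟨hne, j, hj, le_antisymm (order_le_of_coeff_ne_zero hc0) ?_, hmin⟩
  rw [le_order_iff_forall hne]
  intro γ hγ
  rw [coeff_sum]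
  exact Finset.sum_eq_zero fun i hi => coeff_eq_zero_of_lt_order (hγ.trans_le (hmin i hi))

/-- If the values `j • order r`, for `j ∈ p.support`, are pairwise incongruent modulo a subgroup
containing the supports of the coefficients of `p`, then the order of `p.eval r` is the least of
the orders of its monomials. -/
theorem order_eval_of_incongruent {Γ K : Type*} [AddCommGroup Γ] [LinearOrder Γ]
    [IsOrderedAddMonoid Γ] [Field K] (S : AddSubgroup Γ)
    (p : Polynomial (HahnSeries Γ K)) (hp : p ≠ 0)
    (hcoeff : ∀ j, p.coeff j ∈ supportedSubring K S.toAddSubmonoid)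
    (r : HahnSeries Γ K) (hr : r ≠ 0)
    (hS : ∀ j : ℕ, 0 < j → j ≤ p.natDegree → j • r.order ∉ S) :
    p.eval r ≠ 0 ∧ ∃ j ∈ p.support, (p.eval r).order = (p.coeff j).order + j • r.order ∧
      ∀ i ∈ p.support, (p.eval r).order ≤ (p.coeff i).order + i • r.order := by
  have hord : ∀ i ∈ p.support, (p.coeff i * r ^ i).order = (p.coeff i).order + i • r.order := by
    intro i hi
    rw [order_mul (Polynomial.mem_support_iff.1 hi) (pow_ne_zero _ hr), order_pow]
  have hmem : ∀ i ∈ p.support, (p.coeff i).order ∈ S := fun i hi =>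
    order_mem_of_mem_supportedSubring (hcoeff i) (Polynomial.mem_support_iff.1 hi)
  have key : ∀ i ∈ p.support, ∀ j ∈ p.support, i < j →
      (p.coeff i * r ^ i).order ≠ (p.coeff j * r ^ j).order := by
    intro i hi j hj hij h
    rw [hord i hi, hord j hj] at h
    refine hS (j - i) (by lia) ((Nat.sub_le _ _).trans (Polynomial.le_natDegree_of_mem_supp _ hj)) ?_
    have : (j - i) • r.order = (p.coeff i).order - (p.coeff j).order := by
      rw [sub_nsmul _ hij.le]
      rw [← sub_eq_add_neg, sub_eq_sub_iff_add_eq_add, add_comm, ← h]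
    rw [this]
    exact S.sub_mem (hmem i hi) (hmem j hj)
  obtain ⟨h0, j, hj, h1, h2⟩ := order_sum_of_injOn p.support
    (Polynomial.support_nonempty.2 hp) (fun i => p.coeff i * r ^ i)
    (fun i hi => mul_ne_zero (Polynomial.mem_support_iff.1 hi) (pow_ne_zero _ hr))
    (fun i hi j hj h => by
      by_contra hne
      rcases Nat.lt_or_gt_of_ne hne with h' | h'
      · exact key i hi j hj h' h
      · exact key j hj i hi h' h.symm)
  rw [Polynomial.eval_eq_sum, Polynomial.sum_def]
  refine ⟨h0, j, hj, h1.trans (hord j hj), fun i hi => ?_⟩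
  rw [h1, ← hord i hi]
  exact h2 i hi

theorem coeff_taylor_mem {L : Type*} [CommRing L] (S : Subring L) (p : Polynomial L)
    (hp : ∀ i, p.coeff i ∈ S) {x : L} (hx : x ∈ S) (j : ℕ) :
    (Polynomial.taylor x p).coeff j ∈ S := by
  rw [Polynomial.taylor_coeff, Polynomial.eval_eq_sum, Polynomial.sum_def]
  refine S.sum_mem fun i _ => S.mul_mem ?_ (S.pow_mem hx _)
  rw [Polynomial.hasseDeriv_coeff]
  exact S.mul_mem (natCast_mem _ _) (hp _)

end HahnSeries

/-- An element of the form `q(v)` with `v ^ N = u` is a root of a monic polynomial of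
degree `N`. -/
theorem exists_monic_natDegree_eq_of_pow_eq {A L : Type*} [CommRing A] [Nontrivial A] [CommRing L]
    (φ : A →+* L) (u : A) (v : L) (N : ℕ) (hN : N ≠ 0) (hv : v ^ N = φ u) (q : Polynomial A) :
    ∃ χ : Polynomial A, χ.Monic ∧ χ.natDegree = N ∧
      (χ.map φ).eval ((q.map φ).eval v) = 0 := by
  set m : Polynomial A := Polynomial.X ^ N - Polynomial.C u
  have hm : m.Monic := Polynomial.monic_X_pow_sub_C u hN
  have hdeg : m.natDegree = N := Polynomial.natDegree_X_pow_sub_C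
  have := hm.free_adjoinRoot
  have := hm.finite_adjoinRoot
  let _ := φ.toAlgebra
  set b : AdjoinRoot m := AdjoinRoot.mk m q
  let T := Algebra.lmul A (AdjoinRoot m) b
  refine ⟨T.charpoly, T.charpoly_monic, ?_, ?_⟩
  · rw [T.charpoly_natDegree, (AdjoinRoot.powerBasis' hm).finrank]
    exact hdeg
  · let F : AdjoinRoot m →ₐ[A] L := AdjoinRoot.liftAlgHom m (Algebra.ofId A L) v (by
      simp [m, hv, RingHom.algebraMap_toAlgebra])
    have hb : F b = (q.map φ).eval v := by
      rw [Polynomial.eval_map]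
      simp only [F, b, AdjoinRoot.coe_liftAlgHom]
      rfl
    have hroot : Polynomial.aeval b T.charpoly = 0 := by
      apply Algebra.lmul_injective (R := A)
      rw [← Polynomial.aeval_algHom_apply, map_zero]
      exact T.aeval_self_charpoly
    have := Polynomial.aeval_algHom_apply F b T.charpoly
    rw [hroot, map_zero, hb, Polynomial.aeval_def] at this
    rw [Polynomial.eval_map]
    exact this

/-- Two homomorphisms onto `ℤ[1/2] ×ₗ ℤ` with the same nonnegative elements differ by a scaling
of the first coordinate. -/
theorem exists_scaling_of_nonneg_iff {A : Type*} [AddCommGroup A] (N W : A →+ ℚ ×ₗ ℤ)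
    (hN : ∀ γ : ℚ ×ₗ ℤ, (∃ z, N z = γ) ↔ (ofLex γ).1 ∈ dyadicSet)
    (hW : ∀ γ : ℚ ×ₗ ℤ, (∃ z, W z = γ) ↔ (ofLex γ).1 ∈ dyadicSet)
    (h : ∀ z, 0 ≤ N z ↔ 0 ≤ W z) :
    ∃ c : ℚ, 0 < c ∧ ∀ z, (ofLex (W z)).1 = c * (ofLex (N z)).1 ∧
      (ofLex (W z)).2 = (ofLex (N z)).2 := by
  have h0 : ∀ z, N z = 0 → W z = 0 := fun z hz =>
    le_antisymm (by
      have := (h (-z)).1 (by simp [hz])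
      rwa [map_neg, neg_nonneg] at this) ((h z).1 hz.ge)
  have h0' : ∀ z, W z = 0 → N z = 0 := fun z hz =>
    le_antisymm (by
      have := (h (-z)).2 (by simp [hz])
      rwa [map_neg, neg_nonneg] at this) ((h z).2 hz.ge)
  have hpos : ∀ z, 0 < N z ↔ 0 < W z := fun z => by
    rw [lt_iff_le_and_ne, lt_iff_le_and_ne, h z]
    exact and_congr_right fun _ => not_congr ⟨fun e => (h0 z e.symm).symm, fun e => (h0' z e.symm).symm⟩
  have hint : ∀ n : ℤ, (n : ℚ) ∈ dyadicSet := fun n => ⟨n, 0, by simp⟩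
  have hone : ∀ γ : ℚ ×ₗ ℤ, 0 < γ → (toLex (0, 1) : ℚ ×ₗ ℤ) ≤ γ := by
    intro γ hγ
    rw [Prod.Lex.lt_iff] at hγ
    rw [Prod.Lex.le_iff]
    rcases hγ with hγ | ⟨h1, h2⟩
    · exact Or.inl hγ
    · exact Or.inr ⟨h1, Int.add_one_le_of_lt h2⟩
  have honepos : (0 : ℚ ×ₗ ℤ) < toLex (0, 1) := by
    rw [Prod.Lex.lt_iff]; exact Or.inr ⟨rfl, by simp⟩
  obtain ⟨t, ht⟩ := (hN (toLex (0, 1))).2 (by simpa using hint 0)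
  obtain ⟨s, hs⟩ := (hW (toLex (0, 1))).2 (by simpa using hint 0)
  have hWt : W t = toLex (0, 1) := by
    refine le_antisymm ?_ (hone _ ((hpos t).1 (ht ▸ honepos)))
    have h1 : N t ≤ N s := ht ▸ hone _ ((hpos s).2 (hs ▸ honepos))
    have h2 := (h (s - t)).1 (by rwa [map_sub, sub_nonneg])
    rwa [map_sub, sub_nonneg, hs] at h2
  obtain ⟨u, hu⟩ := (hN (toLex (1, 0))).2 (by simpa using hint 1)
  have hrel : ∀ z, ∀ (p : ℤ) (k : ℕ), (ofLex (N z)).1 = (p : ℚ) / 2 ^ k →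
      (2 : ℤ) ^ k • W z = p • W u + ((2 : ℤ) ^ k * (ofLex (N z)).2) • W t := by
    intro z p k hz
    rw [← map_zsmul, ← map_zsmul, ← map_zsmul, ← map_add, ← sub_eq_zero, ← map_sub]
    apply h0
    rw [map_sub, map_add, map_zsmul, map_zsmul, map_zsmul, hu, ht, sub_eq_zero]
    apply ofLex.injective
    ext
    · simp [hz]; field_simp
    · simp
  have hd : (ofLex (W u)).2 = 0 := by
    by_contra hd
    set d := (ofLex (W u)).2
    obtain ⟨z, hz⟩ := (hN (toLex (1 / 2 ^ d.natAbs, 0))).2 ⟨1, d.natAbs, by simp⟩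
    have h1 := hrel z 1 d.natAbs (by simp [hz])
    have h2 := congrArg (fun γ => (ofLex γ).2) h1
    simp only [hz] at h2
    simp at h2
    have h3 : (2 : ℤ) ^ d.natAbs ∣ d := ⟨_, h2.symm⟩
    have h4 := Int.natAbs_le_of_dvd_ne_zero h3 hd
    simp [Int.natAbs_pow] at h4
    exact absurd h4 (not_le.2 (Nat.lt_two_pow_self))
  have hc : 0 < (ofLex (W u)).1 := by
    have h1 : 0 < N u := by rw [hu, Prod.Lex.lt_iff]; exact Or.inl (by simp)
    have h2 := (hpos u).1 h1
    rw [Prod.Lex.lt_iff] at h2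
    rcases h2 with h2 | ⟨_, h2⟩
    · exact h2
    · rw [hd] at h2
      exact absurd h2 (lt_irrefl _)
  refine ⟨_, hc, fun z => ?_⟩
  obtain ⟨p, k, hpk⟩ := (hN (N z)).1 ⟨z, rfl⟩
  have h1 := hrel z p k hpk
  rw [hWt] at h1
  have h2 := congrArg (fun γ => (ofLex γ).1) h1
  have h3 := congrArg (fun γ => (ofLex γ).2) h1
  simp at h2 h3
  refine ⟨?_, ?_⟩
  · rw [hpk]; field_simp; linarith
  · simpa [hd] using h3

/-- A valuation-like function on the nonzero elements of a field, as a homomorphism. -/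
def unitsValueHom {F Γ : Type*} [Field F] [AddCommGroup Γ] (ν : F → Γ)
    (h : ∀ x y : F, x ≠ 0 → y ≠ 0 → ν (x * y) = ν x + ν y) : Additive Fˣ →+ Γ :=
  AddMonoidHom.mk' (fun z => ν (z.toMul : F)) fun x y => h _ _ x.toMul.ne_zero y.toMul.ne_zero

theorem exists_scaling_of_equivalent {F : Type*} [Field F] (ν ω : F → ℚ ×ₗ ℤ)
    (hν : ∀ x y : F, x ≠ 0 → y ≠ 0 → ν (x * y) = ν x + ν y)
    (hω : ∀ x y : F, x ≠ 0 → y ≠ 0 → ω (x * y) = ω x + ω y)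
    (hνG : {γ : ℚ ×ₗ ℤ | ∃ x : F, x ≠ 0 ∧ ν x = γ} = {γ : ℚ ×ₗ ℤ | (ofLex γ).1 ∈ dyadicSet})
    (hωG : {γ : ℚ ×ₗ ℤ | ∃ x : F, x ≠ 0 ∧ ω x = γ} = {γ : ℚ ×ₗ ℤ | (ofLex γ).1 ∈ dyadicSet})
    (h : {x : F | x = 0 ∨ 0 ≤ ν x} = {x : F | x = 0 ∨ 0 ≤ ω x}) :
    ∃ c : ℚ, 0 < c ∧ ∀ x : F, x ≠ 0 → (ofLex (ω x)).1 = c * (ofLex (ν x)).1 ∧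
      (ofLex (ω x)).2 = (ofLex (ν x)).2 := by
  have hsurj : ∀ (μ : F → ℚ ×ₗ ℤ) (hμ : ∀ x y : F, x ≠ 0 → y ≠ 0 → μ (x * y) = μ x + μ y),
      {γ : ℚ ×ₗ ℤ | ∃ x : F, x ≠ 0 ∧ μ x = γ} = {γ : ℚ ×ₗ ℤ | (ofLex γ).1 ∈ dyadicSet} →
      ∀ γ : ℚ ×ₗ ℤ, (∃ z, unitsValueHom μ hμ z = γ) ↔ (ofLex γ).1 ∈ dyadicSet := by
    intro μ hμ hG γ
    refine Iff.trans ?_ (Set.ext_iff.1 hG γ)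
    constructor
    · rintro ⟨z, hz⟩
      exact ⟨_, z.toMul.ne_zero, hz⟩
    · rintro ⟨x, hx, hxγ⟩
      exact ⟨Additive.ofMul (Units.mk0 x hx), hxγ⟩
  obtain ⟨c, hc, H⟩ := exists_scaling_of_nonneg_iff (unitsValueHom ν hν) (unitsValueHom ω hω)
    (hsurj ν hν hνG) (hsurj ω hω hωG) (fun z => by
      have := Set.ext_iff.1 h (z.toMul : F)
      simp only [Set.mem_ofPred_eq, Units.ne_zero, false_or] at this
      exact this)
  exact ⟨c, hc, fun x hx => H (Additive.ofMul (Units.mk0 x hx))⟩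

/-- The denominators of the exponents are `2 ^ dyadicLevel (k + 1)`. -/
def dyadicLevel : ℕ → ℕ
  | 0 => 0
  | k + 1 => 2 * dyadicLevel k + 1

theorem dyadicLevel_strictMono : StrictMono dyadicLevel :=
  strictMono_nat_of_lt_succ fun k => by rw [dyadicLevel]; lia

/-- The exponents of the first variable in the defining series. -/
def dyadicExponent (k : ℕ) : ℚ := 1 - 1 / 2 ^ dyadicLevel (k + 1)

theorem dyadicExponent_nonneg (k : ℕ) : 0 ≤ dyadicExponent k := by
  rw [dyadicExponent, sub_nonneg]
  exact div_le_one_of_le₀ (one_le_pow₀ one_le_two) (by positivity)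

theorem dyadicExponent_lt_one (k : ℕ) : dyadicExponent k < 1 :=
  sub_lt_self _ (by positivity)

theorem dyadicExponent_strictMono : StrictMono dyadicExponent := fun i j hij => by
  have : dyadicLevel (i + 1) < dyadicLevel (j + 1) := dyadicLevel_strictMono (by lia)
  unfold dyadicExponent
  gcongr
  exact one_lt_two

theorem nsmul_toLex (n : ℕ) (q : ℚ) (b : ℤ) :
    n • (toLex (q, b) : ℚ ×ₗ ℤ) = toLex (n * q, n * b) := by
  rw [← nsmul_eq_mul n q, ← nsmul_eq_mul n b]
  rfl

/-- The elements of `ℚ ×ₗ ℤ` whose first coordinate lies in `2⁻ᵐ ℤ`. -/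
def levelSubgroup (m : ℕ) : AddSubgroup (ℚ ×ₗ ℤ) where
  carrier := {γ | ∃ z : ℤ, 2 ^ m * (ofLex γ).1 = z}
  add_mem' := by
    rintro a b ⟨x, hx⟩ ⟨y, hy⟩
    exact ⟨x + y, by push_cast; rw [← hx, ← hy, ofLex_add, Prod.fst_add, mul_add]⟩
  zero_mem' := ⟨0, by simp⟩
  neg_mem' := by
    rintro a ⟨x, hx⟩
    exact ⟨-x, by push_cast; rw [← hx, ofLex_neg, Prod.fst_neg, mul_neg]⟩

theorem mem_levelSubgroup {m : ℕ} {γ : ℚ ×ₗ ℤ} :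
    γ ∈ levelSubgroup m ↔ ∃ z : ℤ, 2 ^ m * (ofLex γ).1 = z := Iff.rfl

theorem toLex_intCast_mem_levelSubgroup (m : ℕ) (n b : ℤ) :
    (toLex ((n : ℚ), b) : ℚ ×ₗ ℤ) ∈ levelSubgroup m := ⟨2 ^ m * n, by simp⟩

theorem toLex_dyadicExponent_mem_levelSubgroup {i k : ℕ} (h : i < k) (b : ℤ) :
    (toLex (dyadicExponent i, b) : ℚ ×ₗ ℤ) ∈ levelSubgroup (dyadicLevel k) := by
  have hle : dyadicLevel (i + 1) ≤ dyadicLevel k := dyadicLevel_strictMono.monotone h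
  refine ⟨2 ^ dyadicLevel k - 2 ^ (dyadicLevel k - dyadicLevel (i + 1)), ?_⟩
  push_cast
  rw [pow_sub₀ _ two_ne_zero hle]
  simp [dyadicExponent]
  ring

theorem nsmul_notMem_levelSubgroup (k j : ℕ) (b : ℤ) (hj : 0 < j) (hjk : j ≤ 2 ^ dyadicLevel k) :
    j • (toLex (dyadicExponent k, b) : ℚ ×ₗ ℤ) ∉ levelSubgroup (dyadicLevel k) := by
  rintro ⟨z, hz⟩
  have h1 : ((2 ^ dyadicLevel k * j - z : ℤ) : ℚ) * 2 ^ (dyadicLevel k + 1) = j := by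
    push_cast
    rw [← hz, nsmul_toLex]
    simp only [ofLex_toLex, dyadicExponent, dyadicLevel]
    rw [show 2 * dyadicLevel k + 1 = dyadicLevel k + (dyadicLevel k + 1) by ring, pow_add]
    field_simp
    ring
  have h2 : (2 ^ dyadicLevel k * j - z : ℤ) * 2 ^ (dyadicLevel k + 1) = j := by exact_mod_cast h1
  have h3 : (2 : ℤ) ^ (dyadicLevel k + 1) ∣ j := ⟨_, h2.symm.trans (mul_comm _ _)⟩
  have h4 : 2 ^ (dyadicLevel k + 1) ∣ j := by exact_mod_cast h3
  have h5 := Nat.le_of_dvd hj h4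
  rw [pow_succ] at h5
  lia

namespace WildSeries

variable (K : Type*) [Field K] (a : ℕ → ℕ)

/-- The exponent of the `i`-th term of the defining series. -/
def exponent (i : ℕ) : ℚ ×ₗ ℤ := toLex (dyadicExponent i, (a i : ℤ))

theorem exponent_strictMono : StrictMono (exponent a) := fun _ _ hij =>
  Prod.Lex.lt_iff.2 (Or.inl (dyadicExponent_strictMono hij))

open Classical in
/-- The series `∑ i ≥ k, u ^ dyadicExponent i * t ^ a i`. -/
noncomputable def tail (k : ℕ) : HahnSeries (ℚ ×ₗ ℤ) K where
  coeff γ := if ∃ i, k ≤ i ∧ γ = exponent a i then 1 else 0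
  isPWO_support' := by
    have h : (Set.range (exponent a)).IsPWO := by
      rw [← Set.image_univ]
      exact (Set.isPWO_of_wellQuasiOrderedLE _).image_of_monotone (exponent_strictMono a).monotone
    refine h.mono fun γ hγ => ?_
    by_contra hcon
    refine hγ (if_neg ?_)
    rintro ⟨i, -, rfl⟩
    exact hcon ⟨i, rfl⟩

open Classical in
theorem coeff_tail (k : ℕ) (γ : ℚ ×ₗ ℤ) :
    (tail K a k).coeff γ = if ∃ i, k ≤ i ∧ γ = exponent a i then 1 else 0 := rfl

theorem coeff_tail_ne_zero {k : ℕ} {γ : ℚ ×ₗ ℤ} (h : (tail K a k).coeff γ ≠ 0) :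
    ∃ i, k ≤ i ∧ γ = exponent a i := by
  by_contra hcon
  exact h (by rw [coeff_tail, if_neg hcon])

theorem tail_eq (k : ℕ) :
    tail K a k = HahnSeries.single (exponent a k) 1 + tail K a (k + 1) := by
  ext γ
  rw [HahnSeries.coeff_add, coeff_tail, coeff_tail]
  by_cases h : γ = exponent a k
  · subst h
    rw [if_pos ⟨k, le_rfl, rfl⟩, HahnSeries.coeff_single_same, if_neg, add_zero]
    rintro ⟨i, hi, hki⟩
    have := (exponent_strictMono a).injective hki
    lia
  · rw [HahnSeries.coeff_single_of_ne h, zero_add]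
    congr 1
    refine propext ⟨?_, fun ⟨i, hi, e⟩ => ⟨i, by lia, e⟩⟩
    rintro ⟨i, hi, rfl⟩
    exact ⟨i, lt_of_le_of_ne hi fun e => h (e ▸ rfl), rfl⟩

theorem coeff_tail_self (k : ℕ) : (tail K a k).coeff (exponent a k) = 1 := by
  rw [coeff_tail, if_pos ⟨k, le_rfl, rfl⟩]

theorem tail_ne_zero (k : ℕ) : tail K a k ≠ 0 := fun h => by
  simpa [h] using coeff_tail_self K a k

theorem order_tail (k : ℕ) : (tail K a k).order = exponent a k := by
  refine le_antisymm (HahnSeries.order_le_of_coeff_ne_zero ?_) ?_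
  · rw [coeff_tail_self]; exact one_ne_zero
  · rw [HahnSeries.le_order_iff_forall (tail_ne_zero K a k)]
    intro γ hγ
    by_contra hne
    obtain ⟨i, hi, rfl⟩ := coeff_tail_ne_zero K a hne
    exact absurd hγ (not_lt.2 ((exponent_strictMono a).monotone hi))

/-- The finite part `∑ i < k, u ^ dyadicExponent i * t ^ a i`. -/
noncomputable def truncation (k : ℕ) : HahnSeries (ℚ ×ₗ ℤ) K :=
  ∑ i ∈ Finset.range k, HahnSeries.single (exponent a i) 1

theorem tail_zero_eq (k : ℕ) : tail K a 0 = tail K a k + truncation K a k := by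
  induction k with
  | zero => simp [truncation]
  | succ k ih =>
    rw [ih, tail_eq, truncation, truncation, Finset.sum_range_succ]
    ring

theorem truncation_mem (k : ℕ) : truncation K a k ∈
    HahnSeries.supportedSubring K (levelSubgroup (dyadicLevel k)).toAddSubmonoid :=
  Subring.sum_mem _ fun _ hi => HahnSeries.single_mem_supportedSubring
    (toLex_dyadicExponent_mem_levelSubgroup (Finset.mem_range.1 hi) _) _

/-- The embedding of the coefficient ring `K[u, t]`. -/
noncomputable def baseHom : MvPolynomial (Fin 2) K →ₐ[K] HahnSeries (ℚ ×ₗ ℤ) K :=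
  aeval ![HahnSeries.single (toLex (1, 0)) 1, HahnSeries.single (toLex (0, 1)) 1]

/-- The embedding of `K[y, u, t]` sending `y` to the defining series. -/
noncomputable def seriesHom : MvPolynomial (Fin 3) K →ₐ[K] HahnSeries (ℚ ×ₗ ℤ) K :=
  aeval ![tail K a 0, HahnSeries.single (toLex (1, 0)) 1, HahnSeries.single (toLex (0, 1)) 1]

theorem seriesHom_eq (f : MvPolynomial (Fin 3) K) :
    seriesHom K a f =
      ((finSuccEquiv K 2 f).map (baseHom K).toRingHom).eval (tail K a 0) := by
  induction f using MvPolynomial.induction_on with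
  | C c => simp [finSuccEquiv_apply]
  | add p q hp hq => simp [hp, hq]
  | mul_X p i hp =>
    rw [map_mul, hp, map_mul, Polynomial.map_mul, Polynomial.eval_mul]
    congr 1
    induction i using Fin.cases with
    | zero => simp [finSuccEquiv_X_zero, seriesHom]
    | succ i =>
      rw [finSuccEquiv_X_succ, Polynomial.map_C, Polynomial.eval_C]
      fin_cases i <;> simp [seriesHom, baseHom]

theorem aeval_mem_supportedSubring {σ : Type*} {S : AddSubmonoid (ℚ ×ₗ ℤ)}
    (v : σ → HahnSeries (ℚ ×ₗ ℤ) K) (hv : ∀ i, v i ∈ HahnSeries.supportedSubring K S)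
    (f : MvPolynomial σ K) : aeval v f ∈ HahnSeries.supportedSubring K S := by
  induction f using MvPolynomial.induction_on with
  | C c =>
    rw [aeval_C, HahnSeries.algebraMap_apply]
    exact HahnSeries.single_mem_supportedSubring S.zero_mem _
  | add p q hp hq => rw [map_add]; exact add_mem hp hq
  | mul_X p i hp => rw [map_mul, aeval_X]; exact mul_mem hp (hv i)

theorem baseHom_mem (m : ℕ) (f : MvPolynomial (Fin 2) K) :
    baseHom K f ∈ HahnSeries.supportedSubring K (levelSubgroup m).toAddSubmonoid := by
  refine aeval_mem_supportedSubring K _ (fun i => ?_) f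
  fin_cases i
  · exact HahnSeries.single_mem_supportedSubring
      (by simpa using toLex_intCast_mem_levelSubgroup m 1 0) _
  · exact HahnSeries.single_mem_supportedSubring
      (by simpa using toLex_intCast_mem_levelSubgroup m 0 1) _

theorem baseHom_monomial (n : Fin 2 →₀ ℕ) (c : K) :
    baseHom K (monomial n c) = HahnSeries.single (toLex ((n 0 : ℚ), (n 1 : ℤ))) c := by
  rw [baseHom, aeval_monomial, HahnSeries.algebraMap_apply, Finsupp.prod_fintype _ _ (by simp)]
  simp only [Fin.prod_univ_two, Matrix.cons_val_zero, Matrix.cons_val_one, HahnSeries.single_pow,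
    one_pow, HahnSeries.single_mul_single, HahnSeries.C_apply, Algebra.algebraMap_self_apply,
    nsmul_toLex, ← toLex_add]
  simp

theorem baseHom_injective : Function.Injective (baseHom K) := by
  rw [injective_iff_map_eq_zero]
  intro f hf
  ext n
  have h : (baseHom K f).coeff (toLex ((n 0 : ℚ), (n 1 : ℤ))) = coeff n f := by
    conv_lhs => rw [f.as_sum, map_sum, HahnSeries.coeff_sum]
    simp only [baseHom_monomial]
    rw [Finset.sum_eq_single n]
    · simp
    · intro m _ hmn
      refine HahnSeries.coeff_single_of_ne fun h => hmn ?_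
      have h' := toLex.injective h
      simp only [Prod.mk.injEq, Nat.cast_inj] at h'
      ext i
      fin_cases i
      · exact h'.1.symm
      · exact h'.2.symm
    · intro hn
      simp [notMem_support_iff.1 hn]
  rw [← h, hf]
  simp

/-- The order of a polynomial expression in the defining series is governed by the Taylor
expansion at a truncation, provided the degree is small. -/
theorem order_eval_tail_zero (k : ℕ) (P : Polynomial (MvPolynomial (Fin 2) K)) (hP : P ≠ 0)
    (hdeg : P.natDegree ≤ 2 ^ dyadicLevel k) :
    let p := Polynomial.taylor (truncation K a k) (P.map (baseHom K).toRingHom)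
    (P.map (baseHom K).toRingHom).eval (tail K a 0) ≠ 0 ∧
      ∃ j ∈ p.support, ((P.map (baseHom K).toRingHom).eval (tail K a 0)).order =
        (p.coeff j).order + j • exponent a k ∧
      ∀ i ∈ p.support, ((P.map (baseHom K).toRingHom).eval (tail K a 0)).order ≤
        (p.coeff i).order + i • exponent a k := by
  intro p
  have hinj : Function.Injective (baseHom K).toRingHom := baseHom_injective K
  have hp : p ≠ 0 := by
    rw [Ne, Polynomial.taylor_eq_zero, Polynomial.map_eq_zero_iff hinj]
    exact hP
  have hpdeg : p.natDegree = P.natDegree := by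
    rw [Polynomial.natDegree_taylor, Polynomial.natDegree_map_eq_of_injective hinj]
  have heval : (P.map (baseHom K).toRingHom).eval (tail K a 0) = p.eval (tail K a k) := by
    rw [Polynomial.taylor_eval, tail_zero_eq K a k]
  rw [heval, ← order_tail K a k]
  refine HahnSeries.order_eval_of_incongruent (levelSubgroup (dyadicLevel k)) p hp
    (HahnSeries.coeff_taylor_mem _ _ (fun i => ?_) (truncation_mem K a k)) _ (tail_ne_zero K a k)
    fun j hj hj' => ?_
  · rw [Polynomial.coeff_map]
    exact baseHom_mem K _ _
  · rw [order_tail]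
    exact nsmul_notMem_levelSubgroup k j _ hj (hj'.trans (hpdeg.trans_le hdeg))

theorem seriesHom_injective : Function.Injective (seriesHom K a) := by
  rw [injective_iff_map_eq_zero]
  intro f hf
  by_contra hne
  have hP : finSuccEquiv K 2 f ≠ 0 := by simpa using hne
  refine (order_eval_tail_zero K a (finSuccEquiv K 2 f).natDegree _ hP ?_).1 ?_
  · exact Nat.lt_two_pow_self.le.trans
      (Nat.pow_le_pow_right two_pos (dyadicLevel_strictMono.le_apply))
  · rw [← seriesHom_eq, hf]

theorem exists_monic_eval_truncation (k : ℕ) :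
    ∃ χ : Polynomial (MvPolynomial (Fin 2) K), χ.Monic ∧ χ.natDegree = 2 ^ dyadicLevel k ∧
      (χ.map (baseHom K).toRingHom).eval (truncation K a k) = 0 := by
  set N := 2 ^ dyadicLevel k with hN
  let v : HahnSeries (ℚ ×ₗ ℤ) K := HahnSeries.single (toLex (1 / (N : ℚ), 0)) 1
  let n : ℕ → ℕ := fun i => 2 ^ dyadicLevel k - 2 ^ (dyadicLevel k - dyadicLevel (i + 1))
  let q : Polynomial (MvPolynomial (Fin 2) K) :=
    ∑ i ∈ Finset.range k, Polynomial.monomial (n i) (X 1 ^ a i)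
  have hq : (q.map (baseHom K).toRingHom).eval v = truncation K a k := by
    simp only [q, Polynomial.map_sum, Polynomial.eval_finsetSum, truncation]
    refine Finset.sum_congr rfl fun i hi => ?_
    rw [Polynomial.map_monomial, Polynomial.eval_monomial]
    have hle : dyadicLevel (i + 1) ≤ dyadicLevel k :=
      dyadicLevel_strictMono.monotone (Finset.mem_range.1 hi)
    have hn : (n i : ℚ) * (1 / N) = dyadicExponent i := by
      simp only [n]
      rw [Nat.cast_sub (Nat.pow_le_pow_right two_pos (Nat.sub_le _ _)), hN]
      push_cast
      rw [pow_sub₀ _ two_ne_zero hle, dyadicExponent]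
      field_simp
    have hX : (baseHom K).toRingHom (X 1 ^ a i) =
        HahnSeries.single (toLex ((0 : ℚ), (a i : ℤ))) 1 := by
      simp [baseHom, HahnSeries.single_pow, nsmul_toLex, -nsmul_eq_mul]
    rw [hX, HahnSeries.single_pow, HahnSeries.single_mul_single, nsmul_toLex, ← toLex_add]
    simp only [one_pow, mul_one, Prod.mk_add_mk, hn]
    simp [exponent]
  obtain ⟨χ, h1, h2, h3⟩ := exists_monic_natDegree_eq_of_pow_eq (baseHom K).toRingHom (X 0) v N
    (by positivity) (by
      have : (N : ℚ) ≠ 0 := by positivity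
      simp [v, baseHom, HahnSeries.single_pow, nsmul_toLex, -nsmul_eq_mul, this]) q
  exact ⟨χ, h1, h2, hq ▸ h3⟩

/-- There are polynomials whose order has bounded first coordinate with large denominator. The
bound does not depend on the exponents `a`. -/
theorem exists_order_notMem_levelSubgroup (k : ℕ) : ∃ h : MvPolynomial (Fin 3) K, h ≠ 0 ∧
    (ofLex (seriesHom K a h).order).1 < 2 ^ dyadicLevel k ∧
    (seriesHom K a h).order ∉ levelSubgroup (dyadicLevel k) := by
  obtain ⟨χ, hmonic, hdeg, hroot⟩ := exists_monic_eval_truncation K a k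
  have hinj : Function.Injective (baseHom K).toRingHom := baseHom_injective K
  obtain ⟨h0, j, hj, hjord, hmin⟩ := order_eval_tail_zero K a k χ hmonic.ne_zero hdeg.le
  set p := Polynomial.taylor (truncation K a k) (χ.map (baseHom K).toRingHom) with hp
  have hpdeg : p.natDegree = 2 ^ dyadicLevel k := by
    rw [Polynomial.natDegree_taylor, Polynomial.natDegree_map_eq_of_injective hinj, hdeg]
  have hlead : p.coeff (2 ^ dyadicLevel k) = 1 := by
    rw [← hpdeg, Polynomial.coeff_natDegree, Polynomial.leadingCoeff_taylor]
    exact hmonic.map _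
  have hcoeff : ∀ i, p.coeff i ∈
      HahnSeries.supportedSubring K (levelSubgroup (dyadicLevel k)).toAddSubmonoid :=
    HahnSeries.coeff_taylor_mem _ _ (fun i => by
      rw [Polynomial.coeff_map]; exact baseHom_mem K _ _) (truncation_mem K a k)
  have hser : seriesHom K a ((finSuccEquiv K 2).symm χ) =
      (χ.map (baseHom K).toRingHom).eval (tail K a 0) := by
    rw [seriesHom_eq, AlgEquiv.apply_symm_apply]
  refine ⟨(finSuccEquiv K 2).symm χ, by simpa using hmonic.ne_zero, ?_, ?_⟩
  · rw [hser]
    have hle := hmin (2 ^ dyadicLevel k)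
      (Polynomial.mem_support_iff.2 (by rw [hlead]; exact one_ne_zero))
    rw [hlead, HahnSeries.order_one, zero_add] at hle
    refine (Prod.Lex.monotone_fst _ _ hle).trans_lt ?_
    rw [exponent, nsmul_toLex, ofLex_toLex]
    push_cast
    exact mul_lt_of_lt_one_right (by positivity) (dyadicExponent_lt_one k)
  · rw [hser, hjord]
    intro hmem
    have hj0 : 0 < j := by
      rw [Nat.pos_iff_ne_zero]
      rintro rfl
      rw [Polynomial.mem_support_iff, hp, Polynomial.taylor_coeff_zero] at hj
      exact hj hroot
    refine nsmul_notMem_levelSubgroup k j (a k) hj0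
      (hpdeg ▸ Polynomial.le_natDegree_of_mem_supp _ hj) ?_
    refine (AddSubgroup.add_mem_cancel_left _ ?_).1 hmem
    exact HahnSeries.order_mem_of_mem_supportedSubring (hcoeff j) (Polynomial.mem_support_iff.1 hj)

theorem add_mem_dyadicSet {p q : ℚ} (hp : p ∈ dyadicSet) (hq : q ∈ dyadicSet) :
    p + q ∈ dyadicSet := by
  obtain ⟨b, k, rfl⟩ := hp
  obtain ⟨c, l, rfl⟩ := hq
  exact ⟨b * 2 ^ l + c * 2 ^ k, k + l, by push_cast; rw [pow_add]; field_simp⟩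

theorem intCast_mem_dyadicSet (n : ℤ) : (n : ℚ) ∈ dyadicSet := ⟨n, 0, by simp⟩

/-- A submonoid containing the supports of the series attached to polynomials. -/
def boundSubmonoid : AddSubmonoid (ℚ ×ₗ ℤ) where
  carrier := {γ | (ofLex γ).1 ∈ dyadicSet ∧ 0 ≤ (ofLex γ).1 ∧ 0 ≤ (ofLex γ).2 ∧
    ∀ k, γ ∉ levelSubgroup (dyadicLevel k) → (a k : ℤ) ≤ (ofLex γ).2}
  zero_mem' := ⟨by simpa using intCast_mem_dyadicSet 0, le_rfl, le_rfl,
    fun k hk => absurd (AddSubgroup.zero_mem _) hk⟩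
  add_mem' := by
    rintro γ δ ⟨h1, h2, h3, h4⟩ ⟨h1', h2', h3', h4'⟩
    refine ⟨add_mem_dyadicSet h1 h1', add_nonneg h2 h2', add_nonneg h3 h3', fun k hk => ?_⟩
    rw [ofLex_add, Prod.snd_add]
    by_cases hγ : γ ∈ levelSubgroup (dyadicLevel k)
    · have := h4' k fun hδ => hk (AddSubgroup.add_mem _ hγ hδ)
      lia
    · have := h4 k hγ
      lia

theorem mem_boundSubmonoid {γ : ℚ ×ₗ ℤ} : γ ∈ boundSubmonoid a ↔
    (ofLex γ).1 ∈ dyadicSet ∧ 0 ≤ (ofLex γ).1 ∧ 0 ≤ (ofLex γ).2 ∧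
    ∀ k, γ ∉ levelSubgroup (dyadicLevel k) → (a k : ℤ) ≤ (ofLex γ).2 := Iff.rfl

theorem nonneg_of_mem_boundSubmonoid {γ : ℚ ×ₗ ℤ} (h : γ ∈ boundSubmonoid a) : 0 ≤ γ := by
  obtain ⟨-, h1, h2, -⟩ := h
  rw [Prod.Lex.le_iff]
  exact h1.lt_or_eq.imp id fun e => ⟨e, h2⟩

variable {a} in
theorem exponent_mem_boundSubmonoid (ha : Monotone a) (i : ℕ) :
    exponent a i ∈ boundSubmonoid a := by
  refine ⟨⟨2 ^ dyadicLevel (i + 1) - 1, dyadicLevel (i + 1), ?_⟩, dyadicExponent_nonneg i,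
    Int.natCast_nonneg _, fun k hk => ?_⟩
  · simp only [exponent, ofLex_toLex, dyadicExponent]
    push_cast
    field_simp
  · have : k ≤ i := by
      by_contra h
      exact hk (toLex_dyadicExponent_mem_levelSubgroup (not_le.1 h) _)
    exact Int.ofNat_le.2 (ha this)

variable {a} in
theorem seriesHom_mem (ha : Monotone a) (f : MvPolynomial (Fin 3) K) :
    seriesHom K a f ∈ HahnSeries.supportedSubring K (boundSubmonoid a) := by
  have hint : ∀ p b : ℕ, (toLex ((p : ℚ), (b : ℤ)) : ℚ ×ₗ ℤ) ∈ boundSubmonoid a := fun p b =>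
    ⟨intCast_mem_dyadicSet p, Nat.cast_nonneg _, Int.natCast_nonneg _,
      fun k hk => absurd (toLex_intCast_mem_levelSubgroup _ p b) hk⟩
  refine aeval_mem_supportedSubring K _ (fun i => ?_) f
  fin_cases i
  · intro γ hγ
    obtain ⟨i, -, rfl⟩ := coeff_tail_ne_zero K a hγ
    exact exponent_mem_boundSubmonoid ha i
  · exact HahnSeries.single_mem_supportedSubring (by simpa using hint 1 0) _
  · exact HahnSeries.single_mem_supportedSubring (by simpa using hint 0 1) _

variable {a} in
theorem order_seriesHom_mem (ha : Monotone a) {f : MvPolynomial (Fin 3) K} (hf : f ≠ 0) :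
    (seriesHom K a f).order ∈ boundSubmonoid a :=
  HahnSeries.order_mem_of_mem_supportedSubring (seriesHom_mem K ha f)
    ((map_ne_zero_iff _ (seriesHom_injective K a)).2 hf)

theorem order_seriesHom_X_pos (i : Fin 3) : 0 < (seriesHom K a (X i)).order := by
  rw [seriesHom, aeval_X]
  fin_cases i
  · change 0 < (tail K a 0).order
    rw [order_tail, Prod.Lex.lt_iff]
    exact Or.inl (by
      simp only [exponent, dyadicExponent, dyadicLevel, ofLex_zero, ofLex_toLex, Prod.fst_zero]
      norm_num)
  · change 0 < (HahnSeries.single (toLex ((1 : ℚ), (0 : ℤ)) : ℚ ×ₗ ℤ) (1 : K)).order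
    rw [HahnSeries.order_single one_ne_zero, Prod.Lex.lt_iff]
    exact Or.inl one_pos
  · change 0 < (HahnSeries.single (toLex ((0 : ℚ), (1 : ℤ)) : ℚ ×ₗ ℤ) (1 : K)).order
    rw [HahnSeries.order_single one_ne_zero, Prod.Lex.lt_iff]
    exact Or.inr ⟨rfl, one_pos⟩

variable {a} in
theorem coeff_zero_seriesHom (ha : Monotone a) (f : MvPolynomial (Fin 3) K) :
    (seriesHom K a f).coeff 0 = constantCoeff f := by
  induction f using MvPolynomial.induction_on with
  | C c =>
    rw [seriesHom, aeval_C, HahnSeries.algebraMap_apply, constantCoeff_C]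
    simp
  | add p q hp hq => rw [map_add, HahnSeries.coeff_add, hp, hq, map_add]
  | mul_X p i hp =>
    rw [map_mul, map_mul constantCoeff, constantCoeff_X, mul_zero]
    by_cases h : p = 0
    · simp [h]
    · refine HahnSeries.coeff_eq_zero_of_lt_order ?_
      have hX : seriesHom K a (X i) ≠ 0 := (map_ne_zero_iff _ (seriesHom_injective K a)).2 (X_ne_zero i)
      rw [HahnSeries.order_mul ((map_ne_zero_iff _ (seriesHom_injective K a)).2 h) hX]
      exact add_pos_of_nonneg_of_pos (nonneg_of_mem_boundSubmonoid a (order_seriesHom_mem K ha h))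
        (order_seriesHom_X_pos K a i)

theorem mem_mxyz_iff (f : MvPolynomial (Fin 3) K) : f ∈ mxyz K ↔ constantCoeff f = 0 := by
  constructor
  · intro hf
    have h : mxyz K ≤ RingHom.ker (constantCoeff (R := K) (σ := Fin 3)) := by
      rw [mxyz, Ideal.span_le]
      rintro _ (rfl | rfl | rfl) <;> simp [RingHom.mem_ker]
    exact h hf
  · intro hf
    have h : f - C (constantCoeff f) ∈ mxyz K := by
      clear hf
      induction f using MvPolynomial.induction_on with
      | C c => simp
      | add p q hp hq =>
        rw [map_add, map_add, add_sub_add_comm]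
        exact add_mem hp hq
      | mul_X p i _ =>
        rw [map_mul, constantCoeff_X, mul_zero, map_zero, sub_zero]
        refine Ideal.mul_mem_left _ _ (Ideal.subset_span ?_)
        fin_cases i <;> simp
    rwa [hf, map_zero, sub_zero] at h

variable {a} in
theorem order_seriesHom_eq_zero_iff (ha : Monotone a) {f : MvPolynomial (Fin 3) K} (hf : f ≠ 0) :
    (seriesHom K a f).order = 0 ↔ f ∉ mxyz K := by
  rw [mem_mxyz_iff, ← coeff_zero_seriesHom K ha]
  constructor
  · intro h
    rw [← h]
    exact HahnSeries.coeff_order_eq_zero.not.2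
      ((map_ne_zero_iff _ (seriesHom_injective K a)).2 hf)
  · intro h
    exact le_antisymm (HahnSeries.order_le_of_coeff_ne_zero h)
      (nonneg_of_mem_boundSubmonoid a (order_seriesHom_mem K ha hf))

/-- The embedding of the field `K(y, u, t)` in the field of Hahn series. -/
noncomputable def fieldHom :
    FractionRing (MvPolynomial (Fin 3) K) →+* HahnSeries (ℚ ×ₗ ℤ) K :=
  IsFractionRing.lift (A := MvPolynomial (Fin 3) K) (g := (seriesHom K a).toRingHom)
    (seriesHom_injective K a)

theorem fieldHom_algebraMap (f : MvPolynomial (Fin 3) K) :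
    fieldHom K a (algebraMap _ _ f) = seriesHom K a f :=
  IsFractionRing.lift_algebraMap _ f

theorem fieldHom_ne_zero {x : FractionRing (MvPolynomial (Fin 3) K)} (hx : x ≠ 0) :
    fieldHom K a x ≠ 0 := (map_ne_zero _).2 hx

/-- The valuation of `K(y, u, t)` given by the order of the associated Hahn series. -/
noncomputable def value (x : FractionRing (MvPolynomial (Fin 3) K)) : ℚ ×ₗ ℤ :=
  (fieldHom K a x).order

theorem value_mul {x y : FractionRing (MvPolynomial (Fin 3) K)} (hx : x ≠ 0) (hy : y ≠ 0) :
    value K a (x * y) = value K a x + value K a y := by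
  rw [value, map_mul, HahnSeries.order_mul (fieldHom_ne_zero K a hx) (fieldHom_ne_zero K a hy)]
  rfl

theorem min_value_le_value_add {x y : FractionRing (MvPolynomial (Fin 3) K)} (h : x + y ≠ 0) :
    min (value K a x) (value K a y) ≤ value K a (x + y) := by
  rw [value, value, value, map_add]
  exact HahnSeries.min_order_le_order_add (map_add (fieldHom K a) x y ▸ fieldHom_ne_zero K a h)

theorem value_algebraMap (f : MvPolynomial (Fin 3) K) :
    value K a (algebraMap _ _ f) = (seriesHom K a f).order := by
  rw [value, fieldHom_algebraMap]

variable {a} in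
theorem value_eq_order (ha : Monotone a) {x : FractionRing (MvPolynomial (Fin 3) K)} (hx : x ≠ 0)
    {f g : MvPolynomial (Fin 3) K} (hg : g ∉ mxyz K)
    (h : x * algebraMap _ _ g = algebraMap _ (FractionRing (MvPolynomial (Fin 3) K)) f) :
    f ≠ 0 ∧ value K a x = (seriesHom K a f).order := by
  have hg0 : g ≠ 0 := fun e => hg (e ▸ Ideal.zero_mem _)
  have hg0' : algebraMap _ (FractionRing (MvPolynomial (Fin 3) K)) g ≠ 0 := by simpa using hg0
  refine ⟨?_, ?_⟩
  · rintro rfl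
    rw [map_zero] at h
    exact mul_ne_zero hx hg0' h
  · rw [← value_algebraMap, ← h, value_mul K a hx hg0', value_algebraMap,
      (order_seriesHom_eq_zero_iff K ha hg0).2 hg, add_zero]

theorem algebraMap_mem_Rxyz (f : MvPolynomial (Fin 3) K) : algebraMap _ _ f ∈ Rxyz K :=
  ⟨f, 1, by simp [mem_mxyz_iff], by simp⟩

/-- A dyadic rational outside `2⁻ᵐ ℤ` generates, together with `1`, a group containing
`2⁻ᵐ ℤ`. -/
theorem exists_combination_eq_inv_two_pow {q : ℚ} (hq : q ∈ dyadicSet) (m : ℕ)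
    (h : ¬ ∃ z : ℤ, 2 ^ m * q = z) : ∃ α β : ℤ, α * q + β = 1 / 2 ^ m := by
  have hex : ∃ s : ℕ, ∃ z : ℤ, 2 ^ s * q = z := by
    obtain ⟨b, k, rfl⟩ := hq
    exact ⟨k, b, by field_simp⟩
  classical
  obtain ⟨p, hp⟩ := Nat.find_spec hex
  set s := Nat.find hex with hs
  have hms : m < s := by
    by_contra hle
    rw [not_lt] at hle
    exact h ⟨2 ^ (m - s) * p, by
      push_cast; rw [← hp, ← mul_assoc, ← pow_add, Nat.sub_add_cancel hle]⟩
  have hodd : ¬ (2 : ℤ) ∣ p := by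
    rintro ⟨r, rfl⟩
    refine Nat.find_min hex (m := s - 1) (by lia) ⟨r, ?_⟩
    have h2 : s = s - 1 + 1 := by lia
    rw [h2, pow_succ] at hp
    push_cast at hp
    linarith
  have hcop : IsCoprime p ((2 : ℤ) ^ s) :=
    ((Int.prime_two.coprime_iff_not_dvd.2 hodd).symm).pow_right
  obtain ⟨α, β, hαβ⟩ := hcop
  have hαβ' : (α : ℚ) * p + β * 2 ^ s = 1 := by exact_mod_cast hαβ
  refine ⟨2 ^ (s - m) * α, 2 ^ (s - m) * β, ?_⟩
  push_cast
  rw [pow_sub₀ _ two_ne_zero hms.le]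
  rw [← hp] at hαβ'
  field_simp
  linarith

variable {a} in
theorem range_value (ha : Monotone a) :
    {γ : ℚ ×ₗ ℤ | ∃ x : FractionRing (MvPolynomial (Fin 3) K), x ≠ 0 ∧ value K a x = γ}
      = {γ : ℚ ×ₗ ℤ | (ofLex γ).1 ∈ dyadicSet} := by
  let V := unitsValueHom (value K a) fun x y => value_mul K a
  have hV : ∀ f : MvPolynomial (Fin 3) K, f ≠ 0 → (seriesHom K a f).order ∈ V.range := by
    intro f hf
    have hf' : algebraMap _ (FractionRing (MvPolynomial (Fin 3) K)) f ≠ 0 := by simpa using hf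
    exact ⟨Additive.ofMul (Units.mk0 _ hf'), value_algebraMap K a f⟩
  ext γ
  constructor
  · rintro ⟨x, hx, rfl⟩
    obtain ⟨f, g, hg, rfl⟩ := IsFractionRing.div_surjective (A := MvPolynomial (Fin 3) K) x
    have hg0 : g ≠ 0 := nonZeroDivisors.ne_zero hg
    have hf0 : f ≠ 0 := by rintro rfl; simp at hx
    have hg0' : algebraMap _ (FractionRing (MvPolynomial (Fin 3) K)) g ≠ 0 := by simpa using hg0
    have h := value_mul K a hx hg0'
    rw [div_mul_cancel₀ _ hg0', value_algebraMap, value_algebraMap] at h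
    obtain ⟨b, k, hbk⟩ := (order_seriesHom_mem K ha hg0).1
    have hneg : -(ofLex (seriesHom K a g).order).1 ∈ dyadicSet :=
      ⟨-b, k, by rw [hbk]; push_cast; ring⟩
    have := add_mem_dyadicSet (order_seriesHom_mem K ha hf0).1 hneg
    rw [h, ofLex_add, Prod.fst_add, add_neg_cancel_right] at this
    exact this
  · intro hγ
    suffices h : γ ∈ V.range by
      obtain ⟨z, hz⟩ := h
      exact ⟨_, z.toMul.ne_zero, hz⟩
    have h10 : (toLex (1, 0) : ℚ ×ₗ ℤ) ∈ V.range := by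
      have := hV (X 1) (X_ne_zero _)
      rwa [seriesHom, aeval_X, Matrix.cons_val_one, Matrix.cons_val_zero,
        HahnSeries.order_single one_ne_zero] at this
    have h01 : (toLex (0, 1) : ℚ ×ₗ ℤ) ∈ V.range := by
      have := hV (X 2) (X_ne_zero _)
      rw [seriesHom, aeval_X] at this
      change (HahnSeries.single (toLex (0, 1) : ℚ ×ₗ ℤ) (1 : K)).order ∈ V.range at this
      rwa [HahnSeries.order_single one_ne_zero] at this
    obtain ⟨n, k, hnk⟩ := hγ
    obtain ⟨f, hf0, -, hf⟩ := exists_order_notMem_levelSubgroup K a k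
    set δ := (seriesHom K a f).order
    obtain ⟨α, β, hαβ⟩ := exists_combination_eq_inv_two_pow (order_seriesHom_mem K ha hf0).1 _ hf
    have hk : k ≤ dyadicLevel k := dyadicLevel_strictMono.le_apply
    set e : ℤ := n * 2 ^ (dyadicLevel k - k) with he
    have key : γ = e • (α • δ + β • toLex (1, 0)) +
        ((ofLex γ).2 - e * (α * (ofLex δ).2)) • toLex (0, 1) := by
      apply ofLex.injective
      ext
      · have : (e : ℚ) * (α * (ofLex δ).1 + β) = (ofLex γ).1 := by
          rw [hαβ, hnk, he]
          push_cast
          rw [pow_sub₀ _ two_ne_zero hk]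
          field_simp
        simpa using this.symm
      · simp
    rw [key]
    exact V.range.add_mem (V.range.zsmul_mem (V.range.add_mem (V.range.zsmul_mem (hV f hf0) _)
      (V.range.zsmul_mem h10 _)) _) (V.range.zsmul_mem h01 _)

/-- For an equivalent valuation, obtained by scaling the first coordinate, the least value with a
suitable first coordinate has large second coordinate. -/
theorem exists_isLeast_of_scaling {a : ℕ → ℕ} (ha : Monotone a)
    (ω : FractionRing (MvPolynomial (Fin 3) K) → ℚ ×ₗ ℤ) (c : ℚ) (hc : 0 < c)
    (hω : ∀ x, x ≠ 0 → (ofLex (ω x)).1 = c * (ofLex (value K a x)).1 ∧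
      (ofLex (ω x)).2 = (ofLex (value K a x)).2) (k : ℕ) :
    ∃ lam : ℚ,
      (∃ h : FractionRing (MvPolynomial (Fin 3) K),
        h ∈ Rxyz K ∧ h ≠ 0 ∧ (ofLex (ω h)).1 = lam) ∧
      0 ≤ lam ∧ lam < c * 2 ^ dyadicLevel k ∧
      ∃ lt : ℚ ×ₗ ℤ,
        IsLeast {γ : ℚ ×ₗ ℤ | ∃ h : FractionRing (MvPolynomial (Fin 3) K),
          h ∈ Rxyz K ∧ h ≠ 0 ∧ (ofLex (ω h)).1 = lam ∧ ω h = γ} lt ∧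
        (a k : ℤ) ≤ (ofLex lt).2 := by
  obtain ⟨f, hf0, hlt, hlevel⟩ := exists_order_notMem_levelSubgroup K a k
  set δ := (seriesHom K a f).order with hδ
  have hf0' : algebraMap _ (FractionRing (MvPolynomial (Fin 3) K)) f ≠ 0 := by simpa using hf0
  have hfω : (ofLex (ω (algebraMap _ _ f))).1 = c * (ofLex δ).1 := by
    rw [(hω _ hf0').1, value_algebraMap]
  have hbound : ∀ h ∈ Rxyz K, h ≠ 0 → (ofLex (ω h)).1 = c * (ofLex δ).1 →
      (a k : ℤ) ≤ (ofLex (ω h)).2 := by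
    rintro h ⟨p, q, hq, hpq⟩ hh0 hh
    obtain ⟨hp0, hval⟩ := value_eq_order K ha hh0 hq hpq
    rw [(hω h hh0).1] at hh
    have hfst := mul_left_cancel₀ hc.ne' hh
    rw [(hω h hh0).2, hval]
    refine (order_seriesHom_mem K ha hp0).2.2.2 k fun hmem => hlevel ?_
    rw [mem_levelSubgroup] at hmem ⊢
    rwa [← hfst, hval]
  refine ⟨c * (ofLex δ).1, ⟨_, algebraMap_mem_Rxyz K f, hf0', hfω⟩,
    mul_nonneg hc.le (order_seriesHom_mem K ha hf0).2.1, mul_lt_mul_of_pos_left hlt hc, ?_⟩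
  obtain ⟨m, ⟨h, hR, h0, h1, hm⟩, hmin⟩ := Int.exists_least_of_bdd
    (P := fun m => ∃ h : FractionRing (MvPolynomial (Fin 3) K),
      h ∈ Rxyz K ∧ h ≠ 0 ∧ (ofLex (ω h)).1 = c * (ofLex δ).1 ∧ (ofLex (ω h)).2 = m)
    ⟨a k, fun m ⟨h, hR, h0, h1, hm⟩ => hm ▸ hbound h hR h0 h1⟩
    ⟨_, _, algebraMap_mem_Rxyz K f, hf0', hfω, rfl⟩
  refine ⟨ω h, ⟨⟨h, hR, h0, h1, rfl⟩, ?_⟩, hbound h hR h0 h1⟩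
  rintro _ ⟨h', hR', h0', h1', rfl⟩
  rw [Prod.Lex.le_iff]
  exact Or.inr ⟨h1.trans h1'.symm, hm ▸ hmin _ ⟨h', hR', h0', h1', rfl⟩⟩

end WildSeries

theorem exists_monotone_nat_gt (g : ℕ → ℤ) : ∃ a : ℕ → ℕ, Monotone a ∧ ∀ k, g k < a k := by
  refine ⟨fun k => ∑ i ∈ Finset.range (k + 1), ((g i).toNat + 1), fun i j hij => ?_, fun k => ?_⟩
  · exact Finset.sum_le_sum_of_subset (Finset.range_subset_range.2 (by lia))
  · have h : (g k).toNat + 1 ≤ ∑ i ∈ Finset.range (k + 1), ((g i).toNat + 1) :=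
      Finset.single_le_sum (f := fun i => (g i).toNat + 1) (fun _ _ => Nat.zero_le _)
        (Finset.self_mem_range_succ k)
    have := Int.self_le_toNat (g k)
    lia

theorem StrictMono.exists_le_and_lt_succ {B : ℕ → ℕ} (hB : StrictMono B) {m n : ℕ}
    (h : B m ≤ n) : ∃ k, m ≤ k ∧ B k ≤ n ∧ n < B (k + 1) := by
  have hmn : m ≤ n := hB.le_apply.trans h
  refine ⟨Nat.findGreatest (fun k => B k ≤ n) n, Nat.le_findGreatest hmn h,
    Nat.findGreatest_spec (P := fun k => B k ≤ n) hmn h, ?_⟩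
  by_contra hle
  rw [not_lt] at hle
  have := Nat.le_findGreatest (P := fun k => B k ≤ n) (hB.le_apply.trans hle) hle
  lia

/-- **Example of increasing tilde function.**  Given a nondecreasing
`g : ℕ → ℤ`, there is a valuation `ν` of `K(x,y,z)` with value group exactly `H × ℤ`
(`H = ℤ[1/2]`), lexicographically ordered, dominating `R = K[x,y,z]_{(x,y,z)}`, such that for
every equivalent valuation `ω` with value group `H × ℤ` there is `n₀` such that for all
`n ≥ n₀` there is `λ ∈ ω₂(R∖{0}) ∩ [0, n)` with `π₂(λ̃) > g(n)`. -/
theorem stmt18 (K : Type*) [Field K] (g : ℕ → ℤ) (hg : ∀ m n : ℕ, n ≤ m → g n ≤ g m) :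
    ∃ ν : FractionRing (MvPolynomial (Fin 3) K) → ℚ ×ₗ ℤ,
      (∀ x y : FractionRing (MvPolynomial (Fin 3) K), x ≠ 0 → y ≠ 0 →
        ν (x * y) = ν x + ν y) ∧
      (∀ x y : FractionRing (MvPolynomial (Fin 3) K), x ≠ 0 → y ≠ 0 → x + y ≠ 0 →
        min (ν x) (ν y) ≤ ν (x + y)) ∧
      -- the value group is exactly `H × ℤ`
      ({γ : ℚ ×ₗ ℤ | ∃ x : FractionRing (MvPolynomial (Fin 3) K), x ≠ 0 ∧ ν x = γ}
        = {γ : ℚ ×ₗ ℤ | (ofLex γ).1 ∈ dyadicSet}) ∧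
      -- `ν` dominates `R`
      (∀ x ∈ Rxyz K, x ≠ 0 → 0 ≤ ν x) ∧
      (∀ x ∈ mRxyz K, x ≠ 0 → 0 < ν x) ∧
      (∀ x ∈ Rxyz K, x ≠ 0 → 0 < ν x → x ∈ mRxyz K) ∧
      -- the wild behavior of the tilde function, for any equivalent valuation
      (∀ ω : FractionRing (MvPolynomial (Fin 3) K) → ℚ ×ₗ ℤ,
        (∀ x y : FractionRing (MvPolynomial (Fin 3) K), x ≠ 0 → y ≠ 0 →
          ω (x * y) = ω x + ω y) →
        (∀ x y : FractionRing (MvPolynomial (Fin 3) K), x ≠ 0 → y ≠ 0 → x + y ≠ 0 →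
          min (ω x) (ω y) ≤ ω (x + y)) →
        ({γ : ℚ ×ₗ ℤ | ∃ x : FractionRing (MvPolynomial (Fin 3) K), x ≠ 0 ∧ ω x = γ}
          = {γ : ℚ ×ₗ ℤ | (ofLex γ).1 ∈ dyadicSet}) →
        -- `ω` is equivalent to `ν`: they have the same valuation ring
        ({x : FractionRing (MvPolynomial (Fin 3) K) | x = 0 ∨ 0 ≤ ν x}
          = {x : FractionRing (MvPolynomial (Fin 3) K) | x = 0 ∨ 0 ≤ ω x}) →
        ∃ n₀ : ℕ, ∀ n : ℕ, n₀ ≤ n →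
          ∃ lam : ℚ,
            (∃ g : FractionRing (MvPolynomial (Fin 3) K),
              g ∈ Rxyz K ∧ g ≠ 0 ∧ (ofLex (ω g)).1 = lam) ∧
            0 ≤ lam ∧ lam < (n : ℚ) ∧
            ∃ lt : ℚ ×ₗ ℤ,
              IsLeast {γ : ℚ ×ₗ ℤ | ∃ g : FractionRing (MvPolynomial (Fin 3) K),
                g ∈ Rxyz K ∧ g ≠ 0 ∧ (ofLex (ω g)).1 = lam ∧ ω g = γ} lt ∧
              g n < (ofLex lt).2) := by
  have hB : StrictMono fun k => k * 2 ^ dyadicLevel k := strictMono_nat_of_lt_succ fun k => by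
    have : 2 ^ dyadicLevel k ≤ 2 ^ dyadicLevel (k + 1) :=
      Nat.pow_le_pow_right two_pos (dyadicLevel_strictMono.monotone (Nat.le_succ k))
    have hpos : 0 < 2 ^ dyadicLevel (k + 1) := by positivity
    nlinarith
  obtain ⟨a, ha, hag⟩ := exists_monotone_nat_gt fun k => g ((k + 1) * 2 ^ dyadicLevel (k + 1))
  have hνG := WildSeries.range_value K ha
  refine ⟨WildSeries.value K a, fun x y => WildSeries.value_mul K a,
    fun x y _ _ => WildSeries.min_value_le_value_add K a, hνG, ?_, ?_, ?_, ?_⟩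
  · rintro x ⟨p, q, hq, h⟩ hx
    obtain ⟨hp0, hval⟩ := WildSeries.value_eq_order K ha hx hq h
    rw [hval]
    exact WildSeries.nonneg_of_mem_boundSubmonoid a (WildSeries.order_seriesHom_mem K ha hp0)
  · rintro x ⟨p, q, hp, hq, h⟩ hx
    obtain ⟨hp0, hval⟩ := WildSeries.value_eq_order K ha hx hq h
    rw [hval]
    refine (WildSeries.nonneg_of_mem_boundSubmonoid a
      (WildSeries.order_seriesHom_mem K ha hp0)).lt_of_ne' fun e => ?_
    exact (WildSeries.order_seriesHom_eq_zero_iff K ha hp0).1 e hp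
  · rintro x ⟨p, q, hq, h⟩ hx hpos
    obtain ⟨hp0, hval⟩ := WildSeries.value_eq_order K ha hx hq h
    refine ⟨p, q, ?_, hq, h⟩
    by_contra hp
    rw [hval, (WildSeries.order_seriesHom_eq_zero_iff K ha hp0).2 hp] at hpos
    exact lt_irrefl _ hpos
  · intro ω hω _ hωG hequiv
    obtain ⟨c, hc, hscale⟩ := exists_scaling_of_equivalent (WildSeries.value K a) ω
      (fun x y => WildSeries.value_mul K a) hω hνG hωG hequiv
    refine ⟨⌈c⌉₊ * 2 ^ dyadicLevel ⌈c⌉₊, fun n hn => ?_⟩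
    obtain ⟨k, hk, hkn, hnk⟩ := hB.exists_le_and_lt_succ hn
    obtain ⟨lam, hex, h0, hlt, lt, hleast, hlarge⟩ :=
      WildSeries.exists_isLeast_of_scaling K ha ω c hc hscale k
    refine ⟨lam, hex, h0, hlt.trans_le ?_, lt, hleast, ?_⟩
    · have hck : c ≤ k := (Nat.le_ceil c).trans (Nat.cast_le.2 hk)
      calc c * 2 ^ dyadicLevel k ≤ k * 2 ^ dyadicLevel k := by gcongr
        _ ≤ n := by exact_mod_cast hkn
    · exact ((hg _ _ hnk.le).trans_lt (hag k)).trans_le hlarge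
end
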